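/- Let F ∈ C^∞(T⁵) satisfy the normalization condition (N): ∫_{[0,1]⁵}(e^F − 1) dx = 0. Then there exists φ ∈ C^∞(T⁵) with ∫_{[−1/2,1/2]⁵} φ = 0 solving equation (★): (φ_{11}+φ_{22}+φ_{33}+φ_{44}+1)(φ_{55}+1) − φ_{15}² − φ_{25}² − φ_{35}² − φ_{45}² = e^F on all of ℝ⁵. -/

import Mathlib

open MeasureTheory

/-- Partial derivative in the `i`-th coordinate direction. -/
noncomputable def pd {n : ℕ} (i : Fin n) (f : (Fin n → ℝ) → ℝ) : (Fin n → ℝ) → ℝ :=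
  fun x => fderiv ℝ f x (Pi.single i 1)

/-- Second partial derivative `∂²f/∂x^i∂x^j`. -/
noncomputable def pd2 {n : ℕ} (i j : Fin n) (f : (Fin n → ℝ) → ℝ) : (Fin n → ℝ) → ℝ :=
  pd i (pd j f)

/-- A function on `ℝⁿ` that is `1`-periodic in every coordinate, i.e. a function on `Tⁿ`. -/
def PeriodicPi {n : ℕ} (f : (Fin n → ℝ) → ℝ) : Prop :=
  ∀ x : Fin n → ℝ, ∀ i : Fin n, f (x + Pi.single i 1) = f x

/-- Equation (★): the reduction of the quaternionic Monge–Ampère equation to `T⁵`. -/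
def EqStar (F φ : (Fin 5 → ℝ) → ℝ) : Prop :=
  ∀ x : Fin 5 → ℝ,
    (pd2 0 0 φ x + pd2 1 1 φ x + pd2 2 2 φ x + pd2 3 3 φ x + 1) * (pd2 4 4 φ x + 1)
      - (pd2 0 4 φ x) ^ 2 - (pd2 1 4 φ x) ^ 2 - (pd2 2 4 φ x) ^ 2 - (pd2 3 4 φ x) ^ 2
      = Real.exp (F x)

namespace TorusMA

open Filter Topology
open scoped ContDiff

/-! ### Smooth periodic functions on `ℝ⁵` and their partial derivatives -/

/-- The algebra of smooth functions on `T⁵`, as a subalgebra of all functions on `ℝ⁵`. -/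
def smoothPeriodic : Subalgebra ℝ ((Fin 5 → ℝ) → ℝ) where
  carrier := {f | ContDiff ℝ (⊤ : ℕ∞) f ∧ PeriodicPi f}
  mul_mem' := fun ⟨hf, hf'⟩ ⟨hg, hg'⟩ => ⟨hf.mul hg, fun x i => by simp [hf' x i, hg' x i]⟩
  add_mem' := fun ⟨hf, hf'⟩ ⟨hg, hg'⟩ => ⟨hf.add hg, fun x i => by simp [hf' x i, hg' x i]⟩
  algebraMap_mem' := fun r => ⟨contDiff_const, fun _ _ => rfl⟩

/-- Smooth functions on `T⁵`. -/
abbrev SP : Type := smoothPeriodic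

lemma SP.contDiff (f : SP) : ContDiff ℝ (⊤ : ℕ∞) (f : (Fin 5 → ℝ) → ℝ) := f.2.1

lemma SP.differentiable (f : SP) : Differentiable ℝ (f : (Fin 5 → ℝ) → ℝ) :=
  f.contDiff.differentiable (by simp)

lemma SP.continuous (f : SP) : Continuous (f : (Fin 5 → ℝ) → ℝ) := f.contDiff.continuous

lemma SP.periodic (f : SP) : PeriodicPi (f : (Fin 5 → ℝ) → ℝ) := f.2.2

lemma pd_mem (j : Fin 5) {f : (Fin 5 → ℝ) → ℝ} (hf : f ∈ smoothPeriodic) :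
    pd j f ∈ smoothPeriodic := by
  refine ⟨?_, fun x i => ?_⟩
  · have h : ContDiff ℝ (⊤ : ℕ∞) (fderiv ℝ f) := hf.1.fderiv_right (by simp)
    exact h.clm_apply contDiff_const
  · have h : (fun y => f (y + Pi.single i 1)) = f := funext fun y => hf.2 y i
    unfold pd
    conv_rhs => rw [← h]
    rw [fderiv_comp_add_right]

/-- Partial derivative as a derivation of the algebra of smooth functions on `T⁵`. -/
noncomputable def dSP (j : Fin 5) : Derivation ℝ SP SP :=
  Derivation.mk'
    { toFun := fun f => ⟨pd j f, pd_mem j f.2⟩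
      map_add' := fun f g => by
        ext x
        simp [pd, fderiv_add (f.differentiable x) (g.differentiable x)]
      map_smul' := fun c f => by
        ext x
        simp [pd, fderiv_const_smul (f.differentiable x) c] }
    (fun f g => by
      ext x
      simp [pd, fderiv_mul (f.differentiable x) (g.differentiable x)])

lemma dSP_coe (j : Fin 5) (f : SP) : ((dSP j f : SP) : (Fin 5 → ℝ) → ℝ) = pd j f := rfl

lemma dSP_comm (i j : Fin 5) (f : SP) : dSP i (dSP j f) = dSP j (dSP i f) := by
  ext x
  have h2 : ∀ v : Fin 5 → ℝ, ∀ w, fderiv ℝ (fun y => fderiv ℝ f.1 y v) x w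
      = fderiv ℝ (fderiv ℝ f.1) x w v := by
    intro v w
    have h : DifferentiableAt ℝ (fderiv ℝ (f : (Fin 5 → ℝ) → ℝ)) x :=
      (f.contDiff.fderiv_right (m := (⊤ : ℕ∞)) (by simp)).differentiable (by simp) x
    rw [fderiv_clm_apply h (by fun_prop)]
    simp
  have hs : IsSymmSndFDerivAt ℝ (f : (Fin 5 → ℝ) → ℝ) x :=
    (f.contDiff.contDiffAt).isSymmSndFDerivAt 
      (by simpa using WithTop.coe_le_coe.2 (le_top : (2 : ℕ∞) ≤ ⊤))
  simp only [dSP_coe]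
  unfold pd
  rw [h2, h2, hs]

lemma periodic_shift {E : Type*} {f : (Fin 5 → ℝ) → E}
    (hf : ∀ x : Fin 5 → ℝ, ∀ i : Fin 5, f (x + Pi.single i 1) = f x)
    (x : Fin 5 → ℝ) (n : Fin 5 → ℤ) : f (fun i => x i + n i) = f x := by
  have h1 : ∀ (i : Fin 5) (k : ℕ) (x : Fin 5 → ℝ), f (x + Pi.single i (k : ℝ)) = f x := by
    intro i k
    induction k with
    | zero => intro x; simp
    | succ k ih =>
      intro x
      rw [show x + Pi.single i ((k + 1 : ℕ) : ℝ) = (x + Pi.single i (k : ℝ)) + Pi.single i 1 by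
        rw [add_assoc, ← Pi.single_add]; push_cast; rfl, hf, ih]
  have h2 : ∀ (i : Fin 5) (k : ℤ) (x : Fin 5 → ℝ), f (x + Pi.single i (k : ℝ)) = f x := by
    intro i k x
    obtain ⟨m, rfl | rfl⟩ := k.eq_nat_or_neg
    · exact_mod_cast h1 i m x
    · rw [← h1 i m (x + _), add_assoc, ← Pi.single_add]; simp
  have h3 : (fun i => x i + (n i : ℝ)) = x + Pi.single 0 (n 0 : ℝ) + Pi.single 1 (n 1 : ℝ)
      + Pi.single 2 (n 2 : ℝ) + Pi.single 3 (n 3 : ℝ) + Pi.single 4 (n 4 : ℝ) := by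
    ext i; fin_cases i <;> simp
  rw [h3, h2, h2, h2, h2, h2]

lemma SP.exists_mem_cube (f : SP) (x : Fin 5 → ℝ) :
    ∃ y ∈ Set.Icc (0 : Fin 5 → ℝ) 1, f.1 y = f.1 x := by
  refine ⟨fun i => x i + ((-⌊x i⌋ : ℤ) : ℝ), ⟨fun i => ?_, fun i => ?_⟩,
    periodic_shift f.periodic x fun i => -⌊x i⌋⟩
  · have := Int.floor_le (x i); simp; linarith
  · have := (Int.lt_floor_add_one (x i)).le; simp; linarith

lemma SP.exists_max (f : SP) : ∃ x, ∀ y, f.1 y ≤ f.1 x := by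
  obtain ⟨x, -, hx⟩ := (isCompact_Icc (a := (0 : Fin 5 → ℝ)) (b := 1)).exists_isMaxOn
    ⟨0, by simp⟩ f.continuous.continuousOn
  refine ⟨x, fun y => ?_⟩
  obtain ⟨z, hz, hzy⟩ := f.exists_mem_cube y
  exact hzy ▸ hx hz

/-- A bounded function has a bound depending only on the function. -/
lemma SP.exists_bound (f : SP) : ∃ C, ∀ y, |f.1 y| ≤ C := by
  obtain ⟨x, hx⟩ := f.exists_max
  obtain ⟨z, hz⟩ := (-f).exists_max
  refine ⟨max (f.1 x) (-f.1 z), fun y => abs_le'.2 ⟨(hx y).trans (le_max_left _ _), ?_⟩⟩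
  exact (show -f.1 y ≤ -f.1 z from hz y).trans (le_max_right _ _)

lemma fderiv_apply_eq_sum (f : SP) (x v : Fin 5 → ℝ) :
    fderiv ℝ (f : (Fin 5 → ℝ) → ℝ) x v = ∑ j, v j * (dSP j f).1 x := by
  conv_lhs => rw [pi_eq_sum_univ' v]
  rw [map_sum]
  refine Finset.sum_congr rfl fun j _ => ?_
  rw [map_smul, smul_eq_mul]
  rfl

lemma hasDerivAt_line (f : SP) (x v : Fin 5 → ℝ) (s : ℝ) :
    HasDerivAt (fun s : ℝ => f.1 (x + s • v)) (∑ j, v j * (dSP j f).1 (x + s • v)) s := by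
  have h1 : HasDerivAt (fun s : ℝ => x + s • v) v s := by
    simpa using ((hasDerivAt_id s).smul_const v).const_add x
  have h2 := (f.differentiable (x + s • v)).hasFDerivAt.comp_hasDerivAt s h1
  rw [fderiv_apply_eq_sum] at h2
  exact h2

/-- First and second order conditions at a maximum. -/
lemma SP.max_principle (f : SP) : ∃ x, (∀ y, f.1 y ≤ f.1 x) ∧ (∀ j, (dSP j f).1 x = 0) ∧
    ∀ v : Fin 5 → ℝ, ∑ j, ∑ k, v j * v k * (dSP k (dSP j f)).1 x ≤ 0 := by
  obtain ⟨x, hx⟩ := f.exists_max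
  have hmax : IsLocalMax f.1 x := Filter.Eventually.of_forall hx
  refine ⟨x, hx, fun j => ?_, fun v => ?_⟩
  · simp only [dSP_coe, pd]
    rw [hmax.fderiv_eq_zero]; rfl
  · by_contra! hpos
    have hd1 : ∀ s, HasDerivAt (fun s : ℝ => f.1 (x + s • v))
        (∑ j, v j * (dSP j f).1 (x + s • v)) s := hasDerivAt_line f x v
    have hd : deriv (fun s : ℝ => f.1 (x + s • v))
        = fun s => ∑ j, v j * (dSP j f).1 (x + s • v) := funext fun s => (hd1 s).deriv
    have hd2 : HasDerivAt (fun s : ℝ => ∑ j, v j * (dSP j f).1 (x + s • v))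
        (∑ j, ∑ k, v j * v k * (dSP k (dSP j f)).1 x) 0 := by
      have : ∀ j ∈ (Finset.univ : Finset (Fin 5)),
          HasDerivAt (fun s : ℝ => v j * (dSP j f).1 (x + s • v))
          (∑ k, v j * v k * (dSP k (dSP j f)).1 x) 0 := by
        intro j _
        have := (hasDerivAt_line (dSP j f) x v 0).const_mul (v j)
        simpa [Finset.mul_sum, mul_assoc] using this
      simpa using HasDerivAt.fun_sum this
    have h0 : deriv (fun s : ℝ => f.1 (x + s • v)) 0 = 0 := by
      have : IsLocalMax (fun s : ℝ => f.1 (x + s • v)) 0 :=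
        Filter.Eventually.of_forall fun s => by simpa using hx _
      exact this.deriv_eq_zero
    have hmin : IsLocalMin (fun s : ℝ => f.1 (x + s • v)) 0 := by
      apply isLocalMin_of_deriv_deriv_pos _ h0 (hd1 0).continuousAt
      rw [hd, hd2.deriv]; exact hpos
    have hev : (fun s : ℝ => f.1 (x + s • v)) =ᶠ[𝓝 0] fun _ => f.1 x := by
      filter_upwards [hmin] with s hs
      refine le_antisymm (hx _) (by simpa using hs)
    have := hev.deriv.deriv.eq_of_nhds
    rw [hd, hd2.deriv] at this
    simp at this
    linarith

end TorusMA

namespace TorusMA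

open Filter Topology
open scoped ContDiff

/-! ### Families of smooth functions and uniform bounds -/

section Families

variable {ι : Type*}

/-- Partial derivative of a family of smooth functions on `T⁵`. -/
noncomputable def dF (j : Fin 5) : Derivation ℝ (ι → SP) (ι → SP) :=
  Derivation.mk'
    { toFun := fun f i => dSP j (f i)
      map_add' := fun f g => by ext1 i; simp
      map_smul' := fun c f => by ext1 i; simp }
    (fun f g => by ext1 i; simp)

lemma dF_apply (j : Fin 5) (f : ι → SP) (i : ι) : dF j f i = dSP j (f i) := rfl

lemma dF_comm (j k : Fin 5) (f : ι → SP) : dF j (dF k f) = dF k (dF j f) :=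
  funext fun i => dSP_comm j k (f i)

/-- Evaluation of a family at a parameter and a point. -/
def ev (z : ι × (Fin 5 → ℝ)) : (ι → SP) →ₐ[ℝ] ℝ :=
  (Pi.evalAlgHom ℝ (fun _ : Fin 5 → ℝ => ℝ) z.2).comp
    (smoothPeriodic.val.comp (Pi.evalAlgHom ℝ (fun _ : ι => SP) z.1))

lemma ev_apply (z : ι × (Fin 5 → ℝ)) (f : ι → SP) : ev z f = (f z.1).1 z.2 := rfl

lemma family_ext {f g : ι → SP} (h : ∀ z, ev z f = ev z g) : f = g := by
  ext i x; exact h (i, x)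

/-- Boundedness on `T⁵`, uniformly over the family. -/
def Bdd (f : ι → SP) : Prop := ∃ C, ∀ z, |ev z f| ≤ C

lemma Bdd.exists_pos {f : ι → SP} (h : Bdd f) : ∃ C, 0 < C ∧ ∀ z, |ev z f| ≤ C := by
  obtain ⟨C, hC⟩ := h
  exact ⟨max C 1, by positivity, fun z => (hC z).trans (le_max_left _ _)⟩

lemma exists_uniform {κ : Type*} [Fintype κ] {f : κ → ι → SP} (h : ∀ k, Bdd (f k)) :
    ∃ C, 0 < C ∧ ∀ k z, |ev z (f k)| ≤ C := by
  choose C hC0 hC using fun k => (h k).exists_pos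
  exact ⟨1 + ∑ k, C k, by have := Finset.sum_nonneg fun k (_ : k ∈ Finset.univ) => (hC0 k).le
                          linarith,
    fun k z => (hC k z).trans ((Finset.single_le_sum (f := C) (fun k _ => (hC0 k).le)
      (Finset.mem_univ k)).trans (by linarith))⟩

/-- Iterated partial derivative along a list of directions. -/
noncomputable def dList : List (Fin 5) → (ι → SP) → (ι → SP)
  | [], f => f
  | j :: l, f => dF j (dList l f)

/-- First and second order conditions at a maximum of a member of a family. -/
lemma exists_max_of_family (g : ι → SP) (i : ι) :
    ∃ x, (∀ y, ev (i, y) g ≤ ev (i, x) g) ∧ (∀ j, ev (i, x) (dF j g) = 0) ∧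
      ∀ (α : Fin 5) (a b : ℝ), a * a * ev (i, x) (dF α (dF α g))
        + 2 * (a * b) * ev (i, x) (dF α (dF 4 g)) + b * b * ev (i, x) (dF 4 (dF 4 g)) ≤ 0 := by
  obtain ⟨x, hx, hx1, hx2⟩ := (g i).max_principle
  refine ⟨x, hx, hx1, fun α a b => ?_⟩
  have h2 := hx2 (Pi.single α a + Pi.single 4 b)
  have hs : ∀ j k, (dSP k (dSP j (g i))).1 x = ev (i, x) (dF k (dF j g)) := fun _ _ => rfl
  simp only [hs, Pi.add_apply, Pi.single_apply, add_mul, mul_add, Finset.sum_add_distrib, ite_mul,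
    mul_ite, zero_mul, mul_zero, Finset.sum_ite_eq', Finset.mem_univ, if_true] at h2
  rw [dF_comm 4 α] at h2
  linarith

end Families

/-! ### Commuting frames -/

/-- The frame `D_α = e_α ∂_α + V_α ∂₅`, with `e_α = 1` for the first four indices
and `e_α = 0` for the last. -/
noncomputable def frame {ι : Type*} (V : Fin 5 → ι → SP) (α : Fin 5) :
    Derivation ℝ (ι → SP) (ι → SP) :=
  (if α = 4 then 0 else 1 : ι → SP) • dF α + V α • dF 4

/-- The data of a family of solutions in the variables obtained by partial Legendre transform:
the gradient `V` of the last coordinate with respect to the commuting frame, the right-hand side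
`f` and the inverse `B` of the last component of `V`. -/
structure LegendreData {ι : Type*} (V : Fin 5 → ι → SP) (f B : ι → SP) : Prop where
  symm : ∀ α β, frame V α (V β) = frame V β (V α)
  pde : (∑ i : Fin 4, frame V i.castSucc (V i.castSucc)) + frame V 4 (f * V 4) = 0
  inv : V 4 * B = 1
  pos : ∃ c, 0 < c ∧ ∀ z, c ≤ ev z f
  bdd_f : ∀ l, Bdd (dList l f)
  bdd_V : ∀ α, Bdd (V α)
  bdd_B : Bdd B

section Bernstein

variable {ι : Type*} {V : Fin 5 → ι → SP} {f B : ι → SP}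

lemma frame_apply (V : Fin 5 → ι → SP) (α : Fin 5) (g : ι → SP) :
    frame V α g = (if α = 4 then 0 else 1) * dF α g + V α * dF 4 g := rfl

lemma LegendreData.comm (h : LegendreData V f B) (α β : Fin 5) (g : ι → SP) :
    frame V α (frame V β g) = frame V β (frame V α g) := by
  have hs := h.symm α β
  have e : ∀ α : Fin 5, ∀ j : Fin 5, dF j (if α = 4 then 0 else 1 : ι → SP) = 0 := by
    intro α j; split_ifs <;> simp
  simp only [frame_apply, map_add, Derivation.leibniz, smul_eq_mul, e] at hs ⊢
  rw [dF_comm β α, dF_comm 4 β, dF_comm 4 α]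
  linear_combination hs * dF 4 g

/-- The weights of the second order operator `∑ D_i² + f D_5²`. -/
noncomputable def wt (f : ι → SP) (α : Fin 5) : ι → SP := if α = 4 then f else 1

/-- The second order operator `∑ D_i² + f D_5²`. -/
noncomputable def opL (V : Fin 5 → ι → SP) (f g : ι → SP) : ι → SP :=
  ∑ α, wt f α * frame V α (frame V α g)

lemma opL_eq (V : Fin 5 → ι → SP) (f g : ι → SP) :
    opL V f g = (∑ i : Fin 4, frame V i.castSucc (frame V i.castSucc g))
      + f * frame V 4 (frame V 4 g) := by
  simp [opL, wt, Fin.sum_univ_succ]; ring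

lemma opL_add (g g' : ι → SP) : opL V f (g + g') = opL V f g + opL V f g' := by
  simp [opL, mul_add, Finset.sum_add_distrib]

lemma opL_sum {κ : Type*} (s : Finset κ) (g : κ → ι → SP) :
    opL V f (∑ k ∈ s, g k) = ∑ k ∈ s, opL V f (g k) := by
  simp only [opL, map_sum, Finset.mul_sum]
  exact Finset.sum_comm

lemma opL_mul (g g' : ι → SP) : opL V f (g * g')
    = g * opL V f g' + g' * opL V f g + 2 * ∑ α, wt f α * (frame V α g * frame V α g') := by
  simp only [opL, Derivation.leibniz, map_add, smul_eq_mul, Finset.mul_sum,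
    ← Finset.sum_add_distrib]
  refine Finset.sum_congr rfl fun α _ => ?_
  ring

lemma opL_const (c : ℝ) : opL V f (algebraMap ℝ (ι → SP) c) = 0 := by
  simp [opL]

lemma LegendreData.opL_frame (h : LegendreData V f B) (β : Fin 5) (g : ι → SP) :
    opL V f (frame V β g) = frame V β (opL V f g) - frame V β f * frame V 4 (frame V 4 g) := by
  simp only [opL_eq, map_add, map_sum, Derivation.leibniz, smul_eq_mul]
  have : ∀ α, frame V α (frame V α (frame V β g)) = frame V β (frame V α (frame V α g)) := by
    intro α; rw [h.comm α β g, h.comm α β]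
  simp only [this]
  ring

lemma LegendreData.opL_V (h : LegendreData V f B) (α : Fin 5) :
    opL V f (V α) = - (frame V α f * frame V 4 (V 4)) - frame V α (frame V 4 f * V 4) := by
  have h1 := congrArg (frame V α) h.pde
  simp only [map_add, map_sum, Derivation.leibniz, smul_eq_mul, map_zero] at h1
  have : ∀ β, frame V β (frame V β (V α)) = frame V α (frame V β (V β)) := by
    intro β; rw [h.symm β α, h.comm β α]
  simp only [opL_eq, this, Derivation.leibniz, smul_eq_mul]
  linear_combination h1

/-- At a maximum of `g` the frame derivatives vanish and `opL g ≤ 0`. -/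
lemma LegendreData.max_principle (h : LegendreData V f B) (g : ι → SP) (i : ι) :
    ∃ x, (∀ y, ev (i, y) g ≤ ev (i, x) g) ∧ (∀ α, ev (i, x) (frame V α g) = 0) ∧
      ev (i, x) (opL V f g) ≤ 0 := by
  obtain ⟨x, hx, hd, hx2⟩ := exists_max_of_family g i
  refine ⟨x, hx, fun α => by
    simp only [frame_apply, map_add, map_mul, hd, mul_zero, add_zero], ?_⟩
  obtain ⟨c, hc, hf⟩ := h.pos
  unfold opL
  rw [map_sum]
  refine Finset.sum_nonpos fun α _ => ?_
  have hw : 0 ≤ ev (i, x) (wt f α) := by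
    unfold wt; split_ifs
    · exact hc.le.trans (hf _)
    · simp
  rw [map_mul]
  refine mul_nonpos_of_nonneg_of_nonpos hw ?_
  set e : ℝ := if α = 4 then 0 else 1 with he
  have e1 : ∀ j : Fin 5, dF j (if α = 4 then 0 else 1 : ι → SP) = 0 := by
    intro j; split_ifs <;> simp
  have e2 : ev (i, x) (if α = 4 then 0 else 1 : ι → SP) = e := by
    rw [he]; split_ifs <;> simp
  have h2 := hx2 α e (ev (i, x) (V α))
  simp only [frame_apply, map_add, Derivation.leibniz, smul_eq_mul, e1, map_mul, hd, e2, map_zero,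
    dF_comm 4 α]
  linarith

/-! ### Weighted monomials in the frame derivatives of `V` -/

/-- The iterated frame derivatives of length `k` of the components of `V`. -/
noncomputable def word (V : Fin 5 → ι → SP) : (k : ℕ) → (Fin (k + 1) → Fin 5) → ι → SP
  | 0, v => V (v 0)
  | k + 1, v => frame V (v 0) (word V k (Fin.tail v))

/-- Polynomials in `B`, the derivatives of `f` and the frame derivatives of `V`, of total
weight at most `d`, where a frame derivative of length `k` has weight `k`. -/
inductive Weighted (V : Fin 5 → ι → SP) (f B : ι → SP) : ℕ → (ι → SP) → Prop
  | const (c : ℝ) : Weighted V f B 0 (algebraMap ℝ (ι → SP) c)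
  | deriv_f (l : List (Fin 5)) : Weighted V f B 0 (dList l f)
  | inv : Weighted V f B 0 B
  | word (k : ℕ) (v : Fin (k + 1) → Fin 5) : Weighted V f B k (word V k v)
  | mono {d d' : ℕ} {g : ι → SP} : d ≤ d' → Weighted V f B d g → Weighted V f B d' g
  | add {d : ℕ} {g g' : ι → SP} : Weighted V f B d g → Weighted V f B d g' →
      Weighted V f B d (g + g')
  | mul {d d' : ℕ} {g g' : ι → SP} : Weighted V f B d g → Weighted V f B d' g' →
      Weighted V f B (d + d') (g * g')

lemma Weighted.neg {d : ℕ} {g : ι → SP} (h : Weighted V f B d g) : Weighted V f B d (-g) := by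
  have := (Weighted.const (V := V) (f := f) (B := B) (-1)).mul h
  have e : -g = algebraMap ℝ (ι → SP) (-1) * g := by rw [map_neg, map_one]; ring
  rwa [zero_add, ← e] at this

lemma Weighted.sub {d : ℕ} {g g' : ι → SP} (h : Weighted V f B d g) (h' : Weighted V f B d g') :
    Weighted V f B d (g - g') := by
  rw [sub_eq_add_neg]; exact h.add h'.neg

lemma Weighted.of_V (α : Fin 5) : Weighted V f B 0 (V α) := Weighted.word 0 fun _ => α

lemma Weighted.of_f : Weighted V f B 0 f := Weighted.deriv_f []

lemma Weighted.e (α : Fin 5) : Weighted V f B 0 (if α = 4 then 0 else 1) := by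
  split_ifs
  · simpa using Weighted.const (V := V) (f := f) (B := B) 0
  · simpa using Weighted.const (V := V) (f := f) (B := B) 1

lemma LegendreData.weighted_frame (h : LegendreData V f B) (α : Fin 5) {d : ℕ} {g : ι → SP}
    (hg : Weighted V f B d g) : Weighted V f B (d + 1) (frame V α g) := by
  induction hg with
  | const c =>
    rw [Derivation.map_algebraMap]
    simpa using (Weighted.const (V := V) (f := f) (B := B) 0).mono (Nat.zero_le 1)
  | deriv_f l =>
    rw [frame_apply]
    exact Weighted.mono (Nat.zero_le 1) (((Weighted.e α).mul (Weighted.deriv_f (α :: l))).add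
      ((Weighted.of_V α).mul (Weighted.deriv_f (4 :: l))))
  | inv =>
    have h1 := congrArg (frame V α) h.inv
    simp only [Derivation.leibniz, smul_eq_mul, Derivation.map_one_eq_zero] at h1
    have h2 : frame V α B = -(B * B * frame V α (V 4)) := by
      linear_combination B * h1 - frame V α B * h.inv
    rw [h2]
    have := (((Weighted.inv (V := V) (f := f) (B := B)).mul Weighted.inv).mul
      (Weighted.word 1 ![α, 4])).neg
    simpa [word, Fin.tail] using this
  | word k v =>
    have := Weighted.word (V := V) (f := f) (B := B) (k + 1) (Fin.cons α v)
    simpa [word] using this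
  | mono hd _ ih => exact ih.mono (by omega)
  | add _ _ ih ih' => rw [map_add]; exact ih.add ih'
  | mul h1 h2 ih ih' =>
    rw [Derivation.leibniz]
    exact ((h1.mul ih').mono (by omega)).add ((h2.mul ih).mono (by omega))

lemma LegendreData.weighted_opL (h : LegendreData V f B) (k : ℕ) (v : Fin (k + 1) → Fin 5) :
    Weighted V f B (k + 1) (opL V f (TorusMA.word V k v)) := by
  have hf : ∀ α, Weighted V f B 0 (frame V α f) := fun α => by
    rw [frame_apply]
    exact ((Weighted.e α).mul (Weighted.deriv_f [α])).add
      ((Weighted.of_V α).mul (Weighted.deriv_f [4]))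
  induction k with
  | zero =>
    simp only [TorusMA.word]
    rw [h.opL_V]
    refine Weighted.sub (Weighted.neg ?_) ?_
    · exact ((hf _).mul (h.weighted_frame 4 (Weighted.of_V 4))).mono (by omega)
    · exact h.weighted_frame _ ((hf 4).mul (Weighted.of_V 4))
  | succ k ih =>
    simp only [TorusMA.word]
    rw [h.opL_frame]
    refine (h.weighted_frame _ (ih _)).sub ?_
    exact ((hf _).mul (h.weighted_frame 4 (h.weighted_frame 4 (Weighted.word k _)))).mono
      (by omega)

end Bernstein

end TorusMA

namespace TorusMA

open Filter Topology
open scoped ContDiff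

/-! ### Bernstein estimates for the frame derivatives -/

section Bernstein

variable {ι : Type*} {V : Fin 5 → ι → SP} {f B : ι → SP}

/-- The sum of the squares of all frame derivatives of `V` of length `k`. -/
noncomputable def sqSum (V : Fin 5 → ι → SP) (k : ℕ) : ι → SP :=
  ∑ v : Fin (k + 1) → Fin 5, word V k v * word V k v

lemma ev_sqSum (V : Fin 5 → ι → SP) (k : ℕ) (z : ι × (Fin 5 → ℝ)) :
    ev z (sqSum V k) = ∑ v : Fin (k + 1) → Fin 5, ev z (word V k v) ^ 2 := by
  simp [sqSum, pow_two]

lemma ev_sqSum_nonneg (V : Fin 5 → ι → SP) (k : ℕ) (z : ι × (Fin 5 → ℝ)) :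
    0 ≤ ev z (sqSum V k) := by
  rw [ev_sqSum]; positivity

lemma abs_word_le (V : Fin 5 → ι → SP) (k : ℕ) (v : Fin (k + 1) → Fin 5)
    (z : ι × (Fin 5 → ℝ)) : |ev z (word V k v)| ≤ √(ev z (sqSum V k)) := by
  apply Real.le_sqrt_of_sq_le
  rw [sq_abs, ev_sqSum]
  exact Finset.single_le_sum (f := fun v => ev z (word V k v) ^ 2) (fun _ _ => sq_nonneg _)
    (Finset.mem_univ v)

lemma ev_sqSum_succ (V : Fin 5 → ι → SP) (k : ℕ) (z : ι × (Fin 5 → ℝ)) :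
    ev z (sqSum V (k + 1)) = ∑ v, ∑ α, ev z (frame V α (word V k v)) ^ 2 := by
  rw [ev_sqSum, Finset.sum_comm, ← Fintype.sum_prod_type']
  refine (Fintype.sum_equiv (Fin.consEquiv fun _ : Fin (k + 2) => Fin 5) _ _ fun p => ?_).symm
  simp [word, Fin.consEquiv]

/-- Pointwise size of a monomial of weight `d ≤ k + 1` when all words shorter than `k` are
bounded, in terms of `s = sqSum V k` and `t = sqSum V (k + 1)`. -/
noncomputable def size (k : ℕ) (s t : ℝ) (d : ℕ) : ℝ :=
  if d < k then 1 else if d = k then max 1 √s else 1 + √t + s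

lemma one_le_size (k : ℕ) {s t : ℝ} (hs : 0 ≤ s) (d : ℕ) : 1 ≤ size k s t d := by
  have := Real.sqrt_nonneg t
  unfold size
  split_ifs
  · exact le_rfl
  · exact le_max_left _ _
  · linarith

lemma max_one_sqrt_le {s : ℝ} (hs : 0 ≤ s) : max 1 √s ≤ 1 + s := by
  refine max_le (by linarith) ?_
  nlinarith [Real.sq_sqrt hs, sq_nonneg (√s - 1)]

lemma size_mono (k : ℕ) {s t : ℝ} (hs : 0 ≤ s) {d d' : ℕ} (h : d ≤ d') :
    size k s t d ≤ size k s t d' := by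
  rcases lt_or_ge d k with hd | hd
  · rw [size, if_pos hd]; exact one_le_size k hs d'
  · have := Real.sqrt_nonneg t
    have := max_one_sqrt_le hs
    unfold size
    split_ifs <;> first | omega | linarith

lemma size_mul (k : ℕ) (hk : 1 ≤ k) {s t : ℝ} (hs : 0 ≤ s) {d d' : ℕ} (h : d + d' ≤ k + 1) :
    size k s t d * size k s t d' ≤ size k s t (d + d') := by
  wlog hdd : d' ≤ d generalizing d d'
  · rw [mul_comm, add_comm]; exact this (by omega) (by omega)
  rcases Nat.eq_zero_or_pos d' with rfl | hd'
  · rw [add_zero, show size k s t 0 = 1 by simp [size]; omega, mul_one]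
  rcases lt_or_ge d' k with h1 | h1
  · rw [show size k s t d' = 1 by simp [size, h1], mul_one]
    exact size_mono k hs (by omega)
  · obtain rfl : k = 1 := by omega
    obtain rfl : d' = 1 := by omega
    obtain rfl : d = 1 := by omega
    simp only [size, lt_irrefl, if_false, if_true]
    norm_num
    have := Real.sqrt_nonneg t
    rcases le_total 1 √s with h2 | h2
    · rw [max_eq_right h2, Real.mul_self_sqrt hs]; linarith
    · rw [max_eq_left h2]; linarith

lemma LegendreData.abs_le_size (h : LegendreData V f B) {k : ℕ} (hk : 1 ≤ k)
    (hB : ∀ j < k, ∀ v, Bdd (word V j v)) {d : ℕ} {g : ι → SP} (hg : Weighted V f B d g) :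
    d ≤ k + 1 → ∃ C, 0 ≤ C ∧
      ∀ z, |ev z g| ≤ C * size k (ev z (sqSum V k)) (ev z (sqSum V (k + 1))) d := by
  have of_bdd : ∀ {d : ℕ} {g : ι → SP}, Bdd g → ∃ C, 0 ≤ C ∧
      ∀ z, |ev z g| ≤ C * size k (ev z (sqSum V k)) (ev z (sqSum V (k + 1))) d := by
    intro d g hg
    obtain ⟨C, hC, hg⟩ := hg.exists_pos
    exact ⟨C, hC.le, fun z => (hg z).trans
      (le_mul_of_one_le_right hC.le (one_le_size k (ev_sqSum_nonneg V k z) d))⟩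
  induction hg with
  | const c => exact fun _ => of_bdd ⟨|c|, fun z => by simp⟩
  | deriv_f l => exact fun _ => of_bdd (h.bdd_f l)
  | inv => exact fun _ => of_bdd h.bdd_B
  | word j v =>
    intro hj
    rcases lt_or_ge j k with h1 | h1
    · exact of_bdd (hB j h1 v)
    · refine ⟨1, zero_le_one, fun z => ?_⟩
      rw [one_mul]
      refine (abs_word_le V j v z).trans ?_
      rcases h1.eq_or_lt with rfl | h2
      · simp [size]
      · obtain rfl : j = k + 1 := by omega
        have := ev_sqSum_nonneg V k z
        simp [size]
        linarith
  | mono hd _ ih =>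
    intro hd'
    obtain ⟨C, hC, hg⟩ := ih (hd.trans hd')
    exact ⟨C, hC, fun z => (hg z).trans
      (mul_le_mul_of_nonneg_left (size_mono k (ev_sqSum_nonneg V k z) hd) hC)⟩
  | add _ _ ih ih' =>
    intro hd
    obtain ⟨C, hC, hg⟩ := ih hd
    obtain ⟨C', hC', hg'⟩ := ih' hd
    refine ⟨C + C', by positivity, fun z => ?_⟩
    rw [map_add, add_mul]
    exact (abs_add_le _ _).trans (add_le_add (hg z) (hg' z))
  | mul _ _ ih ih' =>
    intro hd
    obtain ⟨C, hC, hg⟩ := ih (by omega)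
    obtain ⟨C', hC', hg'⟩ := ih' (by omega)
    refine ⟨C * C', by positivity, fun z => ?_⟩
    rw [map_mul, abs_mul]
    refine (mul_le_mul (hg z) (hg' z) (abs_nonneg _) ((abs_nonneg _).trans (hg z))).trans ?_
    rw [mul_mul_mul_comm]
    exact mul_le_mul_of_nonneg_left (size_mul k hk (ev_sqSum_nonneg V k z) hd) (by positivity)

/-- The lower bound of the operator on a sum of squares of words. -/
lemma opL_sqSum_ge (k : ℕ) {c : ℝ} {z : ι × (Fin 5 → ℝ)} (hc : ∀ α, c ≤ ev z (wt f α)) {M : ℝ}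
    (hM : ∀ v, |ev z (opL V f (word V k v))| ≤ M) :
    2 * c * ev z (sqSum V (k + 1))
      - 2 * (Fintype.card (Fin (k + 1) → Fin 5)) * (√(ev z (sqSum V k)) * M)
      ≤ ev z (opL V f (sqSum V k)) := by
  have h1 : ev z (opL V f (sqSum V k)) = ∑ v, (2 * (ev z (word V k v) * ev z (opL V f (word V k v)))
      + 2 * ∑ α, ev z (wt f α) * ev z (frame V α (word V k v)) ^ 2) := by
    rw [sqSum, opL_sum, map_sum]
    refine Finset.sum_congr rfl fun v _ => ?_
    rw [opL_mul]
    simp only [map_add, map_mul, map_sum, map_ofNat]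
    simp only [← pow_two]
    ring
  have h2 : (2 * c * ev z (sqSum V (k + 1))
      - 2 * (Fintype.card (Fin (k + 1) → Fin 5)) * (√(ev z (sqSum V k)) * M))
      = ∑ v : Fin (k + 1) → Fin 5, (- (2 * (√(ev z (sqSum V k)) * M))
        + 2 * ∑ α, c * ev z (frame V α (word V k v)) ^ 2) := by
    rw [ev_sqSum_succ, Finset.sum_add_distrib, Finset.sum_const, Finset.card_univ]
    simp only [nsmul_eq_mul, Finset.mul_sum]
    have e : ∀ v α, 2 * c * ev z (frame V α (word V k v)) ^ 2
        = 2 * (c * ev z (frame V α (word V k v)) ^ 2) := fun v α => by ring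
    simp only [e]
    ring
  rw [h1, h2]
  refine Finset.sum_le_sum fun v _ => add_le_add ?_ ?_
  · have : |ev z (word V k v) * ev z (opL V f (word V k v))| ≤ √(ev z (sqSum V k)) * M := by
      rw [abs_mul]
      exact mul_le_mul (abs_word_le V k v z) (hM v) (abs_nonneg _) (Real.sqrt_nonneg _)
    linarith [neg_abs_le (ev z (word V k v) * ev z (opL V f (word V k v)))]
  · refine mul_le_mul_of_nonneg_left (Finset.sum_le_sum fun α _ => ?_) (by norm_num)
    exact mul_le_mul_of_nonneg_right (hc α) (sq_nonneg _)

lemma bernstein_algebra {c : ℝ} (hc : 0 < c) {C D u : ℝ} (hC : 0 ≤ C) (hD : 0 ≤ D)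
    (h : (1 + u ^ 2) * (c * u ^ 2 - C) ≤ D * (1 + u ^ 3)) :
    u ≤ 1 + (2 * D + 2 * C) / c := by
  rcases le_or_gt u 1 with h1 | h1
  · have : 0 ≤ (2 * D + 2 * C) / c := by positivity
    linarith
  · have h2 : 1 ≤ u ^ 3 := one_le_pow₀ h1.le
    have h3 : u ^ 2 ≤ u ^ 3 := pow_le_pow_right₀ h1.le (by norm_num)
    have h5 : 0 ≤ c * u ^ 2 := by positivity
    have h4 : (c * u) * u ^ 3 ≤ (2 * D + 2 * C) * u ^ 3 := by
      nlinarith [mul_le_mul_of_nonneg_left h2 hD, mul_le_mul_of_nonneg_left h2 hC,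
        mul_le_mul_of_nonneg_left h3 hC]
    have h6 := le_of_mul_le_mul_right h4 (by positivity)
    have : u ≤ (2 * D + 2 * C) / c := by rw [le_div_iff₀ hc]; linarith
    linarith

set_option maxHeartbeats 1000000 in
/-- If all frame derivatives of length at most `m` are bounded, so are those of
length `m + 1`. -/
lemma LegendreData.bernstein (h : LegendreData V f B) (m : ℕ)
    (hB : ∀ j ≤ m, ∀ v, Bdd (word V j v)) (v : Fin (m + 2) → Fin 5) :
    Bdd (word V (m + 1) v) := by
  have hB' : ∀ j < m + 1, ∀ v, Bdd (word V j v) := fun j hj => hB j (by omega)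
  obtain ⟨c₀, hc₀, hcf⟩ := h.pos
  obtain ⟨F, hF, hfF⟩ := (h.bdd_f []).exists_pos
  obtain ⟨c, hc, hc1, hcc⟩ : ∃ c : ℝ, 0 < c ∧ c ≤ 1 ∧ c ≤ c₀ :=
    ⟨min 1 c₀, by positivity, min_le_left _ _, min_le_right _ _⟩
  have hwt : ∀ z α, c ≤ ev z (wt f α) := by
    intro z α; unfold wt; split_ifs
    · exact hcc.trans (hcf z)
    · simpa using hc1
  obtain ⟨M, hM, hwtM⟩ : ∃ M : ℝ, 0 < M ∧ ∀ z α, ev z (wt f α) ≤ M := by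
    refine ⟨1 + F, by positivity, fun z α => ?_⟩
    unfold wt; split_ifs
    · have := (le_abs_self _).trans (hfF z)
      simp only [dList] at this
      linarith
    · simp [hF.le]
  -- bounds for words of length `m`
  obtain ⟨K, hK, hwK⟩ := exists_uniform fun v => hB m le_rfl v
  set N : ℝ := (Fintype.card (Fin (m + 1) → Fin 5) : ℝ) with hN
  have hN0 : 0 ≤ N := by positivity
  set N' : ℝ := (Fintype.card (Fin (m + 1 + 1) → Fin 5) : ℝ) with hN'
  have hN0' : 0 ≤ N' := by positivity
  have hQ : ∀ z, ev z (sqSum V m) ≤ N * K ^ 2 := by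
    intro z
    rw [ev_sqSum, hN]
    refine (Finset.sum_le_card_nsmul _ _ (K ^ 2) fun v _ => ?_).trans_eq (by simp)
    rw [← sq_abs]; gcongr; exact hwK v z
  -- bounds for the operator on words
  choose a ha0 ha using fun v => h.abs_le_size (le_add_self : 1 ≤ m + 1) hB'
    (h.weighted_opL m v) (by omega)
  choose b hb0 hb using fun v => h.abs_le_size (le_add_self : 1 ≤ m + 1) hB'
    (h.weighted_opL (m + 1) v) (by omega)
  set a' := ∑ v, a v
  set b' := ∑ v, b v
  have ha0' : 0 ≤ a' := Finset.sum_nonneg fun v _ => ha0 v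
  have hb0' : 0 ≤ b' := Finset.sum_nonneg fun v _ => hb0 v
  have hLa : ∀ z v, |ev z (opL V f (word V m v))| ≤ a' * (1 + √(ev z (sqSum V (m + 1)))) := by
    intro z v
    refine (ha v z).trans ?_
    have : a v ≤ a' := Finset.single_le_sum (fun v _ => ha0 v) (Finset.mem_univ v)
    have h1 := one_le_size (m + 1) (t := ev z (sqSum V (m + 1 + 1)))
      (ev_sqSum_nonneg V (m + 1) z) (m + 1)
    refine mul_le_mul this ?_ (by linarith) ha0'
    have := Real.sqrt_nonneg (ev z (sqSum V (m + 1)))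
    simp [size, this]
  have hLb : ∀ z v, |ev z (opL V f (word V (m + 1) v))|
      ≤ b' * (1 + √(ev z (sqSum V (m + 1 + 1))) + ev z (sqSum V (m + 1))) := by
    intro z v
    refine (hb v z).trans ?_
    have : b v ≤ b' := Finset.single_le_sum (fun v _ => hb0 v) (Finset.mem_univ v)
    have h1 := one_le_size (m + 1) (t := ev z (sqSum V (m + 1 + 1)))
      (ev_sqSum_nonneg V (m + 1) z) (m + 1 + 1)
    refine mul_le_mul this ?_ (by linarith) hb0'
    simp [size]
  set Q₀ : ℝ := N * K ^ 2 with hQ0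
  have hQ00 : 0 ≤ Q₀ := by positivity
  obtain ⟨C₁, hC1, hLS⟩ : ∃ C, 0 ≤ C ∧ ∀ z, - (C * (1 + √(ev z (sqSum V (m + 1))) ^ 3))
      ≤ ev z (opL V f (sqSum V (m + 1))) := by
    refine ⟨4 * N' * b' + (N' * b') ^ 2 / c, by positivity, fun z => ?_⟩
    refine le_trans ?_ (opL_sqSum_ge (m + 1) (hwt z) (hLb z))
    rw [← hN']
    set u := √(ev z (sqSum V (m + 1))) with hu
    set w := √(ev z (sqSum V (m + 1 + 1))) with hw
    have hu2 : ev z (sqSum V (m + 1)) = u ^ 2 := (Real.sq_sqrt (ev_sqSum_nonneg _ _ _)).symm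
    have hw2 : ev z (sqSum V (m + 1 + 1)) = w ^ 2 := (Real.sq_sqrt (ev_sqSum_nonneg _ _ _)).symm
    have hu0 : 0 ≤ u := Real.sqrt_nonneg _
    rw [hu2, hw2]
    have e1 : (N' * b') * u * w * 2 ≤ c * w ^ 2 + (N' * b') ^ 2 / c * u ^ 2 := by
      have : c * w ^ 2 + (N' * b') ^ 2 / c * u ^ 2 - (N' * b') * u * w * 2
          = (c * w - N' * b' * u) ^ 2 / c := by field_simp; ring
      have h2 : 0 ≤ (c * w - N' * b' * u) ^ 2 / c := by positivity
      linarith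
    have e2 : u ≤ 1 + u ^ 3 := by
      rcases le_total u 1 with h1 | h1
      · have : 0 ≤ u ^ 3 := by positivity
        linarith
      · nlinarith [pow_le_pow_right₀ h1 (show 1 ≤ 3 by norm_num)]
    have e3 : u ^ 2 ≤ 1 + u ^ 3 := by
      rcases le_total u 1 with h1 | h1
      · have : 0 ≤ u ^ 3 := by positivity
        nlinarith
      · nlinarith [pow_le_pow_right₀ h1 (show 2 ≤ 3 by norm_num)]
    have e4 : 0 ≤ N' * b' := by positivity
    have e5 : 0 ≤ (N' * b') ^ 2 / c := by positivity
    have e6 : 0 ≤ c * w ^ 2 := by positivity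
    nlinarith [mul_le_mul_of_nonneg_left e2 e4, mul_le_mul_of_nonneg_left e3 e5]
  obtain ⟨C₂, hC2, hLQ⟩ : ∃ C, 0 ≤ C ∧ ∀ z, c * ev z (sqSum V (m + 1)) - C
      ≤ ev z (opL V f (sqSum V m)) := by
    refine ⟨2 * N * √Q₀ * a' + (N * √Q₀ * a') ^ 2 / c, by positivity, fun z => ?_⟩
    refine le_trans ?_ (opL_sqSum_ge m (hwt z) (hLa z))
    rw [← hN]
    set u := √(ev z (sqSum V (m + 1))) with hu
    have hu2 : ev z (sqSum V (m + 1)) = u ^ 2 := (Real.sq_sqrt (ev_sqSum_nonneg _ _ _)).symm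
    have hu0 : 0 ≤ u := Real.sqrt_nonneg _
    rw [hu2]
    have hq : √(ev z (sqSum V m)) ≤ √Q₀ := Real.sqrt_le_sqrt (hQ z)
    have e0 : √(ev z (sqSum V m)) * (a' * (1 + u)) ≤ √Q₀ * (a' * (1 + u)) :=
      mul_le_mul_of_nonneg_right hq (by positivity)
    have e1 : 2 * (N * √Q₀ * a') * u ≤ c * u ^ 2 + (N * √Q₀ * a') ^ 2 / c := by
      have : c * u ^ 2 + (N * √Q₀ * a') ^ 2 / c - 2 * (N * √Q₀ * a') * u
          = (c * u - N * √Q₀ * a') ^ 2 / c := by field_simp; ring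
      have h2 : 0 ≤ (c * u - N * √Q₀ * a') ^ 2 / c := by positivity
      linarith
    nlinarith [mul_le_mul_of_nonneg_left e0 hN0]
  obtain ⟨C₃, hC3, hDQ⟩ : ∃ C, 0 ≤ C ∧ ∀ z α, (ev z (frame V α (sqSum V m))) ^ 2
      ≤ C * ev z (sqSum V (m + 1)) := by
    refine ⟨(2 * N * K) ^ 2, by positivity, fun z α => ?_⟩
    rw [← Real.sq_sqrt (ev_sqSum_nonneg V (m + 1) z), ← mul_pow]
    rw [← sq_abs]
    refine pow_le_pow_left₀ (abs_nonneg _) ?_ 2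
    have : ev z (frame V α (sqSum V m))
        = ∑ v, 2 * (ev z (word V m v) * ev z (frame V α (word V m v))) := by
      simp only [sqSum, map_sum, Derivation.leibniz, smul_eq_mul, map_add, map_mul]
      refine Finset.sum_congr rfl fun v _ => by ring
    rw [this]
    refine (Finset.abs_sum_le_sum_abs _ _).trans ?_
    refine (Finset.sum_le_card_nsmul _ _ (2 * (K * √(ev z (sqSum V (m + 1)))))
      fun v _ => ?_).trans_eq
      (by rw [Finset.card_univ, nsmul_eq_mul, ← hN]; ring)
    rw [abs_mul, abs_mul, abs_two]
    have h1 := abs_word_le V (m + 1) (Fin.cons α v) z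
    simp only [word, Fin.cons_zero, Fin.tail_cons] at h1
    gcongr
    exact hwK v z
  obtain ⟨Λ, hΛ1, hΛ⟩ : ∃ Λ : ℝ, 1 ≤ Λ ∧ 20 * M * C₃ / c ≤ Λ :=
    ⟨max 1 (20 * M * C₃ / c), le_max_left _ _, le_max_right _ _⟩
  have hΛ0 : 0 < Λ := by linarith
  set u₀ : ℝ := 1 + (2 * ((Λ + Q₀) * C₁) + 2 * C₂) / (c / 2) with hu0
  have hu00 : 0 ≤ u₀ := by positivity
  set P : ι → SP := (1 + sqSum V (m + 1)) * (algebraMap ℝ (ι → SP) Λ + sqSum V m) with hP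
  have hevP : ∀ z, ev z P = (1 + ev z (sqSum V (m + 1))) * (Λ + ev z (sqSum V m)) := by
    intro z; simp [hP]
  have hS : ∀ z, ev z (sqSum V (m + 1)) ≤ (1 + u₀ ^ 2) * (Λ + Q₀) := by
    rintro ⟨i, y⟩
    obtain ⟨x, hx, hx1, hx2⟩ := h.max_principle P i
    have hxy := hx y
    rw [hevP, hevP] at hxy
    have hSy := ev_sqSum_nonneg V (m + 1) (i, y)
    have hQy := ev_sqSum_nonneg V m (i, y)
    set S := ev (i, x) (sqSum V (m + 1)) with hSdef
    set Q := ev (i, x) (sqSum V m) with hQdef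
    have hS0 : 0 ≤ S := ev_sqSum_nonneg V (m + 1) _
    have hQ0 : 0 ≤ Q := ev_sqSum_nonneg V m _
    have hQx : Q ≤ Q₀ := hQ _
    suffices hu : √S ≤ u₀ by
      have hS1 : S ≤ u₀ ^ 2 := by
        rw [← Real.sq_sqrt hS0]; gcongr
      have : (1 + S) * (Λ + Q) ≤ (1 + u₀ ^ 2) * (Λ + Q₀) := by gcongr
      nlinarith
    have hcross : ∀ α, -((1 + S) * (c / 20 * S)) ≤ ev (i, x) (wt f α)
        * (ev (i, x) (frame V α (sqSum V (m + 1))) * ev (i, x) (frame V α (sqSum V m))) := by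
      intro α
      have h1 := hx1 α
      rw [hP] at h1
      simp only [Derivation.leibniz, map_add, Derivation.map_algebraMap, map_mul, smul_eq_mul,
        Derivation.map_one_eq_zero, map_one, zero_add, AlgHom.commutes, Algebra.algebraMap_self,
        RingHom.id_apply] at h1
      rw [← hSdef, ← hQdef] at h1
      set dS := ev (i, x) (frame V α (sqSum V (m + 1)))
      set dQ := ev (i, x) (frame V α (sqSum V m)) with hdQ
      have h2 : dS * dQ = -((1 + S) / (Λ + Q) * dQ ^ 2) := by
        have : Λ + Q ≠ 0 := by positivity
        field_simp
        linear_combination dQ * h1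
      have h3 : dQ ^ 2 ≤ C₃ * S := hDQ _ _
      have h4 : ev (i, x) (wt f α) * dQ ^ 2 ≤ M * (C₃ * S) :=
        mul_le_mul (hwtM _ _) h3 (sq_nonneg _) hM.le
      have h5 : M * C₃ ≤ c / 20 * Λ := by
        rw [div_le_iff₀ hc] at hΛ; linarith
      have h6 : ev (i, x) (wt f α) * dQ ^ 2 / (Λ + Q) ≤ c / 20 * S := by
        rw [div_le_iff₀ (by positivity)]
        have h7 : M * C₃ * S ≤ c / 20 * Λ * S := mul_le_mul_of_nonneg_right h5 hS0
        have h8 : 0 ≤ c / 20 * S * Q := by positivity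
        linarith
      have h9 := mul_le_mul_of_nonneg_left h6 (show 0 ≤ 1 + S by positivity)
      rw [h2]
      calc -((1 + S) * (c / 20 * S))
          ≤ -((1 + S) * (ev (i, x) (wt f α) * dQ ^ 2 / (Λ + Q))) := by linarith
        _ = _ := by ring
    have hmain : (1 + S) * ev (i, x) (opL V f (sqSum V m))
        + (Λ + Q) * ev (i, x) (opL V f (sqSum V (m + 1)))
        + 2 * ∑ α, ev (i, x) (wt f α) * (ev (i, x) (frame V α (sqSum V (m + 1)))
          * ev (i, x) (frame V α (sqSum V m))) ≤ 0 := by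
      rw [hP, opL_mul, opL_add, opL_add, opL_const,
        show (1 : ι → SP) = algebraMap ℝ (ι → SP) 1 by simp, opL_const] at hx2
      simp only [map_add, map_mul, map_sum, map_ofNat, map_one, zero_add,
        Derivation.map_algebraMap, Derivation.map_one_eq_zero, AlgHom.commutes,
        Algebra.algebraMap_self, RingHom.id_apply] at hx2
      exact hx2
    have hsum := Finset.sum_le_sum fun α (_ : α ∈ Finset.univ) => hcross α
    rw [Finset.sum_const, Finset.card_univ, Fintype.card_fin, nsmul_eq_mul] at hsum
    have h1 := mul_le_mul_of_nonneg_left (hLQ (i, x)) (show 0 ≤ 1 + S by positivity)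
    have h2 := mul_le_mul_of_nonneg_left (hLS (i, x)) (show 0 ≤ Λ + Q by positivity)
    rw [← hSdef] at h1 h2
    have h3 : (Λ + Q) * (C₁ * (1 + √S ^ 3)) ≤ (Λ + Q₀) * (C₁ * (1 + √S ^ 3)) := by gcongr
    refine bernstein_algebra (half_pos hc) hC2 (D := (Λ + Q₀) * C₁) (by positivity) ?_
    rw [Real.sq_sqrt hS0]
    push_cast at hsum
    linarith
  refine ⟨√((1 + u₀ ^ 2) * (Λ + Q₀)), fun z => (abs_word_le V (m + 1) v z).trans ?_⟩
  exact Real.sqrt_le_sqrt (hS z)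

lemma LegendreData.bdd_word (h : LegendreData V f B) (k : ℕ) (v : Fin (k + 1) → Fin 5) :
    Bdd (word V k v) := by
  induction k using Nat.strong_induction_on with
  | _ k ih =>
    cases k with
    | zero => exact h.bdd_V _
    | succ m => exact h.bernstein m (fun j hj v => ih j (by omega) v) v

lemma LegendreData.bdd_weighted (h : LegendreData V f B) {d : ℕ} {g : ι → SP}
    (hg : Weighted V f B d g) : Bdd g := by
  induction hg with
  | const c => exact ⟨|c|, fun z => by simp⟩
  | deriv_f l => exact h.bdd_f l
  | inv => exact h.bdd_B
  | word k v => exact h.bdd_word k v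
  | mono _ _ ih => exact ih
  | add _ _ ih ih' =>
    obtain ⟨C, hC⟩ := ih
    obtain ⟨C', hC'⟩ := ih'
    exact ⟨C + C', fun z => by
      rw [map_add]; exact (abs_add_le _ _).trans (add_le_add (hC z) (hC' z))⟩
  | mul _ _ ih ih' =>
    obtain ⟨C, -, hC⟩ := ih.exists_pos
    obtain ⟨C', -, hC'⟩ := ih'.exists_pos
    exact ⟨C * C', fun z => by
      rw [map_mul, abs_mul]
      exact mul_le_mul (hC z) (hC' z) (abs_nonneg _) ((abs_nonneg _).trans (hC z))⟩

lemma LegendreData.weighted_dF (h : LegendreData V f B) (j : Fin 5) {d : ℕ} {g : ι → SP}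
    (hg : Weighted V f B d g) : Weighted V f B (d + 1) (dF j g) := by
  have h4 : Weighted V f B (d + 1) (dF 4 g) := by
    have : dF 4 g = B * frame V 4 g := by
      rw [frame_apply, if_pos rfl]
      linear_combination -(dF 4 g) * h.inv
    rw [this]
    exact (Weighted.inv.mul (h.weighted_frame 4 hg)).mono (by omega)
  by_cases hj : j = 4
  · rw [hj]; exact h4
  · have : dF j g = frame V j g - V j * dF 4 g := by
      rw [frame_apply, if_neg hj]; ring
    rw [this]
    exact (h.weighted_frame j hg).sub (((Weighted.of_V j).mul h4).mono (by omega))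

lemma LegendreData.bdd_dList (h : LegendreData V f B) {d : ℕ} {g : ι → SP}
    (hg : Weighted V f B d g) (l : List (Fin 5)) : Bdd (dList l g) := by
  suffices ∃ d', Weighted V f B d' (dList l g) from h.bdd_weighted this.choose_spec
  induction l with
  | nil => exact ⟨d, hg⟩
  | cons j l ih => exact ⟨_, h.weighted_dF j ih.choose_spec⟩

end Bernstein

end TorusMA

namespace TorusMA

open Filter Topology
open scoped ContDiff

/-! ### A priori estimates for families of solutions -/

section Apriori

variable {ι : Type*}

/-- The factor `φ₁₁ + φ₂₂ + φ₃₃ + φ₄₄ + 1`. -/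
noncomputable def facA (φ : ι → SP) : ι → SP := ∑ i : Fin 4, dF i.castSucc (dF i.castSucc φ) + 1

/-- The factor `φ₅₅ + 1`. -/
noncomputable def facB (φ : ι → SP) : ι → SP := dF 4 (dF 4 φ) + 1

/-- The mixed derivative `φ_{i5}`. -/
noncomputable def mix (φ : ι → SP) (i : Fin 4) : ι → SP := dF i.castSucc (dF 4 φ)

/-- The Monge-Ampère operator. -/
noncomputable def opMA (φ : ι → SP) : ι → SP :=
  facA φ * facB φ - ∑ i, mix φ i * mix φ i

lemma facA_add_facB (φ : ι → SP) : facA φ + facB φ = ∑ j, dF j (dF j φ) + (1 + 1) := by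
  rw [facA, facB, Fin.sum_univ_castSucc (n := 4), show Fin.last 4 = 4 from rfl]; ring

/-- The linearisation of the Monge-Ampère operator. -/
noncomputable def linMA (φ g : ι → SP) : ι → SP :=
  facB φ * ∑ i : Fin 4, dF i.castSucc (dF i.castSucc g) + facA φ * dF 4 (dF 4 g)
    - 2 * ∑ i, mix φ i * dF i.castSucc (dF 4 g)

lemma dF_opMA (φ : ι → SP) (j : Fin 5) : dF j (opMA φ) = linMA φ (dF j φ) := by
  have h4 : dF j (dF 4 (dF 4 φ)) = dF 4 (dF 4 (dF j φ)) := by rw [dF_comm j 4, dF_comm j 4]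
  have hi : ∀ i : Fin 5, dF j (dF i (dF i φ)) = dF i (dF i (dF j φ)) := fun i => by
    rw [dF_comm j i, dF_comm j i]
  have hm : ∀ i : Fin 5, dF j (dF i (dF 4 φ)) = dF i (dF 4 (dF j φ)) := fun i => by
    rw [dF_comm j i, dF_comm j 4]
  simp only [opMA, linMA, facA, facB, mix, map_sub, map_add, Derivation.leibniz,
    smul_eq_mul, Derivation.map_one_eq_zero, h4, hi, hm, Fin.sum_univ_four]
  ring

lemma linMA_dF_dF (φ : ι → SP) (j : Fin 5) :
    linMA φ (dF j (dF j φ)) = dF j (dF j (opMA φ))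
      - 2 * (dF j (facA φ) * dF j (facB φ) - ∑ i, dF j (mix φ i) * dF j (mix φ i)) := by
  have h4 : ∀ g : ι → SP, dF j (dF 4 (dF 4 g)) = dF 4 (dF 4 (dF j g)) := fun g => by
    rw [dF_comm j 4, dF_comm j 4]
  have hi : ∀ (i : Fin 5) (g : ι → SP), dF j (dF i (dF i g)) = dF i (dF i (dF j g)) :=
    fun i g => by rw [dF_comm j i, dF_comm j i]
  have hm : ∀ (i : Fin 5) (g : ι → SP), dF j (dF i (dF 4 g)) = dF i (dF 4 (dF j g)) :=
    fun i g => by rw [dF_comm j i, dF_comm j 4]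
  have h2 : dF j (2 : ι → SP) = 0 := by exact_mod_cast (dF j).map_natCast 2
  rw [dF_opMA]
  simp only [linMA, facA, facB, mix, map_sub, map_add, Derivation.leibniz,
    smul_eq_mul, Derivation.map_one_eq_zero, h4, hi, hm, h2, Fin.sum_univ_four]
  ring

lemma linMA_add (φ g g' : ι → SP) : linMA φ (g + g') = linMA φ g + linMA φ g' := by
  simp only [linMA, map_add, Finset.sum_add_distrib, mul_add]; ring

lemma linMA_one (φ : ι → SP) : linMA φ 1 = 0 := by
  simp [linMA]

lemma linMA_sum {κ : Type*} (s : Finset κ) (φ : ι → SP) (g : κ → ι → SP) :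
    linMA φ (∑ k ∈ s, g k) = ∑ k ∈ s, linMA φ (g k) := by
  classical
  induction s using Finset.induction_on with
  | empty => simp [linMA]
  | insert a s ha ih => rw [Finset.sum_insert ha, Finset.sum_insert ha, linMA_add, ih]

lemma linMA_sq (φ : ι → SP) : linMA φ (dF 4 φ * dF 4 φ)
    = 2 * (dF 4 φ * dF 4 (opMA φ) + facA φ + opMA φ * facB φ - 2 * opMA φ) := by
  rw [dF_opMA]
  simp only [linMA, opMA, facA, facB, mix, map_add, Derivation.leibniz, smul_eq_mul,
    Fin.sum_univ_four]
  ring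

/-- A family of solutions with right-hand side uniformly positive and uniformly smooth. -/
structure Solves (φ f : ι → SP) : Prop where
  eq : opMA φ = f
  pos : ∃ c, 0 < c ∧ ∀ z, c ≤ ev z f
  bdd_f : ∀ l, Bdd (dList l f)

variable {φ f : ι → SP}

lemma Solves.ev_eq (h : Solves φ f) (z : ι × (Fin 5 → ℝ)) :
    ev z (facA φ) * ev z (facB φ) = ev z f + ∑ i, ev z (mix φ i) ^ 2 := by
  rw [← h.eq]; simp [opMA, pow_two]

lemma Solves.facA_mul_facB_pos (h : Solves φ f) (z : ι × (Fin 5 → ℝ)) :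
    0 < ev z (facA φ) * ev z (facB φ) := by
  obtain ⟨c, hc, hf⟩ := h.pos
  rw [h.ev_eq]
  have := hf z
  have : 0 ≤ ∑ i, ev z (mix φ i) ^ 2 := by positivity
  linarith

lemma Solves.facA_pos (h : Solves φ f) (z : ι × (Fin 5 → ℝ)) : 0 < ev z (facA φ) := by
  obtain ⟨i, y⟩ := z
  by_contra! hneg
  obtain ⟨x, -, -, hx⟩ := exists_max_of_family (-φ) i
  have hx0 : 0 ≤ ev (i, x) (facA φ) := by
    simp only [facA, map_add, map_sum, map_one]
    have : ∀ k : Fin 4, 0 ≤ ev (i, x) (dF k.castSucc (dF k.castSucc φ)) := fun k => by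
      have := hx k.castSucc 1 0
      simp only [map_neg] at this
      linarith
    have := Finset.sum_nonneg fun k (_ : k ∈ Finset.univ) => this k
    linarith
  obtain ⟨w, hw⟩ := mem_range_of_exists_le_of_exists_ge (facA φ i).continuous ⟨y, hneg⟩ ⟨x, hx0⟩
  have := h.facA_mul_facB_pos (i, w)
  rw [show ev (i, w) (facA φ) = 0 from hw, zero_mul] at this
  exact lt_irrefl _ this

lemma Solves.facB_pos (h : Solves φ f) (z : ι × (Fin 5 → ℝ)) : 0 < ev z (facB φ) :=
  pos_of_mul_pos_right (h.facA_mul_facB_pos z) (h.facA_pos z).le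

lemma abs_deriv_le_one {u u' u'' : ℝ → ℝ} (h1 : ∀ s, HasDerivAt u (u' s) s)
    (h2 : ∀ s, HasDerivAt u' (u'' s) s) (hper : ∀ s, u (s + 1) = u s) (hu : ∀ s, -1 ≤ u'' s) :
    |u' 0| ≤ 1 := by
  have hmono : Monotone fun s => u' s + s := by
    refine monotone_of_hasDerivAt_nonneg (f' := fun s => u'' s + 1) (fun s => ?_) fun s => ?_
    · exact (h2 s).add (hasDerivAt_id s)
    · simpa using by linarith [hu s]
  have rolle : ∀ a, ∃ s ∈ Set.Ioo a (a + 1), u' s = 0 := fun a =>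
    exists_hasDerivAt_eq_zero (by linarith)
      (fun s _ => (h1 s).continuousAt.continuousWithinAt) (hper a).symm fun s _ => h1 s
  obtain ⟨s, hs, hs0⟩ := rolle 0
  obtain ⟨r, hr, hr0⟩ := rolle (-1)
  have e1 := hmono hs.1.le
  have e2 := hmono (show r ≤ 0 by linarith [hr.2])
  simp only [hs0, hr0] at e1 e2
  rw [abs_le]
  constructor <;> linarith [hs.2, hr.1]

lemma Solves.abs_dF_le (h : Solves φ f) (z : ι × (Fin 5 → ℝ)) : |ev z (dF 4 φ)| ≤ 1 := by
  obtain ⟨i, x⟩ := z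
  have key : ∀ (g : SP) (s : ℝ), HasDerivAt (fun s : ℝ => g.1 (x + s • Pi.single 4 1))
      ((dSP 4 g).1 (x + s • Pi.single 4 1)) s := fun g s => by
    simpa [Pi.single_apply] using hasDerivAt_line g x (Pi.single 4 1) s
  have := abs_deriv_le_one (key (φ i)) (key (dSP 4 (φ i))) (fun s => ?_) (fun s => ?_)
  · simpa [ev_apply, dF_apply] using this
  · rw [add_smul, one_smul, ← add_assoc, (φ i).periodic]
  · have := h.facB_pos (i, x + s • Pi.single 4 1)
    simp only [facB, map_add, map_one] at this
    simp only [ev_apply, dF_apply] at this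
    linarith

/-- A reverse Cauchy-Schwarz inequality for the Lorentzian form `AB - |b|²`. -/
lemma reverse_cauchy_schwarz {A B f A' B' f' : ℝ} {b b' : Fin 4 → ℝ} (hB : 0 < B) (hf : 0 ≤ f)
    (h : A * B = f + ∑ i, b i ^ 2) (h' : B * A' + A * B' - 2 * ∑ i, b i * b' i = f') :
    4 * f * (A' * B' - ∑ i, b' i ^ 2) ≤ f' ^ 2 := by
  have e1 : B ^ 2 * (f' ^ 2 - 4 * f * (A' * B' - ∑ i, b' i ^ 2))
      = (B * f' - 2 * f * B') ^ 2 + 4 * f * ∑ i, (B * b' i - b i * B') ^ 2 := by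
    simp only [Fin.sum_univ_four] at *
    subst h'
    obtain rfl : f = A * B - (b 0 ^ 2 + b 1 ^ 2 + b 2 ^ 2 + b 3 ^ 2) := by linarith
    ring
  have e2 : 0 ≤ B ^ 2 * (f' ^ 2 - 4 * f * (A' * B' - ∑ i, b' i ^ 2)) := by
    rw [e1]; positivity
  exact sub_nonneg.1 ((mul_nonneg_iff_of_pos_left (by positivity)).1 e2)

lemma Solves.linMA_nonpos (h : Solves φ f) (g : ι → SP) {i : ι} {x : Fin 5 → ℝ}
    (hx : ∀ (α : Fin 5) (a b : ℝ), a * a * ev (i, x) (dF α (dF α g))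
      + 2 * (a * b) * ev (i, x) (dF α (dF 4 g)) + b * b * ev (i, x) (dF 4 (dF 4 g)) ≤ 0) :
    ev (i, x) (linMA φ g) ≤ 0 := by
  obtain ⟨c, hc, hf⟩ := h.pos
  have hB := h.facB_pos (i, x)
  have hAB := h.ev_eq (i, x)
  have h4 := mul_nonneg_of_nonpos_of_nonpos (hx 4 0 1) (neg_nonpos.2 (hc.le.trans (hf (i, x))))
  have hk := fun k : Fin 4 => hx k.castSucc (ev (i, x) (facB φ)) (-ev (i, x) (mix φ k))
  refine nonpos_of_mul_nonpos_right (?_ : ev (i, x) (facB φ) * _ ≤ 0) hB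
  simp only [linMA, map_sub, map_add, map_mul, map_sum, map_ofNat]
  simp only [Fin.sum_univ_four] at hAB ⊢
  have h1 : ev (i, x) (facB φ) * (ev (i, x) (facA φ) * ev (i, x) (dF 4 (dF 4 g)))
    = (ev (i, x) f + (ev (i, x) (mix φ 0) ^ 2 + ev (i, x) (mix φ 1) ^ 2 + ev (i, x) (mix φ 2) ^ 2
      + ev (i, x) (mix φ 3) ^ 2)) * ev (i, x) (dF 4 (dF 4 g)) := by
    rw [← hAB]; ring
  linarith [hk 0, hk 1, hk 2, hk 3]

/-- The right-hand side of the differential inequality for the trace. -/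
lemma Solves.linMA_dF_dF_ge (h : Solves φ f) {c F : ℝ} {z : ι × (Fin 5 → ℝ)} (j : Fin 5)
    (hc : 0 < c) (hcf : c ≤ ev z f) (hF1 : |ev z (dF j f)| ≤ F)
    (hF2 : |ev z (dF j (dF j f))| ≤ F) :
    -(F + F ^ 2 / (2 * c)) ≤ ev z (linMA φ (dF j (dF j φ))) := by
  have h1 := congrArg (fun g => ev z (dF j g)) h.eq
  simp only [opMA, map_sub, map_sum, map_add, map_mul, Derivation.leibniz, smul_eq_mul] at h1
  have h2 := reverse_cauchy_schwarz (h.facB_pos z) (hc.le.trans hcf) (h.ev_eq z)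
    (A' := ev z (dF j (facA φ))) (B' := ev z (dF j (facB φ)))
    (b' := fun i => ev z (dF j (mix φ i))) (f' := ev z (dF j f)) (by
      rw [← h1]; simp only [Fin.sum_univ_four]; ring)
  have h3 := congrArg (ev z) (linMA_dF_dF φ j)
  rw [h.eq] at h3
  simp only [map_sub, map_sum, map_mul, map_ofNat] at h3
  rw [h3]
  simp only [← pow_two]
  set X := ev z (dF j (facA φ)) * ev z (dF j (facB φ)) - ∑ i, ev z (dF j (mix φ i)) ^ 2
  have h4 : 2 * X ≤ F ^ 2 / (2 * c) := by
    rw [le_div_iff₀ (by positivity)]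
    rcases le_total X 0 with hX | hX
    · have := mul_nonneg_of_nonpos_of_nonpos hX (neg_nonpos.2 hc.le)
      nlinarith [sq_nonneg F]
    · have : ev z (dF j f) ^ 2 ≤ F ^ 2 := by rw [← sq_abs]; gcongr
      have := mul_le_mul_of_nonneg_right hcf hX
      linarith
  linarith [neg_abs_le (ev z (dF j (dF j f)))]

lemma Solves.exists_trace_le (h : Solves φ f) :
    ∃ C, 0 < C ∧ ∀ z, ev z (facA φ) + ev z (facB φ) ≤ C := by
  obtain ⟨c, hc, hcf⟩ := h.pos
  obtain ⟨F₀, hF₀, hfF₀⟩ := (h.bdd_f []).exists_pos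
  obtain ⟨F₁, hF₁, hfF₁⟩ := exists_uniform fun j => h.bdd_f [j]
  obtain ⟨F₂, hF₂, hfF₂⟩ := exists_uniform fun j => h.bdd_f [j, j]
  simp only [dList] at hfF₀ hfF₁ hfF₂
  obtain ⟨F, hF, h0, h1, h2⟩ : ∃ F, 0 < F ∧ (∀ z, |ev z f| ≤ F) ∧ (∀ j z, |ev z (dF j f)| ≤ F) ∧
      ∀ j z, |ev z (dF j (dF j f))| ≤ F :=
    ⟨F₀ + F₁ + F₂, by positivity, fun z => (hfF₀ z).trans (by linarith),
      fun j z => (hfF₁ j z).trans (by linarith), fun j z => (hfF₂ j z).trans (by linarith)⟩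
  set D : ℝ := 5 * (F + F ^ 2 / (2 * c)) + 3 * F with hD
  have hD0 : 0 ≤ D := by positivity
  refine ⟨D + D / c + 1, by positivity, ?_⟩
  rintro ⟨i, y⟩
  set g : ι → SP := 2 * (facA φ + facB φ) + dF 4 φ * dF 4 φ with hg
  obtain ⟨x, hx, -, hx2⟩ := exists_max_of_family g i
  have hL := h.linMA_nonpos g hx2
  have htr : linMA φ (facA φ + facB φ) = ∑ j, linMA φ (dF j (dF j φ)) := by
    rw [← linMA_sum, facA_add_facB, linMA_add, linMA_add, linMA_one, add_zero, add_zero]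
  have hsum := Finset.sum_le_sum fun j (_ : j ∈ Finset.univ) =>
    h.linMA_dF_dF_ge j hc (hcf (i, x)) (h1 j (i, x)) (h2 j (i, x))
  rw [Finset.sum_const, Finset.card_univ, Fintype.card_fin, nsmul_eq_mul, ← map_sum, ← htr] at hsum
  rw [hg, linMA_add, two_mul, linMA_add, linMA_sq, h.eq] at hL
  simp only [map_add, map_sub, map_mul, map_ofNat] at hL
  have hA := h.facA_pos (i, x)
  have hB := h.facB_pos (i, x)
  have hw := h.abs_dF_le (i, x)
  have hwf : -F ≤ ev (i, x) (dF 4 φ) * ev (i, x) (dF 4 f) := by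
    have : |ev (i, x) (dF 4 φ) * ev (i, x) (dF 4 f)| ≤ 1 * F := by
      rw [abs_mul]
      exact mul_le_mul hw (h1 4 _) (abs_nonneg _) zero_le_one
    linarith [neg_abs_le (ev (i, x) (dF 4 φ) * ev (i, x) (dF 4 f))]
  have hfB : c * ev (i, x) (facB φ) ≤ ev (i, x) f * ev (i, x) (facB φ) :=
    mul_le_mul_of_nonneg_right (hcf _) hB.le
  have hf0 := (le_abs_self _).trans (h0 (i, x))
  push_cast at hsum
  have hkey : ev (i, x) (facA φ) + c * ev (i, x) (facB φ) ≤ D := by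
    rw [hD]; linarith
  have hcB : 0 < c * ev (i, x) (facB φ) := by positivity
  have hB' : ev (i, x) (facB φ) ≤ D / c := by rw [le_div_iff₀ hc]; linarith
  have hxy := hx y
  rw [hg] at hxy
  simp only [map_add, map_mul, map_ofNat] at hxy
  have : ev (i, x) (dF 4 φ) * ev (i, x) (dF 4 φ) ≤ 1 := by
    rw [← abs_mul_abs_self]
    exact mul_le_one₀ hw (abs_nonneg _) hw
  linarith [mul_self_nonneg (ev (i, y) (dF 4 φ))]

/-- The pointwise inverse of a positive smooth function on `T⁵`. -/
noncomputable def SP.inv (g : SP) (hg : ∀ x, 0 < g.1 x) : SP :=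
  ⟨fun x => (g.1 x)⁻¹, g.contDiff.inv fun x => (hg x).ne', fun x i => by
    simp only; rw [g.periodic x i]⟩

lemma Solves.exists_inv (h : Solves φ f) : ∃ p : ι → SP, p * facB φ = 1 :=
  ⟨fun i => (facB φ i).inv fun x => h.facB_pos (i, x),
    family_ext fun z => by
      rw [map_mul, map_one]
      exact inv_mul_cancel₀ (h.facB_pos z).ne'⟩

/-- The gradient of the last coordinate in the partial Legendre variables. -/
noncomputable def legendreV (φ p : ι → SP) : Fin 5 → ι → SP :=
  Fin.snoc (fun i : Fin 4 => -(mix φ i * p)) p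

lemma legendreV_castSucc (φ p : ι → SP) (i : Fin 4) :
    legendreV φ p i.castSucc = -(mix φ i * p) := by simp [legendreV]

lemma legendreV_last (φ p : ι → SP) : legendreV φ p 4 = p :=
  Fin.snoc_last (α := fun _ => ι → SP) p _

lemma Solves.legendreData (h : Solves φ f) {p : ι → SP} (hp : p * facB φ = 1) :
    LegendreData (legendreV φ p) f (facB φ) := by
  have hdp : ∀ j, dF j p = -(p * p * dF j (facB φ)) := by
    intro j
    have h1 := congrArg (dF j) hp
    simp only [Derivation.leibniz, smul_eq_mul, Derivation.map_one_eq_zero] at h1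
    linear_combination p * h1 - dF j p * hp
  have hm4 : ∀ i, dF 4 (mix φ i) = dF i.castSucc (facB φ) := fun i => by
    simp only [mix, facB, map_add, Derivation.map_one_eq_zero, add_zero, dF_comm 4 i.castSucc]
  have hmm : ∀ i j : Fin 4, dF i.castSucc (mix φ j) = dF j.castSucc (mix φ i) := fun i j => by
    simp only [mix, dF_comm i.castSucc j.castSucc]
  have hA4 : dF 4 (facA φ) = ∑ i, dF i.castSucc (mix φ i) := by
    simp only [mix, facA, map_add, map_sum, Derivation.map_one_eq_zero, add_zero,
      dF_comm 4 (Fin.castSucc _)]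
  have hne : ∀ i : Fin 4, i.castSucc ≠ 4 := fun i => (Fin.castSucc_lt_last i).ne
  have hfr : ∀ (i : Fin 4) (g : ι → SP), frame (legendreV φ p) i.castSucc g
      = dF i.castSucc g - mix φ i * p * dF 4 g := fun i g => by
    rw [frame_apply, if_neg (hne i), legendreV_castSucc]; ring
  have hf4 : ∀ g : ι → SP, frame (legendreV φ p) 4 g = p * dF 4 g := fun g => by
    rw [frame_apply, if_pos rfl, legendreV_last]; ring
  have hpf : f * p = facA φ - ∑ i, mix φ i * mix φ i * p := by
    rw [← h.eq, opMA, ← Finset.sum_mul]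
    linear_combination facA φ * hp
  obtain ⟨C, hC, hCA⟩ := h.exists_trace_le
  obtain ⟨c, hc, hcf⟩ := h.pos
  have hBge : ∀ z, ev z p ≤ C / c := by
    intro z
    have e1 := congrArg (ev z) hp
    rw [map_mul, map_one] at e1
    have hB := h.facB_pos z
    have hp0 : 0 < ev z p := pos_of_mul_pos_left (e1 ▸ one_pos) hB.le
    have e2 := h.ev_eq z
    have e3 := hcf z
    have e4 : 0 ≤ ∑ i, ev z (mix φ i) ^ 2 := by positivity
    have e5 : c * ev z p ≤ ev z (facA φ) := by
      have := mul_le_mul_of_nonneg_right (show c ≤ ev z (facA φ) * ev z (facB φ) by linarith) hp0.le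
      linear_combination this + ev z (facA φ) * e1
    rw [le_div_iff₀ hc]
    linarith [hCA z]
  have hp0 : ∀ z, 0 < ev z p := fun z => by
    have e1 := congrArg (ev z) hp
    rw [map_mul, map_one] at e1
    exact pos_of_mul_pos_left (e1 ▸ one_pos) (h.facB_pos z).le
  have hmix : ∀ i z, |ev z (mix φ i)| ≤ C := fun i z => by
    have e1 := h.ev_eq z
    have e2 : ev z (mix φ i) ^ 2 ≤ ∑ i, ev z (mix φ i) ^ 2 :=
      Finset.single_le_sum (f := fun i => ev z (mix φ i) ^ 2) (fun _ _ => sq_nonneg _)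
        (Finset.mem_univ i)
    have e3 := hcf z
    have e4 := hCA z
    have e5 := h.facA_pos z
    have e6 := h.facB_pos z
    refine abs_le_of_sq_le_sq (?_ : _ ≤ C ^ 2) hC.le
    nlinarith
  refine ⟨fun α β => ?_, ?_, ?_, h.pos, h.bdd_f, fun α => ?_, ?_⟩
  · refine Fin.lastCases ?_ (fun i => ?_) α <;> refine Fin.lastCases ?_ (fun j => ?_) β
    · rfl
    · rw [show Fin.last 4 = 4 from rfl, hf4, hfr, legendreV_castSucc, legendreV_last]
      simp only [map_neg, Derivation.leibniz, smul_eq_mul, hdp, hm4]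
      ring
    · rw [show Fin.last 4 = 4 from rfl, hf4, hfr, legendreV_castSucc, legendreV_last]
      simp only [map_neg, Derivation.leibniz, smul_eq_mul, hdp, hm4]
      ring
    · rw [hfr, hfr, legendreV_castSucc, legendreV_castSucc]
      simp only [map_neg, Derivation.leibniz, smul_eq_mul, hdp, hm4, hmm i j]
      ring
  · rw [legendreV_last, hpf, hf4]
    simp only [hfr, legendreV_castSucc, map_neg, map_sub, map_add, Derivation.leibniz, smul_eq_mul,
      hdp, hm4, hA4, Fin.sum_univ_four]
    ring
  · rw [legendreV_last, hp]
  · refine Fin.lastCases ?_ (fun i => ?_) α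
    · refine ⟨C / c, fun z => ?_⟩
      rw [show Fin.last 4 = 4 from rfl, legendreV_last, abs_of_pos (hp0 z)]
      exact hBge z
    · refine ⟨C * (C / c), fun z => ?_⟩
      rw [legendreV_castSucc, map_neg, abs_neg, map_mul, abs_mul, abs_of_pos (hp0 z)]
      exact mul_le_mul (hmix i z) (hBge z) (hp0 z).le hC.le
  · refine ⟨C, fun z => ?_⟩
    rw [abs_of_pos (h.facB_pos z)]
    linarith [hCA z, h.facA_pos z]

/-- Uniform bounds of all derivatives of the Laplacian of solutions. -/
theorem Solves.bdd_laplacian (h : Solves φ f) (l : List (Fin 5)) :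
    Bdd (dList l (∑ j, dF j (dF j φ))) := by
  obtain ⟨p, hp⟩ := h.exists_inv
  have hL := h.legendreData hp
  have hp0 : Weighted (legendreV φ p) f (facB φ) 0 p := by
    simpa only [legendreV_last] using Weighted.of_V (V := legendreV φ p) 4
  have hm : ∀ i, Weighted (legendreV φ p) f (facB φ) 0 (mix φ i) := fun i => by
    have : mix φ i = -(legendreV φ p i.castSucc * facB φ) := by
      rw [legendreV_castSucc]
      linear_combination -(mix φ i) * hp
    rw [this]
    exact ((Weighted.of_V _).mul Weighted.inv).neg
  have hA : Weighted (legendreV φ p) f (facB φ) 0 (facA φ) := by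
    have : facA φ = (f + (mix φ 0 * mix φ 0 + mix φ 1 * mix φ 1 + mix φ 2 * mix φ 2
        + mix φ 3 * mix φ 3)) * p := by
      rw [← h.eq, opMA, Fin.sum_univ_four]
      linear_combination -(facA φ) * hp
    rw [this]
    have hmm : ∀ i, Weighted (legendreV φ p) f (facB φ) 0 (mix φ i * mix φ i) := fun i =>
      (hm i).mul (hm i)
    exact (Weighted.of_f.add ((((hmm 0).add (hmm 1)).add (hmm 2)).add (hmm 3))).mul hp0
  have : ∑ j, dF j (dF j φ) = facA φ + facB φ - algebraMap ℝ (ι → SP) 2 := by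
    rw [facA_add_facB, map_ofNat]; ring
  rw [this]
  exact hL.bdd_dList ((hA.add Weighted.inv).sub (Weighted.const 2)) l

end Apriori

end TorusMA

namespace TorusMA

open Filter Topology UnitAddTorus
open scoped ContDiff ComplexConjugate

section Fourier

/-! ### Fourier coefficients of smooth functions on `T⁵` -/

noncomputable local instance : MeasureSpace UnitAddCircle := ⟨AddCircle.haarAddCircle⟩

local instance : Measure.IsAddHaarMeasure (volume : Measure UnitAddCircle) :=
  inferInstanceAs (Measure.IsAddHaarMeasure AddCircle.haarAddCircle)

local instance : IsProbabilityMeasure (volume : Measure UnitAddCircle) :=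
  inferInstanceAs (IsProbabilityMeasure AddCircle.haarAddCircle)

/-- The projection `ℝ⁵ → T⁵`. -/
def toTorus : C(Fin 5 → ℝ, UnitAddTorus (Fin 5)) where
  toFun x := fun i => (x i : UnitAddCircle)
  continuous_toFun := continuous_pi fun i => (AddCircle.continuous_mk' 1).comp (continuous_apply i)

lemma toTorus_apply (x : Fin 5 → ℝ) (i : Fin 5) : toTorus x i = (x i : UnitAddCircle) := rfl

lemma isOpenQuotientMap_toTorus : IsOpenQuotientMap toTorus :=
  IsOpenQuotientMap.piMap fun _ => QuotientAddGroup.isOpenQuotientMap_mk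

lemma eq_of_toTorus_eq {E : Type*} {f : (Fin 5 → ℝ) → E}
    (hf : ∀ x : Fin 5 → ℝ, ∀ i : Fin 5, f (x + Pi.single i 1) = f x) {x y : Fin 5 → ℝ}
    (h : toTorus x = toTorus y) : f x = f y := by
  have h1 : ∀ i, ∃ n : ℤ, y i = x i + n := fun i => by
    obtain ⟨n, hn⟩ := (QuotientAddGroup.eq_iff_sub_mem.1 (congrFun h i).symm)
    exact ⟨n, by simp at hn; linarith⟩
  choose n hn using h1
  rw [show y = fun i => x i + n i from funext hn, periodic_shift hf]

lemma SP.factorsThrough (g : SP) : Function.FactorsThrough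
    (⟨fun x => (g.1 x : ℂ), Complex.continuous_ofReal.comp g.continuous⟩ : C(Fin 5 → ℝ, ℂ))
    toTorus :=
  fun _ _ h => eq_of_toTorus_eq (f := fun x => (g.1 x : ℂ)) (fun x i => by rw [g.periodic x i]) h

/-- A smooth function on `T⁵`, as a continuous function on the torus. -/
noncomputable def SP.lift (g : SP) : C(UnitAddTorus (Fin 5), ℂ) :=
  isOpenQuotientMap_toTorus.isQuotientMap.lift _ g.factorsThrough

lemma SP.lift_toTorus (g : SP) (x : Fin 5 → ℝ) : g.lift (toTorus x) = (g.1 x : ℂ) :=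
  DFunLike.congr_fun
    (isOpenQuotientMap_toTorus.isQuotientMap.lift_comp _ g.factorsThrough) x

lemma forall_torus {p : UnitAddTorus (Fin 5) → Prop} (h : ∀ x, p (toTorus x)) (t) : p t := by
  obtain ⟨x, rfl⟩ := isOpenQuotientMap_toTorus.surjective t
  exact h x

/-- The characters of `T⁵`. -/
noncomputable def chi (n : Fin 5 → ℤ) (x : Fin 5 → ℝ) : ℂ := mFourier n (toTorus x)

lemma chi_eq_exp (n : Fin 5 → ℤ) (x : Fin 5 → ℝ) :
    chi n x = Complex.exp (2 * Real.pi * Complex.I * ∑ i, n i * x i) := by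
  simp only [chi, mFourier, toTorus_apply, ContinuousMap.coe_mk, fourier_coe_apply]
  rw [← Complex.exp_sum, Complex.ofReal_sum, Finset.mul_sum]
  congr 1
  refine Finset.sum_congr rfl fun i _ => ?_
  push_cast; ring

lemma norm_chi (n : Fin 5 → ℤ) (x : Fin 5 → ℝ) : ‖chi n x‖ = 1 := by
  rw [chi_eq_exp, show (2 * Real.pi * Complex.I * (∑ i, n i * x i : ℝ) : ℂ)
    = ((2 * Real.pi * ∑ i, (n i : ℝ) * x i : ℝ) : ℂ) * Complex.I by push_cast; ring,
    Complex.norm_exp_ofReal_mul_I]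

lemma chi_neg (n : Fin 5 → ℤ) (x : Fin 5 → ℝ) : chi (-n) x = conj (chi n x) := mFourier_neg

lemma chi_add (m n : Fin 5 → ℤ) (x : Fin 5 → ℝ) : chi (m + n) x = chi m x * chi n x := mFourier_add

lemma chi_zero (x : Fin 5 → ℝ) : chi 0 x = 1 := by simp [chi, mFourier_zero]

lemma toTorus_add (x y : Fin 5 → ℝ) : toTorus (x + y) = toTorus x + toTorus y := rfl

lemma chi_add_right (n : Fin 5 → ℤ) (x y : Fin 5 → ℝ) : chi n (x + y) = chi n x * chi n y := by
  simp only [chi_eq_exp, ← Complex.exp_add, Pi.add_apply]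
  congr 1
  push_cast
  rw [← mul_add, ← Finset.sum_add_distrib]
  simp only [mul_add]

lemma chi_periodic (n : Fin 5 → ℤ) (x : Fin 5 → ℝ) (i : Fin 5) :
    chi n (x + Pi.single i 1) = chi n x := by
  unfold chi
  congr 1
  ext j
  by_cases h : j = i
  · subst h; simp [toTorus_apply]
  · simp [toTorus_apply, h]

/-- Fourier coefficients of a smooth function on `T⁵`. -/
noncomputable def hat (g : SP) (n : Fin 5 → ℤ) : ℂ := mFourierCoeff g.lift n

lemma hat_eq (g : SP) (n : Fin 5 → ℤ) : hat g n = ∫ t, mFourier (-n) t * g.lift t := rfl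

lemma integrable_torus (f : C(UnitAddTorus (Fin 5), ℂ)) : Integrable f :=
  f.continuous.integrable_of_hasCompactSupport (HasCompactSupport.of_compactSpace _)

lemma integrable_hat (g : SP) (n : Fin 5 → ℤ) :
    Integrable fun t => mFourier n t * g.lift t := integrable_torus (mFourier n * g.lift)

lemma lift_add (g h : SP) : (g + h).lift = g.lift + h.lift :=
  ContinuousMap.ext <| forall_torus fun x => by simp [SP.lift_toTorus]

lemma lift_smul (r : ℝ) (g : SP) : (r • g).lift = (r : ℂ) • g.lift :=
  ContinuousMap.ext <| forall_torus fun x => by simp [SP.lift_toTorus]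

lemma lift_mul (g h : SP) : (g * h).lift = g.lift * h.lift :=
  ContinuousMap.ext <| forall_torus fun x => by simp [SP.lift_toTorus]

lemma lift_one : (1 : SP).lift = 1 :=
  ContinuousMap.ext <| forall_torus fun x => by simp [SP.lift_toTorus]

lemma hat_add (g h : SP) (n : Fin 5 → ℤ) : hat (g + h) n = hat g n + hat h n := by
  simp only [hat_eq, lift_add, ContinuousMap.add_apply, mul_add]
  exact integral_add (integrable_hat g _) (integrable_hat h _)

lemma hat_smul (r : ℝ) (g : SP) (n : Fin 5 → ℤ) : hat (r • g) n = r * hat g n := by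
  simp only [hat_eq, lift_smul, ContinuousMap.smul_apply, smul_eq_mul, mul_left_comm _ (r : ℂ)]
  exact integral_const_mul _ _

/-- The Fourier transform as a linear map. -/
noncomputable def hatL (n : Fin 5 → ℤ) : SP →ₗ[ℝ] ℂ where
  toFun g := hat g n
  map_add' g h := hat_add g h n
  map_smul' r g := by simp [hat_smul]

lemma hat_sum {ι : Type*} (s : Finset ι) (g : ι → SP) (n : Fin 5 → ℤ) :
    hat (∑ i ∈ s, g i) n = ∑ i ∈ s, hat (g i) n := map_sum (hatL n) g s

lemma hat_sub (g h : SP) (n : Fin 5 → ℤ) : hat (g - h) n = hat g n - hat h n := map_sub (hatL n) g h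

lemma integral_mFourier (n : Fin 5 → ℤ) :
    ∫ t, mFourier n t = if n = 0 then (1 : ℂ) else 0 := by
  have h := orthonormal_iff_ite.1 (orthonormal_mFourier (d := Fin 5)) 0 n
  rw [ContinuousMap.inner_toLp] at h
  simpa [← mFourier_neg, mFourier_zero, eq_comm] using h

lemma hat_one (n : Fin 5 → ℤ) : hat 1 n = if n = 0 then 1 else 0 := by
  simp only [hat_eq, lift_one, ContinuousMap.one_apply, mul_one, integral_mFourier, neg_eq_zero]

lemma norm_hat_le {g : SP} {C : ℝ} (hC : ∀ x, |g.1 x| ≤ C) (n : Fin 5 → ℤ) : ‖hat g n‖ ≤ C := by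
  have : ∀ t, ‖mFourier (-n) t * g.lift t‖ ≤ C := forall_torus fun x => by
    rw [norm_mul, SP.lift_toTorus, show ‖mFourier (-n) (toTorus x)‖ = 1 from norm_chi _ _, one_mul]
    simpa using hC x
  simpa [hat_eq] using norm_integral_le_of_norm_le_const
    (μ := (volume : Measure (UnitAddTorus (Fin 5)))) (Filter.Eventually.of_forall this)

lemma hat_neg (g : SP) (n : Fin 5 → ℤ) : hat g (-n) = conj (hat g n) := by
  rw [hat_eq, hat_eq, ← integral_conj]
  congr 1
  ext t
  revert t
  refine forall_torus fun x => ?_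
  rw [map_mul, SP.lift_toTorus, Complex.conj_ofReal, ← mFourier_neg]

lemma hat_translate (g : SP) (n : Fin 5 → ℤ) (y : Fin 5 → ℝ) :
    ∫ t, mFourier (-n) t * g.lift (t + toTorus y) = chi n y * hat g n := by
  rw [hat_eq, ← integral_add_right_eq_self (fun t => mFourier (-n) t * g.lift t) (toTorus y),
    ← integral_const_mul]
  congr 1
  ext t
  revert t
  refine forall_torus fun x => ?_
  rw [← toTorus_add]
  change _ = chi n y * (chi (-n) (x + y) * _)
  have h : chi n y * chi (-n) y = 1 := by rw [← chi_add, add_neg_cancel, chi_zero]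
  rw [chi_add_right, show chi n y * (chi (-n) x * chi (-n) y * g.lift (toTorus (x + y))) =
    (chi n y * chi (-n) y) * (chi (-n) x * g.lift (toTorus (x + y))) by ring, h, one_mul]
  rfl

lemma hasDerivAt_chi_single (n : Fin 5 → ℤ) (j : Fin 5) (s : ℝ) :
    HasDerivAt (fun s : ℝ => chi n (s • Pi.single j 1))
      (2 * Real.pi * Complex.I * n j * chi n (s • Pi.single j 1)) s := by
  have h : ∀ s : ℝ, chi n (s • Pi.single j 1)
      = Complex.exp (2 * Real.pi * Complex.I * n j * (s : ℂ)) := fun s => by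
    rw [chi_eq_exp]
    congr 1
    simp [Pi.single_apply, mul_ite]
    ring
  simp only [h]
  have := ((hasDerivAt_id (s : ℂ)).const_mul (2 * Real.pi * Complex.I * n j)).cexp.comp_ofReal
  simpa [mul_comm] using this

lemma hat_dSP (j : Fin 5) (g : SP) (n : Fin 5 → ℤ) :
    hat (dSP j g) n = 2 * Real.pi * Complex.I * n j * hat g n := by
  obtain ⟨C, hC⟩ := (dSP j g).exists_bound
  have h1 := hasDerivAt_integral_of_dominated_loc_of_deriv_le
    (μ := (volume : Measure (UnitAddTorus (Fin 5))))
    (F := fun (s : ℝ) t => mFourier (-n) t * g.lift (t + toTorus (s • Pi.single j 1)))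
    (F' := fun (s : ℝ) t => mFourier (-n) t * (dSP j g).lift (t + toTorus (s • Pi.single j 1)))
    (x₀ := (0 : ℝ)) (s := Set.univ) (bound := fun _ => C) Filter.univ_mem
    (Filter.Eventually.of_forall fun s => (by fun_prop : Continuous _).aestronglyMeasurable)
    (integrable_torus ((mFourier (-n)) *
      g.lift.comp ⟨fun t => t + toTorus ((0 : ℝ) • Pi.single j 1), by fun_prop⟩))
    (by fun_prop : Continuous _).aestronglyMeasurable
    (Filter.Eventually.of_forall <| forall_torus fun x s _ => by
      rw [← toTorus_add, norm_mul, SP.lift_toTorus,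
        show ‖mFourier (-n) (toTorus x)‖ = 1 from norm_chi _ _, one_mul]
      simpa using hC _)
    (integrable_const _)
    (Filter.Eventually.of_forall <| forall_torus fun x s _ => by
      simp only [← toTorus_add, SP.lift_toTorus]
      refine HasDerivAt.const_mul _ ?_
      have := hasDerivAt_line g x (Pi.single j 1) s
      simp only [Pi.single_apply, ite_mul, one_mul, zero_mul, Finset.sum_ite_eq',
        Finset.mem_univ, if_true] at this
      exact this.ofReal_comp)
  have h2 := h1.2
  simp only [hat_translate] at h2
  have h3 := (hasDerivAt_chi_single n j 0).mul_const (hat g n)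
  have h4 := h2.unique h3
  simpa [chi_eq_exp] using h4

lemma re_sum_conj_mul_hat_nonneg {a : Fin 5 → Fin 5 → SP}
    (ha : ∀ x (ξ : Fin 5 → ℝ), 0 ≤ ∑ i, ∑ j, (a i j).1 x * (ξ i * ξ j))
    (S : Finset (Fin 5 → ℤ)) (V : (Fin 5 → ℤ) → Fin 5 → ℂ) :
    0 ≤ (∑ n ∈ S, ∑ k ∈ S, ∑ i, ∑ j, conj (V n i) * V k j * hat (a i j) (n - k)).re := by
  have hint : ∀ n k i j, Integrable fun t =>
      conj (V n i) * V k j * (mFourier (-(n - k)) t * (a i j).lift t) := fun n k i j =>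
    (integrable_hat _ _).const_mul _
  have e : ∑ n ∈ S, ∑ k ∈ S, ∑ i, ∑ j, conj (V n i) * V k j * hat (a i j) (n - k)
      = ∫ t, ∑ n ∈ S, ∑ k ∈ S, ∑ i, ∑ j,
        conj (V n i) * V k j * (mFourier (-(n - k)) t * (a i j).lift t) := by
    rw [integral_finsetSum _ fun n _ => integrable_finsetSum _ fun k _ =>
      integrable_finsetSum _ fun i _ => integrable_finsetSum _ fun j _ => hint n k i j]
    refine Finset.sum_congr rfl fun n _ => ?_
    rw [integral_finsetSum _ fun k _ => integrable_finsetSum _ fun i _ =>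
      integrable_finsetSum _ fun j _ => hint n k i j]
    refine Finset.sum_congr rfl fun k _ => ?_
    rw [integral_finsetSum _ fun i _ => integrable_finsetSum _ fun j _ => hint n k i j]
    refine Finset.sum_congr rfl fun i _ => ?_
    rw [integral_finsetSum _ fun j _ => hint n k i j]
    exact Finset.sum_congr rfl fun j _ => (integral_const_mul _ _).symm
  rw [e]
  refine (integral_nonneg ?_).trans_eq (Complex.reCLM.integral_comp_comm
    (integrable_finsetSum _ fun n _ => integrable_finsetSum _ fun k _ =>
      integrable_finsetSum _ fun i _ => integrable_finsetSum _ fun j _ => hint n k i j))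
  refine forall_torus fun x => ?_
  set X : Fin 5 → ℂ := fun j => ∑ k ∈ S, V k j * chi k x with hX
  have e2 : ∑ n ∈ S, ∑ k ∈ S, ∑ i, ∑ j,
        conj (V n i) * V k j * (mFourier (-(n - k)) (toTorus x) * (a i j).lift (toTorus x))
      = ∑ i, ∑ j, ((a i j).1 x : ℂ) * (conj (X i) * X j) := by
    have : ∀ i j, ((a i j).1 x : ℂ) * (conj (X i) * X j) = ∑ n ∈ S, ∑ k ∈ S,
        conj (V n i) * V k j * (mFourier (-(n - k)) (toTorus x) * (a i j).lift (toTorus x)) := by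
      intro i j
      simp only [hX, map_sum]
      rw [Finset.sum_mul_sum, Finset.mul_sum]
      refine Finset.sum_congr rfl fun n _ => ?_
      rw [Finset.mul_sum]
      refine Finset.sum_congr rfl fun k _ => ?_
      have h1 : mFourier (-(n - k)) (toTorus x) = conj (chi n x) * chi k x := by
        rw [← chi_neg, ← chi_add]; unfold chi; congr 2; abel
      rw [h1, SP.lift_toTorus, map_mul]
      ring
    simp only [this]
    rw [Finset.sum_congr rfl fun n _ => Finset.sum_comm, Finset.sum_comm]
    refine Finset.sum_congr rfl fun i _ => ?_
    rw [Finset.sum_congr rfl fun n _ => Finset.sum_comm, Finset.sum_comm]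
  simp only [Pi.zero_apply, Complex.reCLM_apply]
  rw [e2]
  have h1 := add_nonneg (ha x fun i => (X i).re) (ha x fun i => (X i).im)
  simp only [← Finset.sum_add_distrib] at h1
  refine h1.trans_eq ?_
  simp only [Complex.re_sum]
  refine Finset.sum_congr rfl fun i _ => Finset.sum_congr rfl fun j _ => ?_
  simp
  ring

/-! ### The frequency weight -/

/-- The weight `1 + ∑ |nᵢ|` on frequencies. -/
noncomputable def wgt (n : Fin 5 → ℤ) : ℝ := 1 + ∑ i, |(n i : ℝ)|

lemma one_le_wgt (n : Fin 5 → ℤ) : 1 ≤ wgt n :=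
  le_add_of_nonneg_right (Finset.sum_nonneg fun _ _ => abs_nonneg _)

lemma wgt_pos (n : Fin 5 → ℤ) : 0 < wgt n := one_pos.trans_le (one_le_wgt n)

lemma abs_le_wgt (n : Fin 5 → ℤ) (i : Fin 5) : 1 + |(n i : ℝ)| ≤ wgt n :=
  add_le_add_right (Finset.single_le_sum (f := fun i => |(n i : ℝ)|)
    (fun _ _ => abs_nonneg _) (Finset.mem_univ i)) _

lemma wgt_neg (n : Fin 5 → ℤ) : wgt (-n) = wgt n := by simp [wgt]

lemma wgt_add_le (m n : Fin 5 → ℤ) : wgt (m + n) ≤ wgt m + wgt n - 1 := by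
  have : ∑ i, |((m + n) i : ℝ)| ≤ ∑ i, (|(m i : ℝ)| + |(n i : ℝ)|) :=
    Finset.sum_le_sum fun i _ => by simpa using abs_add_le (m i : ℝ) (n i)
  rw [Finset.sum_add_distrib] at this
  unfold wgt
  linarith

lemma summable_one_add_abs_sq_inv : Summable fun k : ℤ => ((1 + |(k : ℝ)|) ^ 2)⁻¹ := by
  have h : Summable fun k : ℕ => ((1 + (k : ℝ)) ^ 2)⁻¹ := by
    have := (summable_nat_add_iff 1).2 (Real.summable_nat_pow_inv.2 (by norm_num : 1 < 2))
    refine this.congr fun k => ?_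
    push_cast; rw [add_comm]
  exact Summable.of_nat_of_neg (by simpa using h) (by simpa using h)

lemma summable_prod_apply {ι κ : Type*} [Fintype ι] [DecidableEq ι] [DecidableEq κ] {a : κ → ℝ}
    (ha0 : ∀ k, 0 ≤ a k) (ha : Summable a) : Summable fun n : ι → κ => ∏ i, a (n i) := by
  refine summable_of_sum_le (c := ∏ _i : ι, ∑' k, a k)
    (fun n => Finset.prod_nonneg fun i _ => ha0 _) fun s => ?_
  calc ∑ n ∈ s, ∏ i, a (n i)
      ≤ ∑ n ∈ Fintype.piFinset fun i => s.image fun n => n i, ∏ i, a (n i) :=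
        Finset.sum_le_sum_of_subset_of_nonneg
          (fun n hn => Fintype.mem_piFinset.2 fun i => Finset.mem_image_of_mem (fun n => n i) hn)
          fun n _ _ => Finset.prod_nonneg fun i _ => ha0 _
    _ = ∏ i, ∑ k ∈ s.image fun n => n i, a k :=
        by rw [Finset.prod_univ_sum]
    _ ≤ ∏ _i : ι, ∑' k, a k := Finset.prod_le_prod
        (fun i _ => Finset.sum_nonneg fun k _ => ha0 k)
        fun i _ => ha.sum_le_tsum _ fun k _ => ha0 k

lemma summable_wgt : Summable fun n : Fin 5 → ℤ => (wgt n ^ 10)⁻¹ := by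
  refine (summable_prod_apply (ι := Fin 5) (fun k => by positivity)
    summable_one_add_abs_sq_inv).of_nonneg_of_le (fun n => by have := wgt_pos n; positivity)
    fun n => ?_
  rw [Finset.prod_inv_distrib]
  refine inv_anti₀ (Finset.prod_pos fun i _ => by positivity) ?_
  calc ∏ i, (1 + |(n i : ℝ)|) ^ 2 ≤ ∏ _i : Fin 5, wgt n ^ 2 := by
        gcongr with i; exact abs_le_wgt n i
    _ = wgt n ^ 10 := by rw [Finset.prod_const, ← pow_mul]; simp

/-- Rapidly decreasing sequences. -/
def Rapid (c : (Fin 5 → ℤ) → ℂ) : Prop := ∀ N : ℕ, ∃ C, ∀ n, wgt n ^ N * ‖c n‖ ≤ C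

lemma summable_of_wgt_le {c : (Fin 5 → ℤ) → ℂ} {N : ℕ} {C : ℝ}
    (h : ∀ n, wgt n ^ (N + 10) * ‖c n‖ ≤ C) : Summable fun n => wgt n ^ N * ‖c n‖ := by
  refine (summable_wgt.mul_left C).of_nonneg_of_le
    (fun n => by have := wgt_pos n; positivity) fun n => ?_
  have := wgt_pos n
  rw [← div_eq_mul_inv, le_div_iff₀ (by positivity)]
  calc wgt n ^ N * ‖c n‖ * wgt n ^ 10 = wgt n ^ (N + 10) * ‖c n‖ := by ring
    _ ≤ C := h n

lemma Rapid.summable_wgt_mul {c : (Fin 5 → ℤ) → ℂ} (h : Rapid c) (N : ℕ) :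
    Summable fun n => wgt n ^ N * ‖c n‖ := by
  obtain ⟨C, hC⟩ := h (N + 10)
  exact summable_of_wgt_le hC

lemma Rapid.summable {c : (Fin 5 → ℤ) → ℂ} (h : Rapid c) : Summable c :=
  Summable.of_norm (by simpa using h.summable_wgt_mul 0)

/-! ### Decay, inversion and convolution -/

lemma exists_wgt_mul_hat_le {ι : Type*} (N : ℕ) (u : ι → SP) (hu : ∀ l, Bdd (dList l u)) :
    ∃ C, ∀ a n, wgt n ^ N * ‖hat (u a) n‖ ≤ C := by
  induction N generalizing u with
  | zero =>
    obtain ⟨C, hC⟩ := hu []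
    exact ⟨C, fun a n => by simpa using norm_hat_le (fun x => hC (a, x)) n⟩
  | succ N ih =>
    obtain ⟨C, hC⟩ := ih u hu
    have hl : ∀ j l, dList l (dF j u) = dList (l ++ [j]) u := fun j l => by
      induction l with
      | nil => rfl
      | cons k l hl => simp [dList, hl]
    choose D hD using fun j => ih (dF j u) fun l => hl j l ▸ hu _
    refine ⟨C + ∑ j, D j, fun a n => ?_⟩
    have h1 : wgt n ^ (N + 1) * ‖hat (u a) n‖
        = wgt n ^ N * ‖hat (u a) n‖ + ∑ j, wgt n ^ N * (|(n j : ℝ)| * ‖hat (u a) n‖) := by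
      rw [← Finset.mul_sum, ← Finset.sum_mul, pow_succ]
      conv_lhs => rw [show wgt n = 1 + ∑ i, |(n i : ℝ)| from rfl]
      unfold wgt; ring
    rw [h1]
    refine add_le_add (hC a n) (Finset.sum_le_sum fun j _ => le_trans ?_ (hD j a n))
    have := wgt_pos n
    gcongr
    rw [dF_apply, hat_dSP]
    simp only [norm_mul, Complex.norm_I, Complex.norm_real, Complex.norm_ofNat, mul_one,
      Complex.norm_intCast, Real.norm_eq_abs, abs_of_pos Real.pi_pos]
    have h3 : 1 ≤ 2 * Real.pi := by linarith [Real.pi_gt_three]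
    have : 0 ≤ |(n j : ℝ)| * ‖hat (u a) n‖ := by positivity
    nlinarith

lemma SP.bdd_const (g : SP) : ∀ l, Bdd (dList l fun _ : Unit => g) := fun l => by
  obtain ⟨C, hC⟩ := (dList l (fun _ : Unit => g) ()).exists_bound
  exact ⟨C, fun z => hC z.2⟩

lemma rapid_hat (g : SP) : Rapid (hat g) := fun N => by
  obtain ⟨C, hC⟩ := exists_wgt_mul_hat_le N _ g.bdd_const
  exact ⟨C, hC ()⟩

lemma hasSum_hat (g : SP) (x : Fin 5 → ℝ) : HasSum (fun n => hat g n * chi n x) (g.1 x : ℂ) := by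
  rw [← g.lift_toTorus]
  exact hasSum_mFourier_series_apply_of_summable (f := g.lift) (rapid_hat g).summable (toTorus x)

lemma hat_injective {g h : SP} (H : ∀ n, hat g n = hat h n) : g = h := by
  ext x
  have h1 := hasSum_hat g x
  simp only [H] at h1
  exact_mod_cast h1.unique (hasSum_hat h x)

lemma norm_mFourier_apply (n : Fin 5 → ℤ) (t : UnitAddTorus (Fin 5)) : ‖mFourier n t‖ = 1 := by
  revert t; exact forall_torus fun x => norm_chi n x

lemma hasSum_integral_series {c : (Fin 5 → ℤ) → ℂ} (hc : Summable c)
    (f : C(UnitAddTorus (Fin 5), ℂ)) :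
    HasSum (fun k => c k * ∫ t, f t * mFourier k t) (∫ t, f t * ∑' k, c k * mFourier k t) := by
  have h1 : ∀ k, ∫ t, f t * (c k * mFourier k t) = c k * ∫ t, f t * mFourier k t := fun k => by
    rw [← integral_const_mul]
    simp only [mul_left_comm]
  simp only [← h1, ← tsum_mul_left]
  refine hasSum_integral_of_summable_integral_norm
    (fun k => integrable_torus (f * (c k • mFourier k))) ?_
  refine Summable.of_nonneg_of_le (fun k => integral_nonneg fun t => norm_nonneg _) (fun k => ?_)
    (hc.norm.mul_left ‖f‖)
  have : ∀ t, ‖‖f t * (c k * mFourier k t)‖‖ ≤ ‖f‖ * ‖c k‖ := fun t => by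
    rw [norm_norm, norm_mul, norm_mul, norm_mFourier_apply, mul_one]
    gcongr
    exact f.norm_coe_le_norm t
  refine (le_abs_self _).trans ?_
  simpa using norm_integral_le_of_norm_le_const (μ := (volume : Measure (UnitAddTorus (Fin 5))))
      (Filter.Eventually.of_forall this)

lemma hasSum_hat_mul (g h : SP) (n : Fin 5 → ℤ) :
    HasSum (fun k => hat g (n - k) * hat h k) (hat (g * h) n) := by
  have h1 := hasSum_integral_series (rapid_hat h).summable (mFourier (-n) * g.lift)
  have h2 : ∀ t, ∑' k, hat h k * mFourier k t = h.lift t := forall_torus fun x => by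
    rw [h.lift_toTorus, ← (hasSum_hat h x).tsum_eq]; rfl
  simp only [h2] at h1
  rw [hat_eq, lift_mul]
  simp only [ContinuousMap.mul_apply, ← mul_assoc] at h1 ⊢
  convert h1 using 2 with k
  rw [hat_eq, mul_comm, ← integral_const_mul, ← integral_const_mul]
  congr 1
  ext t
  rw [neg_sub, sub_eq_add_neg, mFourier_add]
  ring

lemma hat_zero_eq (g : SP) (a : Fin 5 → ℝ) :
    hat g 0 = ((∫ x in Set.Icc a (fun i => a i + 1), g.1 x : ℝ) : ℂ) := by
  rw [hat, mFourierCoeff_eq_integral _ _ a, ← integral_complex_ofReal]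
  have h1 : {x : Fin 5 → ℝ | ∀ i, x i ∈ Set.Ioc (a i) (a i + 1)}
      = Set.univ.pi fun i => Set.Ioc (a i) (a i + 1) := by ext; simp
  rw [h1, volume_pi, setIntegral_congr_set (Measure.univ_pi_Ioc_ae_eq_Icc)]
  congr 1
  ext x
  change mFourier (-0) (toTorus x) * g.lift (toTorus x) = _
  rw [neg_zero, mFourier_zero, g.lift_toTorus]
  simp

/-! ### Synthesis -/

lemma iteratedDeriv_cexp_real (a : ℂ) (k : ℕ) :
    iteratedDeriv k (fun s : ℝ => Complex.exp (a * s))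
      = fun s : ℝ => a ^ k * Complex.exp (a * s) := by
  induction k with
  | zero => simp
  | succ k ih =>
    rw [iteratedDeriv_succ, ih]
    ext s
    have := (((hasDerivAt_id (s : ℂ)).const_mul a).cexp.comp_ofReal).const_mul (a ^ k)
    rw [show (fun s : ℝ => a ^ k * Complex.exp (a * s))
      = fun y : ℝ => a ^ k * Complex.exp (a * id (y : ℂ))
      from rfl, this.deriv]
    simp; ring

lemma contDiff_cexp_real (a : ℂ) : ContDiff ℝ (⊤ : ℕ∞) fun s : ℝ => Complex.exp (a * s) :=
  (contDiff_const.mul Complex.ofRealCLM.contDiff).cexp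

lemma contDiff_chi (n : Fin 5 → ℤ) : ContDiff ℝ (⊤ : ℕ∞) (chi n) := by
  rw [funext (chi_eq_exp n)]
  exact (contDiff_cexp_real _).comp (by fun_prop)

lemma norm_iteratedFDeriv_chi_le (n : Fin 5 → ℤ) (k : ℕ) (x : Fin 5 → ℝ) :
    ‖iteratedFDeriv ℝ k (chi n) x‖ ≤ (2 * Real.pi) ^ k * wgt n ^ k := by
  set L : (Fin 5 → ℝ) →L[ℝ] ℝ := ∑ i, (n i : ℝ) • ContinuousLinearMap.proj i with hL
  have hLx : ∀ x, L x = ∑ i, n i * x i := fun x => by simp [hL]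
  have hLn : ‖L‖ ≤ wgt n := by
    refine L.opNorm_le_bound (wgt_pos n).le fun x => ?_
    rw [hLx, wgt, add_mul, Finset.sum_mul]
    refine (norm_sum_le _ _).trans ((Finset.sum_le_sum fun i _ => ?_).trans
      (le_add_of_nonneg_left (by positivity)))
    rw [norm_mul, Real.norm_eq_abs]
    gcongr
    exact norm_le_pi_norm x i
  set e : ℝ → ℂ := fun s => Complex.exp (2 * Real.pi * Complex.I * s) with he
  have h1 : chi n = e ∘ L := funext fun x => by rw [chi_eq_exp, Function.comp, hLx]
  rw [h1, L.iteratedFDeriv_comp_right (n := (⊤ : ℕ∞)) (contDiff_cexp_real _) x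
    (WithTop.coe_le_coe.2 le_top)]
  refine (ContinuousMultilinearMap.norm_compContinuousLinearMap_le _ _).trans ?_
  rw [norm_iteratedFDeriv_eq_norm_iteratedDeriv, iteratedDeriv_cexp_real, Finset.prod_const,
    Finset.card_univ, Fintype.card_fin]
  have h2 : ‖Complex.exp (2 * Real.pi * Complex.I * (L x : ℝ))‖ = 1 := by
    rw [show (2 * Real.pi * Complex.I * (L x : ℝ) : ℂ) = ((2 * Real.pi * L x : ℝ) : ℂ) * Complex.I
      by push_cast; ring, Complex.norm_exp_ofReal_mul_I]
  rw [norm_mul, h2, norm_pow]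
  simp only [norm_mul, Complex.norm_I, Complex.norm_real, Complex.norm_ofNat, mul_one,
      Real.norm_eq_abs, abs_of_pos Real.pi_pos]
  gcongr

lemma exists_hat_eq {c : (Fin 5 → ℤ) → ℂ} (hc : Rapid c) (hs : ∀ n, c (-n) = conj (c n)) :
    ∃ φ : SP, ∀ n, hat φ n = c n := by
  have hcd : ContDiff ℝ (⊤ : ℕ∞) fun x => ∑' n, c n * chi n x := by
    refine contDiff_tsum (v := fun k n => (2 * Real.pi) ^ k * (wgt n ^ k * ‖c n‖))
      (fun n => contDiff_const.mul (contDiff_chi n)) (fun k _ => (hc.summable_wgt_mul k).mul_left _)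
      fun k n x _ => ?_
    simp only [← smul_eq_mul (a := c n)]
    rw [iteratedFDeriv_const_smul_apply' ((contDiff_chi n).contDiffAt.of_le
      (WithTop.coe_le_coe.2 le_top)), norm_smul]
    nlinarith [norm_iteratedFDeriv_chi_le n k x, norm_nonneg (c n)]
  have hre : ∀ x, conj (∑' n, c n * chi n x) = ∑' n, c n * chi n x := fun x => by
    rw [Complex.conj_tsum, ← (Equiv.neg (Fin 5 → ℤ)).tsum_eq]
    refine tsum_congr fun n => ?_
    rw [map_mul, ← hs, ← chi_neg, Equiv.neg_apply, neg_neg]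
  let φ : SP := ⟨fun x => (∑' n, c n * chi n x).re, Complex.reCLM.contDiff.comp hcd, fun x i => by
    simp only [chi_periodic]⟩
  have hφ : ∀ x, (φ.1 x : ℂ) = ∑' n, c n * chi n x := fun x => Complex.conj_eq_iff_re.1 (hre x)
  refine ⟨φ, fun n => ?_⟩
  have h2 : ∀ t, ∑' k, c k * mFourier k t = φ.lift t := forall_torus fun x => by
    rw [φ.lift_toTorus, hφ]; rfl
  have h1 := hasSum_integral_series hc.summable (mFourier (-n))
  simp only [h2, ← mFourier_add, integral_mFourier] at h1
  rw [hat_eq]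
  refine h1.unique ?_
  convert hasSum_ite_eq n (c n) using 2 with k
  rcases eq_or_ne k n with rfl | h
  · simp
  · simp [neg_add_eq_zero, h, h.symm]

end Fourier

end TorusMA

namespace TorusMA

open Filter Topology
open scoped ContDiff ComplexConjugate

/-! ### The Monge-Ampère equation on the Fourier side -/

/-- Squared Euclidean length of a frequency. -/
def nsq (n : Fin 5 → ℤ) : ℝ := ∑ j, (n j : ℝ) ^ 2

/-- Euclidean product of the first four components. -/
def dot4 (m k : Fin 5 → ℤ) : ℝ := ∑ i : Fin 4, (m i.castSucc : ℝ) * k i.castSucc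

/-- The symbol of the symmetrised quadratic part of the Monge-Ampère operator. -/
noncomputable def sym (m k : Fin 5 → ℤ) : ℝ :=
  (dot4 m m * (k 4 : ℝ) ^ 2 + dot4 k k * (m 4 : ℝ) ^ 2) / 2 - dot4 m k * (m 4 * k 4)

lemma nsq_eq (n : Fin 5 → ℤ) : nsq n = dot4 n n + (n 4 : ℝ) ^ 2 := by
  rw [nsq, Fin.sum_univ_castSucc (n := 4), dot4]; simp only [sq]; rfl

lemma dot4_comm (m k : Fin 5 → ℤ) : dot4 m k = dot4 k m := by simp only [dot4, mul_comm]

lemma sym_comm (m k : Fin 5 → ℤ) : sym m k = sym k m := by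
  rw [sym, sym, dot4_comm m k]; ring

lemma sym_neg_self (k : Fin 5 → ℤ) : sym (0 - k) k = 0 := by
  have h : dot4 (0 - k) (0 - k) = dot4 k k := by simp [dot4]
  have h' : dot4 (0 - k) k = - dot4 k k := by simp [dot4]
  rw [sym, h, h']; simp; ring

lemma sym_neg_neg (m k : Fin 5 → ℤ) : sym (-m) (-k) = sym m k := by
  simp [sym, dot4]

lemma one_le_nsq {n : Fin 5 → ℤ} (hn : n ≠ 0) : 1 ≤ nsq n := by
  obtain ⟨j, hj⟩ := Function.ne_iff.1 hn
  have h1 : (1 : ℝ) ≤ (n j : ℝ) ^ 2 := by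
    rw [← sq_abs]
    exact one_le_pow₀ (by exact_mod_cast Int.one_le_abs hj)
  exact h1.trans (Finset.single_le_sum (f := fun j => (n j : ℝ) ^ 2) (fun _ _ => sq_nonneg _)
    (Finset.mem_univ j))

lemma sum_abs_le_wgt (n : Fin 5 → ℤ) :
    ∑ i : Fin 4, |(n i.castSucc : ℝ)| + |(n 4 : ℝ)| ≤ wgt n := by
  rw [wgt, Fin.sum_univ_castSucc (n := 4)]
  exact le_add_of_nonneg_left zero_le_one

lemma abs_dot4_le (m k : Fin 5 → ℤ) :
    |dot4 m k| ≤ (∑ i : Fin 4, |(m i.castSucc : ℝ)|) * ∑ i : Fin 4, |(k i.castSucc : ℝ)| := by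
  refine (Finset.abs_sum_le_sum_abs _ _).trans ?_
  rw [Finset.sum_mul]
  refine Finset.sum_le_sum fun i _ => ?_
  rw [abs_mul]
  gcongr
  exact Finset.single_le_sum (f := fun i : Fin 4 => |(k i.castSucc : ℝ)|)
    (fun _ _ => abs_nonneg _) (Finset.mem_univ i)

lemma abs_sym_le (m k : Fin 5 → ℤ) : |sym m k| ≤ 2 * (wgt m ^ 2 * wgt k ^ 2) := by
  have h : ∀ m : Fin 5 → ℤ, abs (∑ i : Fin 4, |(m i.castSucc : ℝ)|) ≤ wgt m ∧ |(m 4 : ℝ)| ≤ wgt m :=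
    fun m => by
    have h1 := sum_abs_le_wgt m
    have h2 : 0 ≤ ∑ i : Fin 4, |(m i.castSucc : ℝ)| := Finset.sum_nonneg fun _ _ => abs_nonneg _
    rw [abs_of_nonneg h2]
    constructor <;> linarith [abs_nonneg (m 4 : ℝ)]
  have h4 : ∀ m k : Fin 5 → ℤ, |dot4 m k| ≤ wgt m * wgt k := fun m k =>
    (abs_dot4_le m k).trans (mul_le_mul ((le_abs_self _).trans (h m).1)
      ((le_abs_self _).trans (h k).1) (Finset.sum_nonneg fun _ _ => abs_nonneg _) (wgt_pos m).le)
  have := wgt_pos m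
  have := wgt_pos k
  have a1 : |dot4 m m * (k 4 : ℝ) ^ 2| ≤ wgt m ^ 2 * wgt k ^ 2 := by
    rw [abs_mul, abs_pow, sq (wgt m)]; gcongr; exacts [h4 m m, (h k).2]
  have a2 : |dot4 k k * (m 4 : ℝ) ^ 2| ≤ wgt m ^ 2 * wgt k ^ 2 := by
    rw [abs_mul, abs_pow, mul_comm, sq (wgt k)]; gcongr; exacts [(h m).2, h4 k k]
  have a3 : |dot4 m k * (m 4 * k 4)| ≤ wgt m ^ 2 * wgt k ^ 2 := by
    rw [abs_mul, abs_mul, show wgt m ^ 2 * wgt k ^ 2 = wgt m * wgt k * (wgt m * wgt k) by ring]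
    gcongr
    exacts [h4 m k, (h m).2, (h k).2]
  rw [abs_le] at *
  unfold sym
  constructor <;> linarith [a1.1, a1.2, a2.1, a2.2, a3.1, a3.2]

section

variable {ι : Type*} (u : ι → SP) (a : ι) (n : Fin 5 → ℤ)

lemma hat_dF_dF (i j : Fin 5) :
    hat (dF i (dF j u) a) n = -(4 * Real.pi ^ 2) * (n i * n j) * hat (u a) n := by
  rw [dF_apply, hat_dSP, dF_apply, hat_dSP]
  linear_combination 4 * Real.pi ^ 2 * n i * n j * hat (u a) n * Complex.I_sq

lemma hat_sum_dF_dF4 : hat ((∑ i : Fin 4, dF i.castSucc (dF i.castSucc u)) a) n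
    = -(4 * Real.pi ^ 2) * dot4 n n * hat (u a) n := by
  rw [Finset.sum_apply, hat_sum]
  simp only [hat_dF_dF, dot4]
  push_cast
  rw [Finset.mul_sum, Finset.sum_mul]

lemma hat_laplacian : hat ((∑ j, dF j (dF j u)) a) n
    = -(4 * Real.pi ^ 2) * nsq n * hat (u a) n := by
  rw [Finset.sum_apply, hat_sum]
  simp only [hat_dF_dF, nsq]
  push_cast
  rw [Finset.mul_sum, Finset.sum_mul]
  simp only [sq]

/-- The Fourier coefficients of the Monge-Ampère operator. -/
lemma hasSum_hat_opMA :
    HasSum (fun k => (16 * Real.pi ^ 4 * sym (n - k) k : ℂ) * (hat (u a) (n - k) * hat (u a) k))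
      (hat (opMA u a) n + 4 * Real.pi ^ 2 * nsq n * hat (u a) n - if n = 0 then 1 else 0) := by
  set A : ι → SP := ∑ i : Fin 4, dF i.castSucc (dF i.castSucc u) with hA
  set B : ι → SP := dF 4 (dF 4 u) with hB
  have h1 := hasSum_hat_mul (A a) (B a) n
  have h2 := hasSum_hat_mul (B a) (A a) n
  have h3 := hasSum_sum fun i (_ : i ∈ (Finset.univ : Finset (Fin 4))) =>
    hasSum_hat_mul (mix u i a) (mix u i a) n
  have h := ((h1.add h2).div_const 2).sub h3
  have e : opMA u a = A a * B a + (A a + B a) + 1 - ∑ i, mix u i a * mix u i a := by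
    simp only [opMA, facA, facB, Pi.sub_apply, Pi.mul_apply, Pi.add_apply, Pi.one_apply,
      Finset.sum_apply, hA, hB]
    ring
  have e1 : (hat (A a * B a) n + hat (B a * A a) n) / 2 - ∑ i, hat (mix u i a * mix u i a) n
      = hat (opMA u a) n + 4 * Real.pi ^ 2 * nsq n * hat (u a) n - if n = 0 then 1 else 0 := by
    rw [e, hat_sub, hat_add, hat_add, hat_add, hat_one, hat_sum, mul_comm (B a), hA, hB,
      hat_sum_dF_dF4, hat_dF_dF, nsq_eq]
    push_cast
    ring
  rw [← e1]
  refine (iff_of_eq (congrArg (HasSum · _) (funext fun k => ?_))).2 h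
  simp only [hA, hB, mix, hat_sum_dF_dF4, hat_dF_dF]
  simp only [sym, dot4, Fin.sum_univ_four]
  push_cast
  ring

end

/-- The Monge-Ampère equation with right-hand side `(1 - t) + t f`, in terms of the Fourier
coefficients `c` of a normalised solution. -/
structure Good (f : SP) (t : ℝ) (c : (Fin 5 → ℤ) → ℂ) : Prop where
  rapid : Rapid c
  symm : ∀ n, c (-n) = conj (c n)
  zero : c 0 = 0
  eq : ∀ n, n ≠ 0 → 4 * Real.pi ^ 2 * nsq n * c n
    = ∑' k, (16 * Real.pi ^ 4 * sym (n - k) k : ℂ) * (c (n - k) * c k) - t * hat f n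

/-- The right-hand sides of the continuity path. -/
noncomputable def rhs (f : SP) (t : ℝ) : SP := (1 - t) • 1 + t • f

lemma hat_rhs (f : SP) (t : ℝ) (n : Fin 5 → ℤ) :
    hat (rhs f t) n = (1 - t) * (if n = 0 then 1 else 0) + t * hat f n := by
  rw [rhs, hat_add, hat_smul, hat_smul, hat_one]; push_cast; rfl

lemma Good.exists_solution {f : SP} (hf : hat f 0 = 1) {t : ℝ} {c : (Fin 5 → ℤ) → ℂ}
    (h : Good f t c) :
    ∃ φ : SP, (∀ n, hat φ n = c n) ∧ opMA (fun _ : Unit => φ) () = rhs f t := by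
  obtain ⟨φ, hφ⟩ := exists_hat_eq h.rapid h.symm
  refine ⟨φ, hφ, hat_injective fun n => ?_⟩
  have h1 := (hasSum_hat_opMA (fun _ : Unit => φ) () n).tsum_eq
  simp only [hφ] at h1
  rw [hat_rhs]
  rcases eq_or_ne n 0 with rfl | hn
  · simp only [sym_neg_self, h.zero, Complex.ofReal_zero, mul_zero, zero_mul, tsum_zero] at h1
    rw [hf]
    simp only [if_true] at h1 ⊢
    linear_combination -h1
  · have h2 := h.eq n hn
    simp only [if_neg hn] at h1 ⊢
    linear_combination -h1 - h2

/-! ### Uniform estimates and closedness -/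

lemma dList_rhs {ι : Type*} (f : SP) (t : ι → ℝ) (l : List (Fin 5)) (a : ι) :
    dList l (fun a => rhs f (t a)) a
      = (1 - t a) • dList l (fun _ : Unit => (1 : SP)) ()
        + t a • dList l (fun _ : Unit => f) () := by
  induction l generalizing a with
  | nil => rfl
  | cons j l ih =>
    simp only [dList, dF_apply]
    rw [ih, map_add, Derivation.map_smul, Derivation.map_smul]

lemma solves_rhs {ι : Type*} {f : SP} (hpos : ∀ x, 0 < f.1 x) {t : ι → ℝ}
    (ht : ∀ a, t a ∈ Set.Icc (0 : ℝ) 1) {u : ι → SP} (hu : opMA u = fun a => rhs f (t a)) :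
    Solves u (fun a => rhs f (t a)) := by
  refine ⟨hu, ?_, fun l => ?_⟩
  · obtain ⟨x, hx⟩ := (-f).exists_max
    refine ⟨min 1 (f.1 x), lt_min one_pos (hpos x), fun z => ?_⟩
    have h1 : f.1 x ≤ f.1 z.2 := neg_le_neg_iff.1 (hx z.2)
    have h2 := ht z.1
    have : ev z (fun a => rhs f (t a)) = (1 - t z.1) + t z.1 * f.1 z.2 := by
      simp [ev_apply, rhs]
    rw [this]
    nlinarith [min_le_left 1 (f.1 x), min_le_right 1 (f.1 x), h2.1, h2.2]
  · obtain ⟨C, hC0, hC⟩ := ((1 : SP).bdd_const l).exists_pos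
    obtain ⟨D, hD0, hD⟩ := (f.bdd_const l).exists_pos
    refine ⟨C + D, fun z => ?_⟩
    have h2 := ht z.1
    have h3 : ev z (dList l fun a => rhs f (t a))
        = (1 - t z.1) * ev ((), z.2) (dList l fun _ : Unit => (1 : SP))
          + t z.1 * ev ((), z.2) (dList l fun _ : Unit => f) := by
      simp only [ev_apply, dList_rhs]; rfl
    have hC' := hC ((), z.2)
    have hD' := hD ((), z.2)
    rw [h3]
    refine (abs_add_le _ _).trans (add_le_add ?_ ?_)
    · rw [abs_mul, abs_of_nonneg (by linarith [h2.2])]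
      nlinarith [h2.1, h2.2, abs_nonneg (ev ((), z.2) (dList l fun _ : Unit => (1 : SP)))]
    · rw [abs_mul, abs_of_nonneg h2.1]
      nlinarith [h2.1, h2.2, abs_nonneg (ev ((), z.2) (dList l fun _ : Unit => f))]

lemma exists_uniform_decay {f : SP} (hpos : ∀ x, 0 < f.1 x) (hf : hat f 0 = 1) (N : ℕ) :
    ∃ C, ∀ t ∈ Set.Icc (0 : ℝ) 1, ∀ c, Good f t c → ∀ n, wgt n ^ N * ‖c n‖ ≤ C := by
  let ι := {p : ℝ × ((Fin 5 → ℤ) → ℂ) // p.1 ∈ Set.Icc (0 : ℝ) 1 ∧ Good f p.1 p.2}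
  choose u hu hMA using fun p : ι => p.2.2.exists_solution hf
  have hsol : Solves u (fun p : ι => rhs f p.1.1) :=
    solves_rhs hpos (fun p => p.2.1) (funext hMA)
  obtain ⟨C, hC⟩ := exists_wgt_mul_hat_le N _ hsol.bdd_laplacian
  refine ⟨max C 0, fun t ht c hc n => ?_⟩
  rcases eq_or_ne n 0 with rfl | hn
  · simp [hc.zero]
  refine le_trans ?_ ((hC ⟨(t, c), ht, hc⟩ n).trans (le_max_left _ _))
  rw [hat_laplacian, hu]
  have := wgt_pos n
  gcongr
  have h1 := one_le_nsq hn
  have h2 : (1 : ℝ) ≤ 4 * Real.pi ^ 2 := by nlinarith [Real.pi_gt_three]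
  rw [norm_mul, norm_mul, norm_neg, Complex.norm_real, Real.norm_eq_abs, abs_of_pos (by linarith)]
  have h3 : ‖(4 * Real.pi ^ 2 : ℂ)‖ = 4 * Real.pi ^ 2 := by
    rw [show (4 * Real.pi ^ 2 : ℂ) = ((4 * Real.pi ^ 2 : ℝ) : ℂ) by push_cast; rfl,
      Complex.norm_real, Real.norm_eq_abs, abs_of_pos (by positivity)]
  rw [h3]
  exact le_mul_of_one_le_left (norm_nonneg _) (one_le_mul_of_one_le_of_one_le h2 h1)

lemma isClosed_setOf_good {f : SP} (hpos : ∀ x, 0 < f.1 x) (hf : hat f 0 = 1) :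
    IsClosed {t | t ∈ Set.Icc (0 : ℝ) 1 ∧ ∃ c, Good f t c} := by
  choose C hC using exists_uniform_decay hpos hf
  set K : Set ((Fin 5 → ℤ) → ℂ) := {c | ∀ N n, wgt n ^ N * ‖c n‖ ≤ C N} with hK
  have hKcl : IsClosed K := by
    simp only [hK, Set.ofPred_forall]
    refine isClosed_iInter fun N => isClosed_iInter fun n => ?_
    exact isClosed_le (by fun_prop) continuous_const
  have hKc : IsCompact K := by
    refine (isCompact_univ_pi fun n : Fin 5 → ℤ =>
      isCompact_closedBall (0 : ℂ) (C 0)).of_isClosed_subset hKcl fun c hc n _ => ?_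
    simpa using hc 0 n
  set G : (Fin 5 → ℤ) → ℝ × ((Fin 5 → ℤ) → ℂ) → ℂ := fun n p => 4 * Real.pi ^ 2 * nsq n * p.2 n
    - (∑' k, (16 * Real.pi ^ 4 * sym (n - k) k : ℂ) * (p.2 (n - k) * p.2 k) - p.1 * hat f n) with hG
  have hS : IsClosed (Set.Icc (0 : ℝ) 1 ×ˢ K) := isClosed_Icc.prod hKcl
  have hGc : ∀ n, ContinuousOn (G n) (Set.Icc (0 : ℝ) 1 ×ˢ K) := fun n => by
    refine ContinuousOn.sub (by fun_prop) (ContinuousOn.sub ?_ (by fun_prop))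
    refine continuousOn_tsum (u := fun k => 32 * Real.pi ^ 4 * (C 2 * (C 12 * (wgt k ^ 10)⁻¹)))
      (fun k => by fun_prop) (((summable_wgt.mul_left _).mul_left _).mul_left _) fun k p hp => ?_
    have h1 := hp.2 2 (n - k)
    have h2 := hp.2 12 k
    have h3 := wgt_pos k
    have h4 : wgt k ^ 2 * ‖p.2 k‖ ≤ C 12 * (wgt k ^ 10)⁻¹ := by
      rw [← div_eq_mul_inv, le_div_iff₀ (by positivity)]
      linarith
    rw [norm_mul, norm_mul, norm_mul (p.2 _),
      show (16 * Real.pi ^ 4 : ℂ) = ((16 * Real.pi ^ 4 : ℝ) : ℂ) by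
      push_cast; rfl, Complex.norm_real, Complex.norm_real, Real.norm_eq_abs, Real.norm_eq_abs,
      abs_of_pos (by positivity)]
    calc 16 * Real.pi ^ 4 * |sym (n - k) k| * (‖p.2 (n - k)‖ * ‖p.2 k‖)
        ≤ 16 * Real.pi ^ 4 * (2 * (wgt (n - k) ^ 2 * wgt k ^ 2)) * (‖p.2 (n - k)‖ * ‖p.2 k‖) := by
          gcongr; exact abs_sym_le _ _
      _ = 32 * Real.pi ^ 4 * ((wgt (n - k) ^ 2 * ‖p.2 (n - k)‖) * (wgt k ^ 2 * ‖p.2 k‖)) := by ring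
      _ ≤ _ := by
          have := wgt_pos (n - k)
          have h0 : 0 ≤ C 2 := le_trans (by positivity) h1
          gcongr
  set Z : Set (ℝ × ((Fin 5 → ℤ) → ℂ)) := (⋂ n, ⋂ _ : n ≠ 0, (Set.Icc (0 : ℝ) 1 ×ˢ K) ∩ G n ⁻¹' {0})
    ∩ ({p | ∀ n, p.2 (-n) = conj (p.2 n)} ∩ {p | p.2 0 = 0}) with hZ
  have hZc : IsClosed Z := by
    refine (isClosed_iInter fun n => isClosed_iInter fun _ =>
      (hGc n).preimage_isClosed_of_isClosed hS isClosed_singleton).inter (IsClosed.inter ?_ ?_)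
    · simp only [Set.ofPred_forall]
      exact isClosed_iInter fun n => isClosed_eq (by fun_prop)
        (Complex.continuous_conj.comp (by fun_prop))
    · exact isClosed_eq (by fun_prop) continuous_const
  have hZS : Z ⊆ Set.Icc (0 : ℝ) 1 ×ˢ K := fun p hp =>
    (Set.mem_iInter₂.1 hp.1 1 one_ne_zero).1
  have hZk : IsCompact Z := (isCompact_Icc.prod hKc).of_isClosed_subset hZc hZS
  convert (hZk.image continuous_fst).isClosed using 1
  ext t
  constructor
  · rintro ⟨ht, c, hc⟩
    refine ⟨(t, c), ⟨Set.mem_iInter₂.2 fun n hn => ⟨⟨ht, fun N => hC N t ht c hc⟩, ?_⟩,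
      hc.symm, hc.zero⟩, rfl⟩
    simp [hG, hc.eq n hn]
  · rintro ⟨⟨t, c⟩, hp, rfl⟩
    refine ⟨(hZS hp).1, c, fun N => ⟨C N, (hZS hp).2 N⟩, hp.2.1, hp.2.2, fun n hn => ?_⟩
    exact sub_eq_zero.1 (Set.mem_iInter₂.1 hp.1 n hn).2

lemma good_zero (f : SP) : Good f 0 0 where
  rapid N := ⟨0, fun n => by simp⟩
  symm := by simp
  zero := rfl
  eq := by simp

end TorusMA

namespace TorusMA

open Filter Topology
open scoped ContDiff ComplexConjugate ENNReal

/-! ### Operators on square-summable families -/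

lemma summable_mul_and_sq_tsum_le {α : Type*} {a b : α → ℝ} (ha : Summable fun k => a k ^ 2)
    (hb : Summable fun k => b k ^ 2) :
    Summable (fun k => a k * b k) ∧ (∑' k, a k * b k) ^ 2 ≤ (∑' k, a k ^ 2) * ∑' k, b k ^ 2 := by
  have h : Summable fun k => a k * b k :=
    Summable.of_norm_bounded (ha.add hb) fun k => by
      rw [Real.norm_eq_abs, abs_le]
      constructor <;> nlinarith [sq_nonneg (a k + b k), sq_nonneg (a k - b k), sq_nonneg (a k),
        sq_nonneg (b k)]
  exact ⟨h, le_of_tendsto_of_tendsto' (h.hasSum.pow 2) (Tendsto.mul ha.hasSum hb.hasSum)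
    fun s => Finset.sum_mul_sq_le_sq_mul_sq s a b⟩

/-- Square-summable families indexed by frequencies. -/
noncomputable abbrev L2 : Type := lp (fun _ : Fin 5 → ℤ => ℂ) 2

namespace L2

lemma hasSum_sq (g : L2) : HasSum (fun n => ‖g n‖ ^ 2) (‖g‖ ^ 2) := by
  simpa using lp.hasSum_norm (p := 2) (by simp) g

lemma mem_of_summable {g : (Fin 5 → ℤ) → ℂ} (h : Summable fun n => ‖g n‖ ^ 2) :
    Memℓp g 2 := memℓp_gen (by simpa using h)

lemma norm_sq_le_of_hasSum {g : L2} {u : (Fin 5 → ℤ) → ℝ} {s C : ℝ} (hC : 0 ≤ C)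
    (hu : ∀ n, ‖g n‖ ^ 2 ≤ u n) (hs : HasSum u s) (h : s ≤ C ^ 2) : ‖g‖ ≤ C :=
  abs_le_of_sq_le_sq' ((hasSum_le hu (hasSum_sq g) hs).trans h) hC |>.2

/-- Multiplication by a bounded family. -/
noncomputable def diag (d : (Fin 5 → ℤ) → ℂ) (C : ℝ) (hd : ∀ n, ‖d n‖ ≤ C) : L2 →L[ℝ] L2 :=
  have hle : ∀ (g : L2) n, ‖d n * g n‖ ^ 2 ≤ C ^ 2 * ‖g n‖ ^ 2 := fun g n => by
    rw [norm_mul, mul_pow]; gcongr; exact hd n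
  have hC : 0 ≤ C := (norm_nonneg _).trans (hd 0)
  LinearMap.mkContinuous
    { toFun := fun g => ⟨fun n => d n * g n, mem_of_summable
        (((hasSum_sq g).summable.mul_left (C ^ 2)).of_nonneg_of_le (fun _ => sq_nonneg _) (hle g))⟩
      map_add' := fun g h => by ext n; exact mul_add _ _ _
      map_smul' := fun r g => by ext n; exact mul_smul_comm r (d n) (g n) } C
    fun g => norm_sq_le_of_hasSum (by positivity) (hle g) ((hasSum_sq g).mul_left _)
      (by rw [mul_pow])

lemma diag_apply (d : (Fin 5 → ℤ) → ℂ) (C : ℝ) (hd : ∀ n, ‖d n‖ ≤ C) (g : L2) (n : Fin 5 → ℤ) :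
    diag d C hd g n = d n * g n := rfl

/-- The conjugation `g ↦ (conj g₋ₙ)ₙ`, whose fixed points correspond to real functions. -/
noncomputable def conjNeg : L2 →L[ℝ] L2 :=
  have hs : ∀ g : L2, HasSum (fun n => ‖conj (g (-n))‖ ^ 2) (‖g‖ ^ 2) := fun g => by
    simpa [Function.comp_def] using (Equiv.neg _).hasSum_iff.2 (hasSum_sq g)
  LinearMap.mkContinuous
    { toFun := fun g => ⟨fun n => conj (g (-n)), mem_of_summable (hs g).summable⟩
      map_add' := fun g h => by ext n; exact map_add _ _ _
      map_smul' := fun r g => by ext n; simp } 1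
    fun g => norm_sq_le_of_hasSum (by positivity) (fun n => le_rfl) (hs g) (by simp)

lemma conjNeg_apply (g : L2) (n : Fin 5 → ℤ) : conjNeg g n = conj (g (-n)) := rfl

lemma hasSum_conv (g h : L2) :
    HasSum (fun p : (Fin 5 → ℤ) × (Fin 5 → ℤ) => ‖g (p.1 - p.2) * h p.2‖ ^ 2)
      (‖g‖ ^ 2 * ‖h‖ ^ 2) := by
  have h1 : Summable fun p : (Fin 5 → ℤ) × (Fin 5 → ℤ) => ‖g p.1‖ ^ 2 * ‖h p.2‖ ^ 2 :=
    (hasSum_sq g).summable.mul_of_nonneg (hasSum_sq h).summable (fun _ => sq_nonneg _)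
      fun _ => sq_nonneg _
  let e : (Fin 5 → ℤ) × (Fin 5 → ℤ) ≃ (Fin 5 → ℤ) × (Fin 5 → ℤ) :=
    { toFun := fun p => (p.1 - p.2, p.2)
      invFun := fun p => (p.1 + p.2, p.2)
      left_inv := fun p => by simp
      right_inv := fun p => by simp }
  have h2 := e.hasSum_iff.2 ((hasSum_sq g).mul (hasSum_sq h) h1)
  simp only [norm_mul, mul_pow]
  exact h2

lemma summable_kernel {q : (Fin 5 → ℤ) → (Fin 5 → ℤ) → ℝ} (hs : ∀ n, Summable fun k => q n k ^ 2)
    (g h : L2) (n : Fin 5 → ℤ) : Summable fun k => (q n k : ℂ) * (g (n - k) * h k) := by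
  refine Summable.of_norm ?_
  have h1 := (hasSum_conv g h).summable.prod_factor n
  convert (summable_mul_and_sq_tsum_le (hs n |>.congr fun k => (sq_abs (q n k)).symm) h1).1 with k
  simp

lemma norm_kernel_sq_le {q : (Fin 5 → ℤ) → (Fin 5 → ℤ) → ℝ} (hs : ∀ n, Summable fun k => q n k ^ 2)
    {C : ℝ} (hq : ∀ n, ∑' k, q n k ^ 2 ≤ C ^ 2) (g h : L2) (n : Fin 5 → ℤ) :
    ‖∑' k, (q n k : ℂ) * (g (n - k) * h k)‖ ^ 2
      ≤ C ^ 2 * ∑' k, ‖g (n - k) * h k‖ ^ 2 := by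
  have h1 := (hasSum_conv g h).summable.prod_factor n
  have h2 := summable_mul_and_sq_tsum_le (hs n |>.congr fun k => (sq_abs (q n k)).symm) h1
  have h3 : ‖∑' k, (q n k : ℂ) * (g (n - k) * h k)‖ ≤ ∑' k, |q n k| * ‖g (n - k) * h k‖ := by
    refine (norm_tsum_le_tsum_norm ?_).trans_eq ?_
    · exact (summable_kernel hs g h n).norm
    · simp
  refine (pow_le_pow_left₀ (norm_nonneg _) h3 2).trans (h2.2.trans ?_)
  simp only [sq_abs]
  exact mul_le_mul_of_nonneg_right (hq n) (tsum_nonneg fun _ => sq_nonneg _)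

/-- The bilinear operator `(g, h) ↦ ∑ₖ q n k gₙ₋ₖ hₖ`. -/
noncomputable def bil (q : (Fin 5 → ℤ) → (Fin 5 → ℤ) → ℝ) (C : ℝ) (hC : 0 ≤ C)
    (hs : ∀ n, Summable fun k => q n k ^ 2) (hq : ∀ n, ∑' k, q n k ^ 2 ≤ C ^ 2) :
    L2 →L[ℝ] L2 →L[ℝ] L2 :=
  have hsum : ∀ g h : L2, HasSum (fun n => C ^ 2 * ∑' k, ‖g (n - k) * h k‖ ^ 2)
      (C ^ 2 * (‖g‖ ^ 2 * ‖h‖ ^ 2)) := fun g h =>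
    (((hasSum_conv g h).prod_fiberwise fun n =>
      ((hasSum_conv g h).summable.prod_factor n).hasSum)).mul_left _
  LinearMap.mkContinuous₂
    (LinearMap.mk₂ ℝ (fun g h : L2 => (⟨fun n => ∑' k, (q n k : ℂ) * (g (n - k) * h k),
      mem_of_summable ((hsum g h).summable.of_nonneg_of_le (fun _ => sq_nonneg _)
        (norm_kernel_sq_le hs hq g h))⟩ : L2))
      (fun g g' h => by
        ext n
        refine Eq.trans (tsum_congr fun k => ?_)
          ((summable_kernel hs g h n).tsum_add (summable_kernel hs g' h n))
        simp [add_mul, mul_add])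
      (fun r g h => by
        ext n
        refine Eq.trans (tsum_congr fun k => ?_) (tsum_const_smul'' r)
        simp only [lp.coeFn_smul, Pi.smul_apply, Complex.real_smul]
        ring)
      (fun g h h' => by
        ext n
        refine Eq.trans (tsum_congr fun k => ?_)
          ((summable_kernel hs g h n).tsum_add (summable_kernel hs g h' n))
        simp [mul_add])
      (fun r g h => by
        ext n
        refine Eq.trans (tsum_congr fun k => ?_) (tsum_const_smul'' r)
        simp only [lp.coeFn_smul, Pi.smul_apply, Complex.real_smul]
        ring)) C
    fun g h => norm_sq_le_of_hasSum (by positivity) (norm_kernel_sq_le hs hq g h) (hsum g h)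
      (le_of_eq (by ring))

end L2

end TorusMA

namespace TorusMA

open Filter Topology
open scoped ContDiff ComplexConjugate ENNReal

/-! ### Coercivity on the Fourier side -/

lemma abs_wgt_sub_le (n k : Fin 5 → ℤ) : |wgt n - wgt k| ≤ wgt (n - k) := by
  have h1 := wgt_add_le (n - k) k
  have h2 := wgt_add_le (-(n - k)) n
  rw [wgt_neg, show -(n - k) + n = k by abel] at h2
  rw [sub_add_cancel] at h1
  rw [abs_le]
  constructor <;> linarith

lemma wgt_le_mul (n k : Fin 5 → ℤ) : wgt n ≤ wgt (n - k) * wgt k := by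
  have h1 := wgt_add_le (n - k) k
  rw [sub_add_cancel] at h1
  nlinarith [one_le_wgt (n - k), one_le_wgt k]

lemma abs_wgt_pow_sub_le (n k : Fin 5 → ℤ) :
    |wgt n ^ 6 - wgt k ^ 6| ≤ 6 * (wgt (n - k) ^ 6 * wgt k ^ 5) := by
  have h0 := wgt_pos n
  have h1 := one_le_wgt k
  have h2 := one_le_wgt (n - k)
  have h3 : ∀ i ∈ Finset.range 6, wgt n ^ i * wgt k ^ (6 - 1 - i) ≤ wgt (n - k) ^ 5 * wgt k ^ 5 :=
    fun i hi => by
    have hi : i ≤ 5 := Nat.lt_succ_iff.1 (Finset.mem_range.1 hi)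
    calc wgt n ^ i * wgt k ^ (5 - i) ≤ (wgt (n - k) * wgt k) ^ i * wgt k ^ (5 - i) := by
          gcongr; exact wgt_le_mul n k
      _ = wgt (n - k) ^ i * (wgt k ^ i * wgt k ^ (5 - i)) := by ring
      _ = wgt (n - k) ^ i * wgt k ^ 5 := by rw [← pow_add, Nat.add_sub_cancel' hi]
      _ ≤ _ := by gcongr
  rw [← (Commute.all (wgt n) (wgt k)).geom_sum₂_mul, abs_mul, abs_of_nonneg (by positivity)]
  calc _ ≤ (∑ i ∈ Finset.range 6, wgt (n - k) ^ 5 * wgt k ^ 5) * wgt (n - k) :=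
        mul_le_mul (Finset.sum_le_sum h3) (abs_wgt_sub_le n k) (abs_nonneg _) (by positivity)
    _ = _ := by simp; ring

lemma wgt_sq_le_nsq {n : Fin 5 → ℤ} (hn : n ≠ 0) : wgt n ^ 2 ≤ 20 * nsq n := by
  have h1 : (∑ i, |(n i : ℝ)|) ^ 2 ≤ 5 * nsq n := by
    simpa [nsq] using sq_sum_le_card_mul_sum_sq (s := Finset.univ) (f := fun i => |(n i : ℝ)|)
  have h2 : 1 ≤ ∑ i, |(n i : ℝ)| := by
    obtain ⟨j, hj⟩ := Function.ne_iff.1 hn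
    exact le_trans (by exact_mod_cast Int.one_le_abs hj)
      (Finset.single_le_sum (f := fun j => |(n j : ℝ)|) (fun _ _ => abs_nonneg _)
        (Finset.mem_univ j))
  unfold wgt
  nlinarith

lemma exists_interpolation {μ : ℝ} (hμ : 0 < μ) {D : ℝ} (hD : 0 ≤ D) :
    ∃ K, 0 ≤ K ∧ ∀ x, 0 ≤ x → D * x ≤ μ / 4 + K * μ * x ^ 6 := by
  set δ := μ / (4 * (D + 1)) with hδ
  have hδ0 : 0 < δ := by positivity
  refine ⟨D / (μ * δ ^ 5), by positivity, fun x hx => ?_⟩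
  rcases le_total x δ with h | h
  · have h1 : D * x ≤ (D + 1) * δ := by gcongr; linarith
    have h2 : (D + 1) * δ = μ / 4 := by rw [hδ]; field_simp
    have : 0 ≤ D / (μ * δ ^ 5) * μ * x ^ 6 := by positivity
    linarith
  · have h1 : D * x ≤ D / (μ * δ ^ 5) * μ * x ^ 6 := by
      rw [show D / (μ * δ ^ 5) * μ * x ^ 6 = D * x * (x / δ) ^ 5 by field_simp]
      exact le_mul_of_one_le_right (by positivity) (one_le_pow₀ ((one_le_div hδ0).2 h))
    linarith

/-- The matrix of the second order operator `-∂ᵢ (aᵢⱼ ∂ⱼ ·)` on the Fourier side, up to the factor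
`4π²`. -/
noncomputable def symbolMat (a : Fin 5 → Fin 5 → SP) (n k : Fin 5 → ℤ) : ℂ :=
  ∑ i, ∑ j, (n i : ℂ) * k j * hat (a i j) (n - k)

section Coercive

variable {a : Fin 5 → Fin 5 → SP} {lam : ℝ}

lemma le_re_sum_symbolMat
    (ha : ∀ x (ξ : Fin 5 → ℝ), lam * ∑ i, ξ i ^ 2 ≤ ∑ i, ∑ j, (a i j).1 x * (ξ i * ξ j))
    (S : Finset (Fin 5 → ℤ)) (v : (Fin 5 → ℤ) → ℂ) :
    lam * ∑ n ∈ S, nsq n * ‖v n‖ ^ 2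
      ≤ (∑ n ∈ S, ∑ k ∈ S, conj (v n) * v k * symbolMat a n k).re := by
  have h := re_sum_conj_mul_hat_nonneg
    (a := fun i j => a i j - (if i = j then lam else 0) • (1 : SP)) (fun x ξ => ?_) S
    fun n i => n i * v n
  · rw [← sub_nonneg]
    refine h.trans_eq ?_
    rw [eq_sub_iff_add_eq, ← Complex.ofReal_re (lam * _), ← Complex.add_re]
    congr 1
    have e : ∀ n ∈ S, (nsq n * ‖v n‖ ^ 2 : ℂ)
        = ∑ k ∈ S, ∑ i, (if n = k then (n i : ℂ) * k i * (conj (v n) * v k) else 0) :=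
      fun n hn => by
      rw [Finset.sum_comm]
      simp only [Finset.sum_ite_eq, if_pos hn, nsq]
      rw [← Finset.sum_mul, Complex.conj_mul']
      push_cast
      simp only [sq]
    push_cast
    rw [Finset.sum_congr rfl e, Finset.mul_sum, ← Finset.sum_add_distrib]
    refine Finset.sum_congr rfl fun n _ => ?_
    rw [Finset.mul_sum, ← Finset.sum_add_distrib]
    refine Finset.sum_congr rfl fun k _ => ?_
    rw [symbolMat, Finset.mul_sum, Finset.mul_sum, ← Finset.sum_add_distrib]
    refine Finset.sum_congr rfl fun i _ => ?_
    simp only [hat_sub, hat_smul, hat_one, sub_eq_zero, mul_sub, Finset.sum_sub_distrib]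
    rw [Finset.sum_eq_single_of_mem (f := fun j => _ * (((if i = j then lam else 0 : ℝ) : ℂ) * _)) i
      (Finset.mem_univ i)
      (fun j _ hj => by simp [hj.symm]), if_pos rfl, Finset.mul_sum]
    rw [sub_add_eq_add_sub, sub_eq_iff_eq_add]
    congr 1
    · refine Finset.sum_congr rfl fun j _ => ?_
      simp
      ring
    · split_ifs
      · simp
        ring
      · simp
  · have e : ∀ i j, (a i j - (if i = j then lam else 0) • (1 : SP)).1 x
        = (a i j).1 x - if i = j then lam else 0 := fun i j => by split_ifs <;> simp
    simp only [e, sub_mul, Finset.sum_sub_distrib, ite_mul, zero_mul, Finset.sum_ite_eq,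
      Finset.mem_univ, if_true, ← sq, ← Finset.mul_sum]
    exact sub_nonneg.2 (ha x ξ)

lemma summable_hat_coeff (a : Fin 5 → Fin 5 → SP) :
    Summable fun m => wgt m ^ 6 * ∑ i, ∑ j, ‖hat (a i j) m‖ := by
  simp only [Finset.mul_sum]
  exact summable_sum fun i _ => summable_sum fun j _ => (rapid_hat (a i j)).summable_wgt_mul 6

lemma norm_symbolMat_le (a : Fin 5 → Fin 5 → SP) (n k : Fin 5 → ℤ) :
    ‖symbolMat a n k‖ ≤ wgt n * wgt k * ∑ i, ∑ j, ‖hat (a i j) (n - k)‖ := by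
  refine (norm_sum_le _ _).trans ?_
  rw [Finset.mul_sum]
  refine Finset.sum_le_sum fun i _ => (norm_sum_le _ _).trans ?_
  rw [Finset.mul_sum]
  refine Finset.sum_le_sum fun j _ => ?_
  have h1 := abs_le_wgt n i
  have h2 := abs_le_wgt k j
  rw [norm_mul, norm_mul, Complex.norm_intCast, Complex.norm_intCast]
  have := wgt_pos n
  gcongr <;> linarith

lemma norm_sum_commutator_le (a : Fin 5 → Fin 5 → SP) {ε : ℝ} (hε : 0 < ε)
    (S : Finset (Fin 5 → ℤ)) (h : (Fin 5 → ℤ) → ℂ) :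
    ‖∑ n ∈ S, ∑ k ∈ S, conj (h n) * h k * (symbolMat a n k
        * ((wgt n)⁻¹ * (wgt n ^ 6 - wgt k ^ 6) * (wgt k ^ 7)⁻¹ : ℝ))‖
      ≤ 6 * (∑' m, wgt m ^ 6 * ∑ i, ∑ j, ‖hat (a i j) m‖)
        * (ε / 2 * ∑ n ∈ S, ‖h n‖ ^ 2 + (2 * ε)⁻¹ * ∑ n ∈ S, ((wgt n) ^ 2)⁻¹ * ‖h n‖ ^ 2) := by
  set γ : (Fin 5 → ℤ) → ℝ := fun m => wgt m ^ 6 * ∑ i, ∑ j, ‖hat (a i j) m‖ with hγ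
  have hs : Summable γ := summable_hat_coeff a
  have hγ0 : ∀ m, 0 ≤ γ m := fun m => by have := wgt_pos m; positivity
  have hrow : ∀ n, ∑ k ∈ S, γ (n - k) ≤ ∑' m, γ m := fun n =>
    ((((Equiv.subLeft n).summable_iff.2 hs).sum_le_tsum S fun k _ => hγ0 _).trans_eq
      ((Equiv.subLeft n).tsum_eq γ))
  have hcol : ∀ k, ∑ n ∈ S, γ (n - k) ≤ ∑' m, γ m := fun k =>
    ((((Equiv.subRight k).summable_iff.2 hs).sum_le_tsum S fun n _ => hγ0 _).trans_eq
      ((Equiv.subRight k).tsum_eq γ))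
  have hterm : ∀ n k, ‖conj (h n) * h k * (symbolMat a n k
        * ((wgt n)⁻¹ * (wgt n ^ 6 - wgt k ^ 6) * (wgt k ^ 7)⁻¹ : ℝ))‖
      ≤ 6 * (ε / 2 * (γ (n - k) * ‖h n‖ ^ 2)
        + (2 * ε)⁻¹ * (γ (n - k) * (((wgt k) ^ 2)⁻¹ * ‖h k‖ ^ 2))) := fun n k => by
    have hn := wgt_pos n
    have hk := wgt_pos k
    rw [norm_mul, norm_mul, norm_mul, RCLike.norm_conj, Complex.norm_real, Real.norm_eq_abs,
      abs_mul, abs_mul, abs_of_pos (inv_pos.2 hn), abs_of_pos (by positivity : 0 < (wgt k ^ 7)⁻¹)]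
    calc ‖h n‖ * ‖h k‖ * (‖symbolMat a n k‖
          * ((wgt n)⁻¹ * |wgt n ^ 6 - wgt k ^ 6| * (wgt k ^ 7)⁻¹))
        ≤ ‖h n‖ * ‖h k‖ * (wgt n * wgt k * (∑ i, ∑ j, ‖hat (a i j) (n - k)‖)
          * ((wgt n)⁻¹ * (6 * (wgt (n - k) ^ 6 * wgt k ^ 5)) * (wgt k ^ 7)⁻¹)) := by
          gcongr
          · exact norm_symbolMat_le a n k
          · exact abs_wgt_pow_sub_le n k
      _ = 6 * (γ (n - k) * (‖h n‖ * ((wgt k)⁻¹ * ‖h k‖))) := by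
          simp only [hγ]; field_simp
      _ ≤ 6 * (γ (n - k) * (ε / 2 * ‖h n‖ ^ 2 + (2 * ε)⁻¹ * ((wgt k)⁻¹ * ‖h k‖) ^ 2)) := by
          have hg := hγ0 (n - k)
          have : ‖h n‖ * ((wgt k)⁻¹ * ‖h k‖)
              ≤ ε / 2 * ‖h n‖ ^ 2 + (2 * ε)⁻¹ * ((wgt k)⁻¹ * ‖h k‖) ^ 2 := by
            have h1 : ε / 2 * ‖h n‖ ^ 2 + (2 * ε)⁻¹ * ((wgt k)⁻¹ * ‖h k‖) ^ 2
              - ‖h n‖ * ((wgt k)⁻¹ * ‖h k‖)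
              = (2 * ε)⁻¹ * (ε * ‖h n‖ - (wgt k)⁻¹ * ‖h k‖) ^ 2 := by field_simp; ring
            have h2 : 0 ≤ (2 * ε)⁻¹ * (ε * ‖h n‖ - (wgt k)⁻¹ * ‖h k‖) ^ 2 := by positivity
            linarith
          gcongr
      _ = _ := by rw [mul_pow, inv_pow]; ring
  refine (norm_sum_le _ _).trans ((Finset.sum_le_sum fun n _ => (norm_sum_le _ _).trans
    (Finset.sum_le_sum fun k _ => hterm n k)).trans ?_)
  simp only [← Finset.mul_sum, Finset.sum_add_distrib]
  rw [mul_assoc]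
  gcongr
  rw [mul_add, mul_left_comm _ (ε / 2), mul_left_comm _ (2 * ε)⁻¹]
  gcongr
  · rw [Finset.mul_sum]
    refine Finset.sum_le_sum fun n _ => ?_
    rw [← Finset.sum_mul]
    gcongr
    exact hrow n
  · rw [Finset.sum_comm, Finset.mul_sum]
    refine Finset.sum_le_sum fun k _ => ?_
    rw [← Finset.sum_mul]
    have := wgt_pos k
    gcongr
    exact hcol k

/-- Gårding's inequality in the weighted space. -/
lemma exists_garding (hlam : 0 < lam)
    (ha : ∀ x (ξ : Fin 5 → ℝ), lam * ∑ i, ξ i ^ 2 ≤ ∑ i, ∑ j, (a i j).1 x * (ξ i * ξ j)) :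
    ∃ K c : ℝ, 0 ≤ K ∧ 0 < c ∧ ∀ (S : Finset (Fin 5 → ℤ)) (h : (Fin 5 → ℤ) → ℂ),
      c * ∑ n ∈ S, ‖h n‖ ^ 2 ≤ (∑ n ∈ S, ∑ k ∈ S, (1 + K * (wgt n ^ 12)⁻¹ : ℝ) * (conj (h n) * h k
        * (symbolMat a n k * (wgt n ^ 5 * (wgt k ^ 7)⁻¹ : ℝ)
          + if n = k ∧ n = 0 then 1 else 0))).re := by
  set Γ := 6 * (∑' m, wgt m ^ 6 * ∑ i, ∑ j, ‖hat (a i j) m‖) with hΓ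
  have hΓ0 : 0 ≤ Γ := mul_nonneg (by norm_num) (tsum_nonneg fun m => by
    have := wgt_pos m; positivity)
  set μ := min (lam / 20) 1 with hμ
  have hμ0 : 0 < μ := lt_min (by positivity) one_pos
  set ε := μ / (Γ + 1) with hε
  have hε0 : 0 < ε := by positivity
  obtain ⟨K, hK0, hK⟩ := exists_interpolation hμ0 (D := Γ * (2 * ε)⁻¹) (by positivity)
  refine ⟨K, μ / 4, hK0, by positivity, fun S h => ?_⟩
  have h1 := le_re_sum_symbolMat ha S fun n => ((wgt n)⁻¹ : ℝ) * h n
  have h2 := le_re_sum_symbolMat ha S fun n => ((wgt n ^ 7)⁻¹ : ℝ) * h n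
  have h3 := (Complex.abs_re_le_norm _).trans (norm_sum_commutator_le a hε0 S h)
  have h4 : ∑ n ∈ S, ∑ k ∈ S, ((1 + K * (wgt n ^ 12)⁻¹ : ℝ) : ℂ) * (conj (h n) * h k
        * (symbolMat a n k * (wgt n ^ 5 * (wgt k ^ 7)⁻¹ : ℝ) + if n = k ∧ n = 0 then 1 else 0))
      = ∑ n ∈ S, ∑ k ∈ S, conj (((wgt n)⁻¹ : ℝ) * h n) * (((wgt k)⁻¹ : ℝ) * h k) * symbolMat a n k
      + ∑ n ∈ S, ∑ k ∈ S, conj (h n) * h k * (symbolMat a n k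
        * ((wgt n)⁻¹ * (wgt n ^ 6 - wgt k ^ 6) * (wgt k ^ 7)⁻¹ : ℝ))
      + K * ∑ n ∈ S, ∑ k ∈ S, conj (((wgt n ^ 7)⁻¹ : ℝ) * h n) * (((wgt k ^ 7)⁻¹ : ℝ) * h k)
        * symbolMat a n k
      + (∑ n ∈ S, if n = 0 then (1 + K) * ‖h n‖ ^ 2 else 0 : ℝ) := by
    have e : ((∑ n ∈ S, if n = 0 then (1 + K) * ‖h n‖ ^ 2 else 0 : ℝ) : ℂ)
        = ∑ n ∈ S, ∑ k ∈ S, if n = k then (if n = 0 then (1 + K : ℂ) * (conj (h n) * h k) else 0)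
          else 0 := by
      push_cast
      refine Finset.sum_congr rfl fun n hn => ?_
      rw [Finset.sum_ite_eq, if_pos hn, Complex.conj_mul']
      split_ifs <;> push_cast <;> rfl
    rw [e, Finset.mul_sum, ← Finset.sum_add_distrib, ← Finset.sum_add_distrib,
      ← Finset.sum_add_distrib]
    refine Finset.sum_congr rfl fun n _ => ?_
    rw [Finset.mul_sum, ← Finset.sum_add_distrib, ← Finset.sum_add_distrib,
      ← Finset.sum_add_distrib]
    refine Finset.sum_congr rfl fun k _ => ?_
    have hn : (wgt n : ℂ) ≠ 0 := Complex.ofReal_ne_zero.2 (wgt_pos n).ne'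
    have hk : (wgt k : ℂ) ≠ 0 := Complex.ofReal_ne_zero.2 (wgt_pos k).ne'
    rw [mul_add, mul_add]
    congr 1
    · simp only [map_mul, Complex.conj_ofReal]
      push_cast
      field_simp
      ring
    · rcases eq_or_ne n k with rfl | hnk
      · rcases eq_or_ne n 0 with rfl | h0
        · simp [wgt]
        · simp [h0]
      · simp [hnk]
  rw [h4, Complex.add_re, Complex.add_re, Complex.add_re, Complex.re_ofReal_mul,
    Complex.ofReal_re]
  have h5 := (abs_le.1 h3).1
  rw [← hΓ] at h5
  have h6 := mul_le_mul_of_nonneg_left h2 hK0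
  refine le_trans ?_ (add_le_add_left (add_le_add (add_le_add h1 h5) h6) _)
  simp only [Finset.mul_sum, ← Finset.sum_add_distrib, ← Finset.sum_neg_distrib]
  refine Finset.sum_le_sum fun n _ => ?_
  have hw := wgt_pos n
  have h7 := hK ((wgt n ^ 2)⁻¹) (by positivity)
  have hε2 : Γ * (ε / 2) ≤ μ / 2 := by
    rw [hε]
    have : Γ * (μ / (Γ + 1) / 2) = μ / 2 * (Γ / (Γ + 1)) := by ring
    rw [this]
    exact mul_le_of_le_one_right (by positivity) ((div_le_one (by positivity)).2 (by linarith))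
  have hp : 0 ≤ ‖h n‖ ^ 2 := sq_nonneg _
  rw [norm_mul, norm_mul, Complex.norm_real, Complex.norm_real, Real.norm_eq_abs, Real.norm_eq_abs,
    mul_pow, mul_pow, sq_abs, sq_abs]
  have key : μ + K * μ * ((wgt n ^ 2)⁻¹) ^ 6 ≤ lam * (nsq n * (wgt n)⁻¹ ^ 2)
      + K * (lam * (nsq n * (wgt n ^ 7)⁻¹ ^ 2)) + if n = 0 then 1 + K else 0 := by
    rcases eq_or_ne n 0 with rfl | hn
    · have : μ ≤ 1 := min_le_right _ _
      simp only [wgt, nsq, Pi.zero_apply, Int.cast_zero, abs_zero, Finset.sum_const_zero, if_true]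
      norm_num
      nlinarith
    · have e1 : μ ≤ lam * (nsq n * (wgt n)⁻¹ ^ 2) := by
        have : 1 / 20 ≤ nsq n * (wgt n)⁻¹ ^ 2 := by
          rw [inv_pow, ← div_eq_mul_inv, le_div_iff₀ (by positivity)]
          linarith [wgt_sq_le_nsq hn]
        calc μ ≤ lam * (1 / 20) := (min_le_left _ _).trans_eq (by ring)
          _ ≤ _ := by gcongr
      have e2 : K * (lam * (nsq n * (wgt n ^ 7)⁻¹ ^ 2))
          = K * (lam * (nsq n * (wgt n)⁻¹ ^ 2)) * ((wgt n ^ 2)⁻¹) ^ 6 := by field_simp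
      rw [e2, if_neg hn, add_zero]
      gcongr
  have h8 := mul_le_mul_of_nonneg_right key hp
  have h9 := mul_le_mul_of_nonneg_right h7 hp
  have h10 := mul_le_mul_of_nonneg_right hε2 hp
  split_ifs at h8 ⊢ <;> linarith

end Coercive

end TorusMA

namespace TorusMA

open Filter Topology
open scoped ContDiff ComplexConjugate ENNReal

/-! ### The linearised operator -/

section Coeff

variable {ι : Type*}

/-- The coefficient matrix of the linearised Monge-Ampère operator, up to the factor `4π²`. -/
noncomputable def coeff (u : ι → SP) (a : ι) (i j : Fin 5) : SP :=
  (4 * Real.pi ^ 2) • Fin.lastCases (motive := fun _ => SP)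
    (Fin.lastCases (motive := fun _ => SP) (facA u a) (fun j => -mix u j a) j)
    (fun i => Fin.lastCases (motive := fun _ => SP) (-mix u i a)
      (fun j => if i = j then facB u a else 0) j) i

variable (u : ι → SP) (a : ι)

lemma coeff_castSucc_castSucc (i j : Fin 4) :
    coeff u a i.castSucc j.castSucc = (4 * Real.pi ^ 2) • if i = j then facB u a else 0 := by
  simp [coeff]

lemma coeff_castSucc_four (i : Fin 4) :
    coeff u a i.castSucc 4 = (4 * Real.pi ^ 2) • -mix u i a := by
  rw [coeff, Fin.lastCases_castSucc]; exact congrArg _ Fin.lastCases_last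

lemma coeff_four_castSucc (i : Fin 4) :
    coeff u a 4 i.castSucc = (4 * Real.pi ^ 2) • -mix u i a := by
  rw [show (4 : Fin 5) = Fin.last 4 from rfl, coeff, Fin.lastCases_last, Fin.lastCases_castSucc]

lemma coeff_four_four : coeff u a 4 4 = (4 * Real.pi ^ 2) • facA u a :=
  congrArg _ (Fin.lastCases_last.trans Fin.lastCases_last)

lemma sum_sum_castSucc {M : Type*} [AddCommMonoid M] (f : Fin 5 → Fin 5 → M) :
    ∑ i, ∑ j, f i j = ∑ i : Fin 4, (∑ j : Fin 4, f i.castSucc j.castSucc + f i.castSucc 4)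
      + (∑ j : Fin 4, f 4 j.castSucc + f 4 4) := by
  rw [Fin.sum_univ_castSucc (n := 4)]
  simp only [Fin.sum_univ_castSucc (n := 4)]
  rfl

lemma coeff_quadratic (x ξ : Fin 5 → ℝ) :
    ∑ i, ∑ j, (coeff u a i j).1 x * (ξ i * ξ j)
      = 4 * Real.pi ^ 2 * (ev (a, x) (facB u) * ∑ i : Fin 4, ξ i.castSucc ^ 2
        + ev (a, x) (facA u) * ξ 4 ^ 2
        - 2 * ξ 4 * ∑ i : Fin 4, ev (a, x) (mix u i) * ξ i.castSucc) := by
  simp only [sum_sum_castSucc, coeff_castSucc_castSucc, coeff_castSucc_four, coeff_four_castSucc,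
    coeff_four_four, ev_apply]
  simp [Fin.sum_univ_four]
  ring

lemma symbolMat_coeff (n k : Fin 5 → ℤ) :
    symbolMat (coeff u a) n k = (if n = k then 4 * Real.pi ^ 2 * nsq n else 0 : ℝ)
      - 32 * Real.pi ^ 4 * sym (n - k) k * hat (u a) (n - k) := by
  obtain ⟨m, rfl⟩ : ∃ m, n = m + k := ⟨n - k, (sub_add_cancel n k).symm⟩
  have hA : hat (facA u a) m = -(4 * Real.pi ^ 2) * dot4 m m * hat (u a) m
      + if m = 0 then 1 else 0 := by
    rw [facA, Pi.add_apply, Pi.one_apply, hat_add, hat_one, hat_sum_dF_dF4]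
  have hB : hat (facB u a) m = -(4 * Real.pi ^ 2) * (m 4 * m 4) * hat (u a) m
      + if m = 0 then 1 else 0 := by
    rw [facB, Pi.add_apply, Pi.one_apply, hat_add, hat_one, hat_dF_dF]
  have hmix : ∀ i, hat (mix u i a) m
      = -(4 * Real.pi ^ 2) * (m i.castSucc * m 4) * hat (u a) m := fun i => hat_dF_dF u a m _ _
  have hneg : ∀ g, hat (-g) m = - hat g m := fun g => map_neg (hatL m) g
  have h0 : hat 0 m = 0 := map_zero (hatL m)
  have hdiag : (4 * Real.pi ^ 2 * (dot4 (m + k) k + (m + k) 4 * k 4) * if m = 0 then 1 else 0 : ℂ)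
      = (if m + k = k then 4 * Real.pi ^ 2 * nsq (m + k) else 0 : ℝ) := by
    rcases eq_or_ne m 0 with rfl | hm
    · simp [nsq_eq, sq]
    · simp [hm]
  rw [symbolMat, add_sub_cancel_right, ← hdiag]
  simp only [sum_sum_castSucc, coeff_castSucc_castSucc, coeff_castSucc_four, coeff_four_castSucc,
    coeff_four_four, hat_smul, hneg, hmix, hA, hB, apply_ite (hat · m), h0, mul_ite, mul_zero,
    Finset.sum_ite_eq, Finset.mem_univ, if_true]
  simp only [sym, dot4, Fin.sum_univ_four, Pi.add_apply]
  split_ifs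
  · push_cast
    ring
  · push_cast
    ring

end Coeff

end TorusMA

namespace TorusMA

open Filter Topology
open scoped ContDiff ComplexConjugate ENNReal

lemma two_mul_le_of_sq_le {α β s y d : ℝ} (hα : 0 ≤ α) (hβ : 0 ≤ β) (hs : 0 ≤ s)
    (h : d ^ 2 ≤ α * β * s) : 2 * y * d ≤ β * s + α * y ^ 2 := by
  refine abs_le_of_sq_le_sq' ?_ (by positivity) |>.2
  nlinarith [sq_nonneg (β * s - α * y ^ 2), mul_le_mul_of_nonneg_left h (sq_nonneg y)]

lemma Solves.exists_elliptic {ι : Type*} {u f : ι → SP} (h : Solves u f) :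
    ∃ lam > 0, ∀ a (x ξ : Fin 5 → ℝ),
      lam * ∑ i, ξ i ^ 2 ≤ ∑ i, ∑ j, (coeff u a i j).1 x * (ξ i * ξ j) := by
  obtain ⟨c, hc, hfc⟩ := h.pos
  obtain ⟨C, hC, hABC⟩ := h.exists_trace_le
  refine ⟨4 * Real.pi ^ 2 * (c / C), by positivity, fun a x ξ => ?_⟩
  rw [coeff_quadratic, mul_assoc]
  have heq := h.ev_eq (a, x)
  have hA := h.facA_pos (a, x)
  have hB := h.facB_pos (a, x)
  have hfc := hfc (a, x)
  have hABC := hABC (a, x)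
  set A := ev (a, x) (facA u)
  set B := ev (a, x) (facB u)
  set b := fun i => ev (a, x) (mix u i)
  set s := ∑ i : Fin 4, ξ i.castSucc ^ 2
  have hb : (∑ i, b i * ξ i.castSucc) ^ 2 ≤ (∑ i, b i ^ 2) * s :=
    Finset.sum_mul_sq_le_sq_mul_sq _ _ _
  have hs : 0 ≤ s := by positivity
  have hb0 : 0 ≤ ∑ i, b i ^ 2 := by positivity
  have hlam : c / C * C = c := div_mul_cancel₀ _ hC.ne'
  have hlam0 : 0 < c / C := by positivity
  set lam := c / C
  have hA' : lam ≤ A := by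
    by_contra hlt
    nlinarith
  have hB' : lam ≤ B := by
    by_contra hlt
    nlinarith
  have key := two_mul_le_of_sq_le (y := ξ 4) (sub_nonneg.2 hA') (sub_nonneg.2 hB') hs
    (hb.trans (mul_le_mul_of_nonneg_right (by nlinarith) hs))
  have hsum : ∑ i, ξ i ^ 2 = s + ξ 4 ^ 2 := Fin.sum_univ_castSucc _
  rw [hsum]
  gcongr
  linarith

end TorusMA

namespace TorusMA

open Filter Topology
open scoped ContDiff ComplexConjugate ENNReal

/-! ### The Monge-Ampère operator on weighted sequences -/

/-- The kernel of the quadratic part of the Monge-Ampère operator on weighted sequences. -/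
noncomputable def kern (n k : Fin 5 → ℤ) : ℝ :=
  16 * Real.pi ^ 4 * wgt n ^ 5 * (wgt (n - k) ^ 7)⁻¹ * (wgt k ^ 7)⁻¹ * sym (n - k) k

lemma kern_sub (n k : Fin 5 → ℤ) : kern n (n - k) = kern n k := by
  rw [kern, kern, sub_sub_cancel, sym_comm]; ring

lemma kern_neg_neg (n k : Fin 5 → ℤ) : kern (-n) (-k) = kern n k := by
  rw [kern, kern, ← neg_sub', wgt_neg, wgt_neg, wgt_neg, sym_neg_neg]

lemma kern_zero (k : Fin 5 → ℤ) : kern 0 k = 0 := by rw [kern, sym_neg_self, mul_zero]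

lemma wgt_pow_five_le (n k : Fin 5 → ℤ) : wgt n ^ 5 ≤ 16 * (wgt (n - k) ^ 5 + wgt k ^ 5) := by
  have h1 := wgt_add_le (n - k) k
  rw [sub_add_cancel] at h1
  have h2 := wgt_pos n
  calc wgt n ^ 5 ≤ (wgt (n - k) + wgt k) ^ 5 := by gcongr; linarith
    _ ≤ 2 ^ 4 * (wgt (n - k) ^ 5 + wgt k ^ 5) :=
      add_pow_le (wgt_pos _).le (wgt_pos _).le 5
    _ = _ := by norm_num

lemma abs_kern_le (n k : Fin 5 → ℤ) :
    |kern n k| ≤ 512 * Real.pi ^ 4 * ((wgt k ^ 5)⁻¹ + (wgt (n - k) ^ 5)⁻¹) := by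
  have h1 := wgt_pos (n - k)
  have h2 := wgt_pos k
  have h3 := wgt_pos n
  rw [kern, abs_mul, abs_of_nonneg (by positivity)]
  calc _ ≤ 16 * Real.pi ^ 4 * (16 * (wgt (n - k) ^ 5 + wgt k ^ 5)) * (wgt (n - k) ^ 7)⁻¹
        * (wgt k ^ 7)⁻¹ * (2 * (wgt (n - k) ^ 2 * wgt k ^ 2)) := by
        gcongr
        · exact wgt_pow_five_le n k
        · exact abs_sym_le _ _
    _ = _ := by field_simp; ring

lemma kern_sq_le (n k : Fin 5 → ℤ) :
    kern n k ^ 2 ≤ 2 * (512 * Real.pi ^ 4) ^ 2 * ((wgt k ^ 10)⁻¹ + (wgt (n - k) ^ 10)⁻¹) := by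
  have h := pow_le_pow_left₀ (abs_nonneg _) (abs_kern_le n k) 2
  rw [sq_abs, mul_pow] at h
  refine h.trans ?_
  have e : ∀ m : Fin 5 → ℤ, (wgt m ^ 10)⁻¹ = ((wgt m ^ 5)⁻¹) ^ 2 := fun m => by
    rw [← inv_pow, ← inv_pow, ← pow_mul]
  rw [e, e, mul_assoc 2, mul_left_comm]
  gcongr
  exact add_sq_le

lemma hasSum_kern_bound (n : Fin 5 → ℤ) :
    HasSum (fun k => 2 * (512 * Real.pi ^ 4) ^ 2 * ((wgt k ^ 10)⁻¹ + (wgt (n - k) ^ 10)⁻¹))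
      (2 * (512 * Real.pi ^ 4) ^ 2 * (∑' k, (wgt k ^ 10)⁻¹ + ∑' k, (wgt k ^ 10)⁻¹)) :=
  (summable_wgt.hasSum.add ((Equiv.subLeft n).hasSum_iff.2 summable_wgt.hasSum)).mul_left _

lemma summable_kern_sq (n : Fin 5 → ℤ) : Summable fun k => kern n k ^ 2 :=
  (hasSum_kern_bound n).summable.of_nonneg_of_le (fun _ => sq_nonneg _) (kern_sq_le n)

lemma tsum_kern_sq_le (n : Fin 5 → ℤ) :
    ∑' k, kern n k ^ 2 ≤ (1024 * Real.pi ^ 4 * (∑' k, (wgt k ^ 10)⁻¹ + 1)) ^ 2 := by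
  refine ((summable_kern_sq n).tsum_le_tsum (kern_sq_le n) (hasSum_kern_bound n).summable).trans ?_
  rw [(hasSum_kern_bound n).tsum_eq]
  have hS : 0 ≤ ∑' k, (wgt k ^ 10)⁻¹ := tsum_nonneg fun k => by have := wgt_pos k; positivity
  set S := ∑' k, (wgt k ^ 10)⁻¹
  calc 2 * (512 * Real.pi ^ 4) ^ 2 * (S + S) = (1024 * Real.pi ^ 4) ^ 2 * S := by ring
    _ ≤ (1024 * Real.pi ^ 4) ^ 2 * (S + 1) ^ 2 := by gcongr; nlinarith
    _ = _ := by ring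

/-- The polarised quadratic part of the Monge-Ampère operator. -/
noncomputable def quad : L2 →L[ℝ] L2 →L[ℝ] L2 :=
  L2.bil kern (1024 * Real.pi ^ 4 * (∑' k, (wgt k ^ 10)⁻¹ + 1))
    (mul_nonneg (by positivity) (add_nonneg (tsum_nonneg fun k => by
      have := wgt_pos k; positivity) zero_le_one)) summable_kern_sq tsum_kern_sq_le

lemma quad_apply (g h : L2) (n : Fin 5 → ℤ) :
    quad g h n = ∑' k, (kern n k : ℂ) * (g (n - k) * h k) := rfl

lemma quad_comm (g h : L2) : quad g h = quad h g := by
  ext n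
  rw [quad_apply, quad_apply, ← (Equiv.subLeft n).tsum_eq]
  refine tsum_congr fun k => ?_
  rw [Equiv.subLeft_apply, kern_sub, sub_sub_cancel, mul_comm (g k)]

lemma nsq_le (n : Fin 5 → ℤ) : nsq n ≤ 5 * wgt n ^ 2 := by
  calc nsq n ≤ ∑ _i : Fin 5, wgt n ^ 2 := Finset.sum_le_sum fun i _ => by
        rw [← sq_abs]; exact pow_le_pow_left₀ (abs_nonneg _) (by linarith [abs_le_wgt n i]) 2
    _ = _ := by simp

/-- The symbol of the linear part of the Monge-Ampère operator on weighted sequences. -/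
noncomputable def linSym (n : Fin 5 → ℤ) : ℝ :=
  4 * Real.pi ^ 2 * nsq n * (wgt n ^ 2)⁻¹ + if n = 0 then 1 else 0

lemma linSym_neg (n : Fin 5 → ℤ) : linSym (-n) = linSym n := by
  simp [linSym, wgt_neg, nsq]

lemma linSym_zero : linSym 0 = 1 := by simp [linSym, nsq]

lemma norm_linSym_le (n : Fin 5 → ℤ) : ‖(linSym n : ℂ)‖ ≤ 20 * Real.pi ^ 2 + 1 := by
  have h1 := wgt_pos n
  have h0 : 0 ≤ nsq n := Finset.sum_nonneg fun _ _ => sq_nonneg _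
  rw [Complex.norm_real, Real.norm_eq_abs, abs_of_nonneg (by unfold linSym; positivity), linSym]
  refine add_le_add ?_ (by split_ifs <;> norm_num)
  rw [← div_eq_mul_inv, div_le_iff₀ (by positivity)]
  nlinarith [nsq_le n, Real.pi_pos, sq_nonneg Real.pi]

/-- The linear part of the Monge-Ampère operator. -/
noncomputable def linPart : L2 →L[ℝ] L2 :=
  L2.diag (fun n => linSym n) _ norm_linSym_le

/-- The Monge-Ampère operator acting on weighted sequences of Fourier coefficients. -/
noncomputable def maOp (g : L2) : L2 := linPart g - quad g g

lemma maOp_apply (g : L2) (n : Fin 5 → ℤ) :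
    maOp g n = linSym n * g n - ∑' k, (kern n k : ℂ) * (g (n - k) * g k) := rfl

lemma Rapid.memℓp {c : (Fin 5 → ℤ) → ℂ} (hc : Rapid c) (N : ℕ) :
    Memℓp (fun n => (wgt n : ℂ) ^ N * c n) 2 := by
  obtain ⟨C, hC⟩ := hc (N + 5)
  refine L2.mem_of_summable ((summable_wgt.mul_left (C ^ 2)).of_nonneg_of_le
    (fun _ => sq_nonneg _) fun n => ?_)
  have h := wgt_pos n
  have := pow_le_pow_left₀ (by positivity) (hC n) 2
  rw [norm_mul, norm_pow, Complex.norm_real, Real.norm_eq_abs, abs_of_pos h,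
    ← div_eq_mul_inv, le_div_iff₀ (by positivity)]
  calc _ = (wgt n ^ (N + 5) * ‖c n‖) ^ 2 := by ring
    _ ≤ _ := this

/-- The weighted sequence attached to a rapidly decreasing one. -/
noncomputable def Rapid.toL2 {c : (Fin 5 → ℤ) → ℂ} (hc : Rapid c) (N : ℕ) : L2 :=
  ⟨fun n => (wgt n : ℂ) ^ N * c n, hc.memℓp N⟩

lemma Rapid.toL2_apply {c : (Fin 5 → ℤ) → ℂ} (hc : Rapid c) (N : ℕ) (n : Fin 5 → ℤ) :
    hc.toL2 N n = (wgt n : ℂ) ^ N * c n := rfl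

lemma rapid_datum (f : SP) : Rapid fun n => if n = 0 then 0 else -hat f n := fun N => by
  obtain ⟨C, hC⟩ := rapid_hat f N
  refine ⟨C, fun n => le_trans ?_ (hC n)⟩
  have := wgt_pos n
  gcongr
  beta_reduce
  split_ifs <;> simp

/-- The right-hand side of the equation for weighted sequences. -/
noncomputable def datum (f : SP) : L2 := (rapid_datum f).toL2 5

lemma wgt_ne_zero (n : Fin 5 → ℤ) : (wgt n : ℂ) ≠ 0 := by exact_mod_cast (wgt_pos n).ne'

lemma maOp_eq_datum_iff {f : SP} {t : ℝ} {g : L2} {c : (Fin 5 → ℤ) → ℂ}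
    (hg : ∀ n, g n = (wgt n : ℂ) ^ 7 * c n) :
    maOp g = t • datum f ↔ c 0 = 0 ∧ ∀ n, n ≠ 0 → 4 * Real.pi ^ 2 * nsq n * c n
      = ∑' k, (16 * Real.pi ^ 4 * sym (n - k) k : ℂ) * (c (n - k) * c k) - t * hat f n := by
  have hquad : ∀ n, ∑' k, (kern n k : ℂ) * (g (n - k) * g k)
      = wgt n ^ 5 * ∑' k, (16 * Real.pi ^ 4 * sym (n - k) k : ℂ) * (c (n - k) * c k) := fun n => by
    rw [← tsum_mul_left]
    refine tsum_congr fun k => ?_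
    have h1 := wgt_ne_zero (n - k)
    have h2 := wgt_ne_zero k
    rw [hg, hg, kern]
    push_cast
    field_simp
  have h0 : maOp g 0 = c 0 := by
    rw [maOp_apply, linSym_zero, hg]
    simp [kern_zero, wgt]
  have hn : ∀ n, n ≠ 0 → maOp g n = wgt n ^ 5 * (4 * Real.pi ^ 2 * nsq n * c n
      - ∑' k, (16 * Real.pi ^ 4 * sym (n - k) k : ℂ) * (c (n - k) * c k)) := fun n hn => by
    have h1 := wgt_ne_zero n
    rw [maOp_apply, hquad, linSym, if_neg hn, hg]
    push_cast
    field_simp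
    ring
  have hd0 : (t • datum f) 0 = 0 := by
    simp [datum, Rapid.toL2_apply]
  have hdn : ∀ n, n ≠ 0 → (t • datum f) n = wgt n ^ 5 * (-(t * hat f n)) := fun n hn => by
    rw [lp.coeFn_smul, Pi.smul_apply, datum, Rapid.toL2_apply, if_neg hn, Complex.real_smul]
    ring
  constructor
  · intro h
    refine ⟨by rw [← h0, h, hd0], fun n hn0 => ?_⟩
    have := hn n hn0
    rw [h, hdn n hn0] at this
    have := mul_left_cancel₀ (pow_ne_zero 5 (wgt_ne_zero n)) this
    linear_combination -this
  · rintro ⟨hc0, hc⟩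
    ext n
    rcases eq_or_ne n 0 with rfl | hn0
    · rw [h0, hd0, hc0]
    · rw [hn n hn0, hdn n hn0, hc n hn0]
      ring

lemma Good.maOp_eq {f : SP} {t : ℝ} {c : (Fin 5 → ℤ) → ℂ} (h : Good f t c) :
    maOp (h.rapid.toL2 7) = t • datum f :=
  (maOp_eq_datum_iff fun _ => rfl).2 ⟨h.zero, h.eq⟩

lemma good_of_maOp_eq {f : SP} {t : ℝ} {g : L2}
    (hr : Rapid fun n => ((wgt n : ℂ) ^ 7)⁻¹ * g n) (hs : L2.conjNeg g = g)
    (h : maOp g = t • datum f) : Good f t fun n => ((wgt n : ℂ) ^ 7)⁻¹ * g n := by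
  obtain ⟨h0, h1⟩ := (maOp_eq_datum_iff fun n =>
    (mul_inv_cancel_left₀ (pow_ne_zero 7 (wgt_ne_zero n)) (g n)).symm).1 h
  refine ⟨hr, fun n => ?_, h0, h1⟩
  have h2 := congrArg (fun g : L2 => g (-n)) hs
  simp only [L2.conjNeg_apply, neg_neg] at h2
  rw [← h2, wgt_neg]
  simp

end TorusMA

namespace TorusMA

open Filter Topology
open scoped ContDiff ComplexConjugate ENNReal

/-! ### Invertibility of the linearised operator -/

lemma bijective_of_inner_ge {V : Type*} [NormedAddCommGroup V] [InnerProductSpace ℝ V]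
    [CompleteSpace V] {T : V →L[ℝ] V} {c : ℝ} (hc : 0 < c)
    (h : ∀ v, c * ‖v‖ ^ 2 ≤ inner ℝ (T v) v) : Function.Bijective T := by
  let B : V →L[ℝ] V →L[ℝ] ℝ := LinearMap.mkContinuous₂
    (LinearMap.mk₂ ℝ (fun v w => inner ℝ (T v) w)
      (fun v v' w => by rw [map_add, inner_add_left])
      (fun r v w => by rw [map_smul, real_inner_smul_left]; rfl)
      (fun v w w' => inner_add_right _ _ _)
      (fun r v w => real_inner_smul_right _ _ _)) ‖T‖
    fun v w => (norm_inner_le_norm _ _).trans (by gcongr; exact T.le_opNorm v)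
  have hB : IsCoercive B := ⟨c, hc, fun v => by rw [mul_assoc, ← sq]; exact h v⟩
  have : T = hB.continuousLinearEquivOfBilin := by
    ext v
    exact hB.unique_continuousLinearEquivOfBilin fun w => rfl
  rw [this]
  exact hB.continuousLinearEquivOfBilin.bijective

/-- The linearisation of the Monge-Ampère operator. -/
noncomputable def linOp (g : L2) : L2 →L[ℝ] L2 := linPart - (quad g + quad g)

lemma hasFDerivAt_maOp (g : L2) : HasFDerivAt maOp (linOp g) g := by
  have h := linPart.hasFDerivAt.sub
    ((quad.hasFDerivAt (x := g)).clm_apply (hasFDerivAt_id (𝕜 := ℝ) g))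
  refine h.congr_fderiv ?_
  ext1 h
  change linPart h - (quad g h + quad h g) = linPart h - (quad g h + quad g h)
  rw [quad_comm h g]

lemma contDiff_maOp {n : WithTop ℕ∞} : ContDiff ℝ n maOp :=
  linPart.contDiff.sub (quad.contDiff.clm_apply contDiff_id)

lemma linOp_apply_of_support (g : L2) {h : L2} {S : Finset (Fin 5 → ℤ)} (hS : ∀ k ∉ S, h k = 0)
    {n : Fin 5 → ℤ} (hn : n ∈ S) :
    linOp g h n
      = ∑ k ∈ S, ((if n = k then linSym n else 0 : ℝ) - 2 * kern n k * g (n - k)) * h k := by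
  have h1 : linOp g h n = linSym n * h n - 2 * ∑' k, (kern n k : ℂ) * (g (n - k) * h k) := by
    rw [two_mul]; rfl
  rw [h1, tsum_eq_sum (s := S) fun k hk => by rw [hS k hk, mul_zero, mul_zero], Finset.mul_sum]
  simp only [sub_mul, Finset.sum_sub_distrib]
  congr 1
  · rw [Finset.sum_eq_single_of_mem n hn fun k _ hk => by rw [if_neg hk.symm]; simp, if_pos rfl]
  · exact Finset.sum_congr rfl fun k _ => by ring

lemma symbolMat_coeff_mul {φ : SP} {g : L2} (hg : ∀ n, g n = (wgt n : ℂ) ^ 7 * hat φ n)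
    (n k : Fin 5 → ℤ) :
    symbolMat (coeff (fun _ : Unit => φ) ()) n k * (wgt n ^ 5 * (wgt k ^ 7)⁻¹ : ℝ)
        + (if n = k ∧ n = 0 then 1 else 0)
      = (if n = k then linSym n else 0 : ℝ) - 2 * kern n k * g (n - k) := by
  have h1 := wgt_ne_zero n
  have h2 := wgt_ne_zero k
  have h3 := wgt_ne_zero (n - k)
  have h4 : 32 * Real.pi ^ 4 * sym (n - k) k * hat φ (n - k) * (wgt n ^ 5 * (wgt k ^ 7)⁻¹ : ℝ)
      = 2 * kern n k * g (n - k) := by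
    rw [hg, kern]
    push_cast
    field_simp
    ring
  rw [symbolMat_coeff, sub_mul, h4]
  rcases eq_or_ne n k with rfl | hnk
  · simp only [if_true, true_and, linSym]
    split_ifs <;> push_cast <;> field_simp <;> ring
  · simp [hnk]

lemma exists_linOp_coercive {f φ : SP} (h : Solves (fun _ : Unit => φ) (fun _ => f)) {g : L2}
    (hg : ∀ n, g n = (wgt n : ℂ) ^ 7 * hat φ n) :
    ∃ G : L2 →L[ℝ] L2, Function.Injective G ∧ ∃ c > 0, ∀ v : L2,
      c * ‖v‖ ^ 2 ≤ inner ℝ (G (linOp g v)) v := by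
  obtain ⟨lam, hlam, hell⟩ := h.exists_elliptic
  obtain ⟨K, c, hK, hc, hG⟩ := exists_garding hlam (hell ())
  have hw : ∀ n, 0 ≤ K * (wgt n ^ 12)⁻¹ := fun n => by have := wgt_pos n; positivity
  have hd : ∀ n, ‖((1 + K * (wgt n ^ 12)⁻¹ : ℝ) : ℂ)‖ ≤ 1 + K := fun n => by
    rw [Complex.norm_real, Real.norm_eq_abs, abs_of_nonneg (by linarith [hw n])]
    gcongr
    exact mul_le_of_le_one_right hK (inv_le_one_of_one_le₀ (one_le_pow₀ (one_le_wgt n)))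
  refine ⟨L2.diag _ _ hd, fun v w hvw => ?_, c, hc, fun v => ?_⟩
  · ext n
    have h1 := congrArg (fun g : L2 => g n) hvw
    simp only [L2.diag_apply] at h1
    exact mul_left_cancel₀ (Complex.ofReal_ne_zero.2 (by linarith [hw n])) h1
  · have hlim : Tendsto (fun S : Finset (Fin 5 → ℤ) => ∑ n ∈ S, lp.single 2 n (v n)) atTop (𝓝 v) :=
      lp.hasSum_single (by simp) v
    refine le_of_tendsto_of_tendsto' ((hlim.norm.pow 2).const_mul c)
      ((((L2.diag _ _ hd).comp (linOp g)).continuous.tendsto v |>.comp hlim).inner hlim) fun S => ?_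
    set w : L2 := ∑ n ∈ S, lp.single 2 n (v n) with hwdef
    have hwS : ∀ k ∉ S, w k = 0 := fun k hk => by
      rw [hwdef, lp.coeFn_sum, Finset.sum_apply]
      refine Finset.sum_eq_zero fun n hn => ?_
      rw [lp.single_apply_ne]
      rintro rfl
      exact hk hn
    have h1 : ‖w‖ ^ 2 = ∑ n ∈ S, ‖w n‖ ^ 2 :=
      (L2.hasSum_sq w).unique (hasSum_sum_of_ne_finset_zero fun k hk => by simp [hwS k hk])
    rw [h1]
    refine (hG S w).trans_eq ?_
    rw [Function.comp_apply, ContinuousLinearMap.comp_apply, lp.inner_eq_tsum,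
      tsum_eq_sum (s := S) fun k hk => by rw [hwS k hk, inner_zero_right], Complex.re_sum]
    refine Finset.sum_congr rfl fun n hn => ?_
    rw [real_inner_comm, Complex.inner, L2.diag_apply, linOp_apply_of_support g hwS hn]
    simp only [symbolMat_coeff_mul hg, Finset.mul_sum, Finset.sum_mul]
    exact congrArg Complex.re (Finset.sum_congr rfl fun k _ => by ring)

end TorusMA

namespace TorusMA

open Filter Topology
open scoped ContDiff ComplexConjugate ENNReal

lemma Solves.bijective_linOp {f φ : SP} (h : Solves (fun _ : Unit => φ) (fun _ => f)) {g : L2}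
    (hg : ∀ n, g n = (wgt n : ℂ) ^ 7 * hat φ n) : Function.Bijective (linOp g) := by
  obtain ⟨G, hG, c, hc, hle⟩ := exists_linOp_coercive h hg
  have hb := bijective_of_inner_ge (T := G.comp (linOp g)) hc hle
  refine ⟨Function.Injective.of_comp (f := G) hb.1, fun y => ?_⟩
  obtain ⟨x, hx⟩ := hb.2 (G y)
  exact ⟨x, hG hx⟩

lemma exists_localInverse_maOp {g₀ : L2} (h : Function.Bijective (linOp g₀)) :
    ∃ ψ : L2 → L2, ψ (maOp g₀) = g₀ ∧
      (∀ᶠ y in 𝓝 (maOp g₀), ContDiffAt ℝ ω ψ y ∧ maOp (ψ y) = y) ∧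
      ∀ᶠ g in 𝓝 g₀, ψ (maOp g) = g := by
  let E : L2 ≃L[ℝ] L2 := .ofBijective (linOp g₀) (LinearMap.ker_eq_bot.2 h.1)
    (LinearMap.range_eq_top.2 h.2)
  have hE : HasFDerivAt maOp (E : L2 →L[ℝ] L2) g₀ := by
    refine (hasFDerivAt_maOp g₀).congr_fderiv ?_
    ext1 v
    rfl
  have hc : ContDiffAt ℝ ω maOp g₀ := contDiff_maOp.contDiffAt
  have h0 : (ω : WithTop ℕ∞) ≠ 0 := by simp
  let e := hc.toOpenPartialHomeomorph maOp hE h0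
  refine ⟨hc.localInverse hE h0, hc.localInverse_apply_image hE h0,
    ((hc.to_localInverse hE h0).eventually (by simp)).and ?_, ?_⟩
  · exact (hc.hasStrictFDerivAt' hE h0).eventually_right_inverse
  · exact (hc.hasStrictFDerivAt' hE h0).eventually_left_inverse

/-! ### Translations -/

/-- The Fourier multiplier of the translation by `s` in the direction `j`. -/
noncomputable def expo (j : Fin 5) (s : ℝ) (n : Fin 5 → ℤ) : ℂ :=
  Complex.exp (2 * Real.pi * Complex.I * n j * s)

lemma norm_expo (j : Fin 5) (s : ℝ) (n : Fin 5 → ℤ) : ‖expo j s n‖ = 1 := by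
  rw [expo, show 2 * Real.pi * Complex.I * n j * s
    = ((2 * Real.pi * n j * s : ℝ) : ℂ) * Complex.I by
    push_cast; ring, Complex.norm_exp_ofReal_mul_I]

lemma expo_zero (j : Fin 5) (n : Fin 5 → ℤ) : expo j 0 n = 1 := by simp [expo]

lemma expo_sub_mul (j : Fin 5) (s : ℝ) (n k : Fin 5 → ℤ) :
    expo j s (n - k) * expo j s k = expo j s n := by
  rw [expo, expo, expo, ← Complex.exp_add, Pi.sub_apply]
  push_cast
  ring_nf

/-- Translation by `s` in the direction `j`. -/
noncomputable def trans (j : Fin 5) (s : ℝ) : L2 →L[ℝ] L2 :=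
  L2.diag (expo j s) 1 fun n => (norm_expo j s n).le

lemma trans_apply (j : Fin 5) (s : ℝ) (g : L2) (n : Fin 5 → ℤ) :
    trans j s g n = expo j s n * g n := rfl

lemma trans_zero (j : Fin 5) (g : L2) : trans j 0 g = g := by
  ext n
  rw [trans_apply, expo_zero, one_mul]

lemma maOp_trans (j : Fin 5) (s : ℝ) (g : L2) : maOp (trans j s g) = trans j s (maOp g) := by
  ext n
  rw [trans_apply, maOp_apply, maOp_apply, mul_sub, ← tsum_mul_left]
  congr 1
  · rw [trans_apply]; ring
  · refine tsum_congr fun k => ?_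
    rw [trans_apply, trans_apply, ← expo_sub_mul j s n k]
    ring

lemma tendsto_trans (j : Fin 5) (g : L2) : Tendsto (fun s => trans j s g) (𝓝 0) (𝓝 g) := by
  have h1 : ∀ s, HasSum (fun n => ‖(expo j s n - 1) * g n‖ ^ 2) (‖trans j s g - g‖ ^ 2) :=
    fun s => by
    convert L2.hasSum_sq (trans j s g - g) using 4 with n
    rw [lp.coeFn_sub, Pi.sub_apply, trans_apply]
    ring
  have h2 : Continuous fun s => ∑' n, ‖(expo j s n - 1) * g n‖ ^ 2 := by
    refine continuous_tsum (u := fun n => 2 ^ 2 * ‖g n‖ ^ 2) (fun n => by unfold expo; fun_prop)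
      ((L2.hasSum_sq g).summable.mul_left _) fun n s => ?_
    rw [Real.norm_of_nonneg (sq_nonneg _), norm_mul, mul_pow]
    gcongr
    calc ‖expo j s n - 1‖ ≤ ‖expo j s n‖ + ‖(1 : ℂ)‖ := norm_sub_le _ _
      _ = 2 := by rw [norm_expo, norm_one]; norm_num
  simp only [(h1 _).tsum_eq] at h2
  have h3 := h2.tendsto 0
  rw [trans_zero, sub_self, norm_zero, zero_pow two_ne_zero] at h3
  refine tendsto_iff_norm_sub_tendsto_zero.2 ?_
  simpa [Real.sqrt_sq] using h3.sqrt

lemma conjNeg_maOp (g : L2) : L2.conjNeg (maOp g) = maOp (L2.conjNeg g) := by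
  ext n
  rw [L2.conjNeg_apply, maOp_apply, maOp_apply, map_sub, Complex.conj_tsum,
    ← (Equiv.neg _).tsum_eq]
  congr 1
  · rw [L2.conjNeg_apply, map_mul, linSym_neg, Complex.conj_ofReal]
  · refine tsum_congr fun k => ?_
    rw [Equiv.neg_apply, kern_neg_neg, L2.conjNeg_apply, L2.conjNeg_apply, map_mul, map_mul,
      Complex.conj_ofReal, neg_sub_neg, neg_sub]

lemma conjNeg_datum (f : SP) : L2.conjNeg (datum f) = datum f := by
  ext n
  rw [L2.conjNeg_apply, datum, Rapid.toL2_apply, Rapid.toL2_apply, hat_neg]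
  rcases eq_or_ne n 0 with rfl | hn
  · simp
  · simp [hn, wgt_neg]

lemma contDiff_expo_mul (j : Fin 5) (n : Fin 5 → ℤ) (z : ℂ) :
    ContDiff ℝ (⊤ : ℕ∞) fun s => expo j s n * z :=
  (contDiff_cexp_real _).mul contDiff_const

lemma norm_iteratedFDeriv_expo_mul (j : Fin 5) (n : Fin 5 → ℤ) (z : ℂ) (k : ℕ) (s : ℝ) :
    ‖iteratedFDeriv ℝ k (fun s => expo j s n * z) s‖ = (2 * Real.pi * |(n j : ℝ)|) ^ k * ‖z‖ := by
  simp only [norm_iteratedFDeriv_eq_norm_iteratedDeriv, expo]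
  rw [iteratedDeriv_mul_const_field, iteratedDeriv_cexp_real, norm_mul, norm_mul, norm_pow, ← expo,
    norm_expo, mul_one]
  simp [abs_of_pos Real.pi_pos]

lemma contDiff_trans_toL2 (j : Fin 5) {c : (Fin 5 → ℤ) → ℂ} (hc : Rapid c) (N : ℕ) :
    ContDiff ℝ (⊤ : ℕ∞) fun s => trans j s (hc.toL2 N) := by
  have h1 : ∀ s, trans j s (hc.toL2 N)
      = ∑' n, lp.singleContinuousLinearMap ℝ (fun _ : Fin 5 → ℤ => ℂ) 2 n
        (expo j s n * hc.toL2 N n) := fun s =>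
    (lp.hasSum_single (by simp) (trans j s (hc.toL2 N))).tsum_eq.symm
  simp only [h1]
  refine contDiff_tsum (v := fun k n => (2 * Real.pi) ^ k * (wgt n ^ (k + N) * ‖c n‖))
    (fun n => (ContinuousLinearMap.contDiff _).comp (contDiff_expo_mul j n _))
    (fun k _ => (hc.summable_wgt_mul _).mul_left _) fun k n s _ => ?_
  have hw := wgt_pos n
  have hL : ‖lp.singleContinuousLinearMap ℝ (fun _ : Fin 5 → ℤ => ℂ) 2 n‖ ≤ 1 :=
    ContinuousLinearMap.opNorm_le_bound _ zero_le_one fun z => by simp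
  refine (ContinuousLinearMap.norm_iteratedFDeriv_comp_left _
    (contDiff_expo_mul j n _).contDiffAt (by exact_mod_cast le_top)).trans ?_
  rw [norm_iteratedFDeriv_expo_mul, Rapid.toL2_apply, norm_mul, norm_pow, Complex.norm_real,
    Real.norm_eq_abs, abs_of_pos hw, mul_pow]
  calc _ ≤ 1 * ((2 * Real.pi) ^ k * wgt n ^ k * (wgt n ^ N * ‖c n‖)) := by
        gcongr
        linarith [abs_le_wgt n j]
    _ = _ := by ring

lemma wgt_le_six_mul {n : Fin 5 → ℤ} (hn : n ≠ 0) : ∃ j, wgt n ≤ 6 * |(n j : ℝ)| := by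
  obtain ⟨j, -, hj⟩ := Finset.exists_max_image Finset.univ (fun j => |(n j : ℝ)|)
    Finset.univ_nonempty
  obtain ⟨i, hi⟩ := Function.ne_iff.1 hn
  have h1 : (1 : ℝ) ≤ |(n i : ℝ)| := by exact_mod_cast Int.one_le_abs hi
  have h2 : ∑ i, |(n i : ℝ)| ≤ ∑ _i : Fin 5, |(n j : ℝ)| :=
    Finset.sum_le_sum fun i _ => hj i (by simp)
  have h3 := hj i (by simp)
  rw [Finset.sum_const, Finset.card_univ, Fintype.card_fin, nsmul_eq_mul] at h2
  push_cast at h2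
  exact ⟨j, by unfold wgt; linarith⟩

lemma rapid_of_contDiffAt_trans {g : L2}
    (h : ∀ j, ContDiffAt ℝ (⊤ : ℕ∞) (fun s => trans j s g) 0) : Rapid g := fun N => by
  refine ⟨6 ^ N * ∑ j, ‖iteratedFDeriv ℝ N (fun s => trans j s g) 0‖ + ‖g 0‖, fun n => ?_⟩
  rcases eq_or_ne n 0 with rfl | hn
  · have : wgt 0 = 1 := by simp [wgt]
    rw [this, one_pow, one_mul]
    exact le_add_of_nonneg_left (by positivity)
  obtain ⟨j, hj⟩ := wgt_le_six_mul hn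
  have hw := wgt_pos n
  let L : L2 →L[ℝ] ℂ := lp.evalCLM ℝ (fun _ : Fin 5 → ℤ => ℂ) 2 n
  have hL : ‖L‖ ≤ 1 := ContinuousLinearMap.opNorm_le_bound _ zero_le_one fun z => by
    rw [one_mul]; exact lp.norm_apply_le_norm two_ne_zero z n
  have h1 := L.norm_iteratedFDeriv_comp_left (h j) (n := N) (by exact_mod_cast le_top)
  have h2 : L ∘ (fun s => trans j s g) = fun s => expo j s n * g n := rfl
  rw [h2] at h1
  rw [norm_iteratedFDeriv_expo_mul] at h1
  calc wgt n ^ N * ‖g n‖ ≤ (6 * (2 * Real.pi * |(n j : ℝ)|)) ^ N * ‖g n‖ := by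
        gcongr
        nlinarith [Real.pi_gt_three, abs_nonneg (n j : ℝ)]
    _ = 6 ^ N * ((2 * Real.pi * |(n j : ℝ)|) ^ N * ‖g n‖) := by rw [mul_pow 6]; ring
    _ ≤ 6 ^ N * (1 * ‖iteratedFDeriv ℝ N (fun s => trans j s g) 0‖) := by
        exact mul_le_mul_of_nonneg_left (h1.trans (by gcongr)) (by positivity)
    _ ≤ 6 ^ N * ∑ j, ‖iteratedFDeriv ℝ N (fun s => trans j s g) 0‖ := by
        rw [one_mul]
        gcongr
        exact Finset.single_le_sum (f := fun j => ‖iteratedFDeriv ℝ N (fun s => trans j s g) 0‖)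
          (fun _ _ => norm_nonneg _) (Finset.mem_univ j)
    _ ≤ _ := le_add_of_nonneg_right (norm_nonneg _)

lemma Rapid.inv_wgt_mul {c : (Fin 5 → ℤ) → ℂ} (hc : Rapid c) (k : ℕ) :
    Rapid fun n => ((wgt n : ℂ) ^ k)⁻¹ * c n := fun N => by
  obtain ⟨C, hC⟩ := hc N
  refine ⟨C, fun n => le_trans ?_ (hC n)⟩
  have hw := wgt_pos n
  gcongr
  rw [norm_mul, norm_inv, norm_pow, Complex.norm_real, Real.norm_eq_abs, abs_of_pos hw]
  exact mul_le_of_le_one_left (norm_nonneg _) (inv_le_one_of_one_le₀ (one_le_pow₀ (one_le_wgt n)))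

/-! ### Openness -/

lemma Good.eventually {f : SP} (hpos : ∀ x, 0 < f.1 x) (hf : hat f 0 = 1) {t₀ : ℝ}
    (ht₀ : t₀ ∈ Set.Icc (0 : ℝ) 1) {c₀ : (Fin 5 → ℤ) → ℂ} (h : Good f t₀ c₀) :
    ∀ᶠ t in 𝓝 t₀, ∃ c, Good f t c := by
  obtain ⟨φ, hφ, hMA⟩ := h.exists_solution hf
  have hsol : Solves (fun _ : Unit => φ) (fun _ => rhs f t₀) :=
    solves_rhs hpos (fun _ => ht₀) (funext fun _ => hMA)
  set g₀ := h.rapid.toL2 7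
  have hconj₀ : L2.conjNeg g₀ = g₀ := by
    ext n
    rw [L2.conjNeg_apply, Rapid.toL2_apply, Rapid.toL2_apply, h.symm, wgt_neg]
    simp
  obtain ⟨ψ, hψ₀, hψ, hinv⟩ := exists_localInverse_maOp
    (hsol.bijective_linOp (g := g₀) fun n => by rw [hφ]; rfl)
  have hψc : Tendsto ψ (𝓝 (maOp g₀)) (𝓝 g₀) := by
    have := hψ.self_of_nhds.1.continuousAt.tendsto
    rwa [hψ₀] at this
  have hy : Tendsto (fun t : ℝ => t • datum f) (𝓝 t₀) (𝓝 (maOp g₀)) := by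
    rw [h.maOp_eq]
    exact (continuous_id.smul continuous_const).tendsto t₀
  have hconj : Tendsto L2.conjNeg (𝓝 g₀) (𝓝 g₀) := by
    have := L2.conjNeg.continuous.tendsto g₀
    rwa [hconj₀] at this
  filter_upwards [hy.eventually hψ, (hψc.comp hy).eventually hinv.eventually_nhds,
    (hconj.comp (hψc.comp hy)).eventually hinv] with t ⟨hsm, heq⟩ hnear hcn
  set g := ψ (t • datum f)
  refine ⟨_, good_of_maOp_eq (g := g) (Rapid.inv_wgt_mul (rapid_of_contDiffAt_trans fun j => ?_) 7)
    ?_ heq⟩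
  · have h1 : (fun s => trans j s g) =ᶠ[𝓝 0] fun s => ψ (t • trans j s (datum f)) := by
      filter_upwards [(tendsto_trans j g).eventually hnear] with s hs
      rw [← hs, maOp_trans, heq, map_smul]
    refine ContDiffAt.congr_of_eventuallyEq ?_ h1
    refine ContDiffAt.comp (0 : ℝ) ?_
      ((contDiff_trans_toL2 j (rapid_datum f) 5).const_smul t).contDiffAt
    rw [trans_zero]
    exact hsm.of_le le_top
  · have : L2.conjNeg g = ψ (maOp (L2.conjNeg g)) := hcn.symm
    rw [this, ← conjNeg_maOp, heq, map_smul, conjNeg_datum]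

end TorusMA

namespace TorusMA

open Filter Topology

/-! ### The continuity path reaches the endpoint -/

lemma exists_good_one {f : SP} (hpos : ∀ x, 0 < f.1 x) (hf : hat f 0 = 1) : ∃ c, Good f 1 c := by
  have h0 : IsClosed ({t | ∃ c, Good f t c} ∩ Set.Icc (0 : ℝ) 1) := by
    rw [Set.inter_comm]
    exact isClosed_setOf_good hpos hf
  exact h0.Icc_subset_of_forall_mem_nhdsWithin ⟨0, good_zero f⟩
    (fun t ⟨⟨_, hc⟩, ht⟩ => nhdsWithin_le_nhds (hc.eventually hpos hf ⟨ht.1, ht.2.le⟩))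
    (Set.right_mem_Icc.2 zero_le_one)

/-- The exponential of a smooth function on `T⁵`. -/
noncomputable def expSP (F : SP) : SP :=
  ⟨fun x => Real.exp (F.1 x), F.contDiff.exp, fun x i => congrArg Real.exp (F.periodic x i)⟩

lemma hat_expSP_zero (F : SP)
    (h : ∫ x in Set.Icc (0 : Fin 5 → ℝ) 1, (Real.exp (F.1 x) - 1) = 0) : hat (expSP F) 0 = 1 := by
  have hint : IntegrableOn (fun x => Real.exp (F.1 x)) (Set.Icc (0 : Fin 5 → ℝ) 1) :=
    F.continuous.rexp.continuousOn.integrableOn_compact isCompact_Icc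
  rw [integral_sub hint (continuous_const.integrableOn_Icc), sub_eq_zero] at h
  have h1 := hat_zero_eq (expSP F) 0
  have h2 : (fun i => (0 : Fin 5 → ℝ) i + 1) = 1 := by ext; simp
  rw [h2] at h1
  rw [h1]
  change ((∫ x in Set.Icc (0 : Fin 5 → ℝ) 1, Real.exp (F.1 x) : ℝ) : ℂ) = 1
  rw [h]
  simp [Real.volume_Icc_pi, Measure.real]

end TorusMA

open TorusMA

/-- Main theorem: solvability of the quaternionic Monge–Ampère equation on `T⁵`. -/
theorem solvability_of_quaternionic_MA_on_T5
    (F : (Fin 5 → ℝ) → ℝ) (hF : ContDiff ℝ (⊤ : ℕ∞) F) (hFper : PeriodicPi F)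
    (hnorm : ∫ x in Set.Icc (0 : Fin 5 → ℝ) 1, (Real.exp (F x) - 1) = 0) :
    ∃ φ : (Fin 5 → ℝ) → ℝ, ContDiff ℝ (⊤ : ℕ∞) φ ∧ PeriodicPi φ ∧
      (∫ x in Set.Icc ((fun _ => -(1/2)) : Fin 5 → ℝ) (fun _ => 1/2), φ x) = 0 ∧
      EqStar F φ := by
  have hf : hat (expSP ⟨F, hF, hFper⟩) 0 = 1 := hat_expSP_zero _ hnorm
  obtain ⟨c, hc⟩ := exists_good_one (fun x => Real.exp_pos _) hf
  obtain ⟨φ, hφ, hMA⟩ := hc.exists_solution hf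
  refine ⟨φ.1, φ.contDiff, φ.periodic, ?_, fun x => ?_⟩
  · have h := hat_zero_eq φ fun _ => -(1 / 2)
    rw [hφ, hc.zero, eq_comm, Complex.ofReal_eq_zero] at h
    convert h using 4
    norm_num
  · have h := congrArg (fun g : SP => g.1 x) hMA
    have h1 : ev ((), x) (opMA fun _ => φ) = Real.exp (F x) := by
      refine h.trans ?_
      simp [rhs, expSP]
    simp only [opMA, facA, facB, mix, map_sub, map_add, map_mul, map_one,
      Fin.sum_univ_four] at h1
    rw [← h1]
    change (pd2 0 0 φ.1 x + pd2 1 1 φ.1 x + pd2 2 2 φ.1 x + pd2 3 3 φ.1 x + 1)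
      * (pd2 4 4 φ.1 x + 1) - (pd2 0 4 φ.1 x) ^ 2 - (pd2 1 4 φ.1 x) ^ 2 - (pd2 2 4 φ.1 x) ^ 2
      - (pd2 3 4 φ.1 x) ^ 2 = (pd2 0 0 φ.1 x + pd2 1 1 φ.1 x + pd2 2 2 φ.1 x + pd2 3 3 φ.1 x + 1)
      * (pd2 4 4 φ.1 x + 1) - (pd2 0 4 φ.1 x * pd2 0 4 φ.1 x + pd2 1 4 φ.1 x * pd2 1 4 φ.1 x
      + pd2 2 4 φ.1 x * pd2 2 4 φ.1 x + pd2 3 4 φ.1 x * pd2 3 4 φ.1 x)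
    ring
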